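/- arXiv:1701.02762 — 6 statements merged into one kernel-verified Lean document; each statement's English description precedes it below -/
import Mathlib

section
/- Let S and C be compact subsets of ℝ with dimH C > 0, and let B ⊆ ℝ be a Borel set such that for every x ∈ S there exists r ∈ ℝ with x + r • C ⊆ B. Then dimH B ≥ (dimH S) / 2. -/
open MeasureTheory
open scoped ENNReal Pointwise

/-- A one-dimensional Frostman lemma. -/
theorem frostman_aux (C : Set ℝ) (hC : IsCompact C) (s : ℝ) (hs : 0 < s)
    (h : Measure.hausdorffMeasure s C ≠ 0) :
    ∃ (μ : Measure ℝ) (A : ℝ), IsFiniteMeasure μ ∧ μ Set.univ ≠ 0 ∧ μ Cᶜ = 0 ∧ 0 < A ∧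
      ∀ c ρ : ℝ, 0 < ρ → μ (Metric.closedBall c ρ) ≤ ENNReal.ofReal (A * ρ ^ s) := by
  obtain ⟨r0, hr0, hH0⟩ : ∃ r0 : ℝ, 0 < r0 ∧ OuterMeasure.mkMetric'.pre
      (fun t : Set ℝ => Metric.ediam t ^ s) (ENNReal.ofReal r0) C ≠ 0 := by
    by_contra! hcon
    apply h
    have e : Measure.hausdorffMeasure s C
        = OuterMeasure.mkMetric (X := ℝ) (fun r => r ^ s) C := by
      rw [OuterMeasure.coe_mkMetric]; rfl
    rw [e, OuterMeasure.mkMetric, OuterMeasure.mkMetric']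
    simp only [OuterMeasure.iSup_apply, ENNReal.iSup_eq_zero]
    intro r hr
    obtain ⟨q, hq0, hq⟩ := ENNReal.lt_iff_exists_nnreal_btwn.1 hr
    have h1 := hcon q (by exact_mod_cast hq0)
    have h2 := OuterMeasure.mkMetric'.mono_pre (fun t : Set ℝ => Metric.ediam t ^ s)
      (r := ENNReal.ofReal q) (r' := r) (by simpa using hq.le) C
    exact le_antisymm (h2.trans h1.le) bot_le
  set H : OuterMeasure ℝ := OuterMeasure.mkMetric'.pre
      (fun t : Set ℝ => Metric.ediam t ^ s) (ENNReal.ofReal r0) with hH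
  have hpre : ∀ t : Set ℝ, Metric.ediam t ≤ ENNReal.ofReal r0 → H t ≤ Metric.ediam t ^ s :=
    fun t ht => OuterMeasure.mkMetric'.pre_le ht
  have hIcc : ∀ a b : ℝ, b - a ≤ r0 → a ≤ b → H (Set.Icc a b) ≤ ENNReal.ofReal ((b - a) ^ s) := by
    intro a b hab hab'
    have := hpre (Set.Icc a b) (by rw [Real.ediam_Icc]; exact ENNReal.ofReal_le_ofReal hab)
    rwa [Real.ediam_Icc, ENNReal.ofReal_rpow_of_nonneg (by linarith) hs.le] at this
  have hfin : H C < ⊤ := by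
    refine hC.induction_on (p := fun A => H A < ⊤) (by simp) (fun A B hAB hB =>
      (measure_mono hAB).trans_lt hB) (fun A B hA hB => (measure_union_le A B).trans_lt
        (ENNReal.add_lt_top.2 ⟨hA, hB⟩)) (fun x _ => ?_)
    refine ⟨Set.Icc (x - r0 / 2) (x + r0 / 2), mem_nhdsWithin_of_mem_nhds
      (Icc_mem_nhds (by linarith) (by linarith)), ?_⟩
    exact (hIcc _ _ (by linarith) (by linarith)).trans_lt ENNReal.ofReal_lt_top
  have hfin' : ∀ A, A ⊆ C → H A ≠ ⊤ := fun A hA => ((measure_mono hA).trans_lt hfin).ne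
  set F : ℝ → ℝ := fun x => (H (C ∩ Set.Iic x)).toReal with hF
  have hmono : Monotone F := fun x y hxy => ENNReal.toReal_mono (hfin' _ Set.inter_subset_left)
    (measure_mono (Set.inter_subset_inter_right _ (Set.Iic_subset_Iic.2 hxy)))
  have hdiff : ∀ x y, x ≤ y → F y - F x ≤ (H (C ∩ Set.Ioc x y)).toReal := by
    intro x y hxy
    rw [sub_le_iff_le_add', hF]
    simp only
    rw [← ENNReal.toReal_add (hfin' _ Set.inter_subset_left) (hfin' _ Set.inter_subset_left)]
    refine ENNReal.toReal_mono (ENNReal.add_ne_top.2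
      ⟨hfin' _ Set.inter_subset_left, hfin' _ Set.inter_subset_left⟩) ?_
    refine (measure_mono ?_).trans (measure_union_le _ _)
    rw [← Set.inter_union_distrib_left, Set.Iic_union_Ioc_eq_Iic hxy]
  have hhol : ∀ x y, x ≤ y → y - x ≤ r0 → F y - F x ≤ (y - x) ^ s := by
    intro x y hxy hr
    refine (hdiff x y hxy).trans ?_
    refine ENNReal.toReal_le_of_le_ofReal (Real.rpow_nonneg (by linarith) _) ?_
    exact (measure_mono (Set.inter_subset_right.trans Set.Ioc_subset_Icc_self)).trans
      (hIcc x y hr hxy)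
  have hFle : ∀ x, F x ≤ (H C).toReal := fun x =>
    ENNReal.toReal_mono hfin.ne (measure_mono Set.inter_subset_left)
  have hF0 : ∀ x, 0 ≤ F x := fun x => ENNReal.toReal_nonneg
  have hrc : ∀ x, ContinuousWithinAt F (Set.Ici x) x := by
    intro x
    have h1 : Filter.Tendsto (fun y : ℝ => F x + (y - x) ^ s) (nhdsWithin x (Set.Ici x))
        (nhds (F x)) := by
      have : ContinuousAt (fun y : ℝ => F x + (y - x) ^ s) x := by
        refine continuousAt_const.add (ContinuousAt.rpow_const (by fun_prop) (Or.inr hs.le))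
      have h2 := this.tendsto
      simp only [sub_self, Real.zero_rpow hs.ne', add_zero] at h2
      exact h2.mono_left nhdsWithin_le_nhds
    refine tendsto_of_tendsto_of_tendsto_of_le_of_le' tendsto_const_nhds h1 ?_ ?_
    · filter_upwards [self_mem_nhdsWithin] with y hy using hmono hy
    · filter_upwards [self_mem_nhdsWithin, mem_nhdsWithin_of_mem_nhds
        (Iic_mem_nhds (show x < x + r0 by linarith))] with y hy hy2
      have := hhol x y hy (by have := Set.mem_Iic.1 hy2; linarith)
      linarith
  let f : StieltjesFunction ℝ := ⟨F, hmono, hrc⟩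
  have hfI : ∀ a b, f.measure (Set.Ioc a b) = ENNReal.ofReal (F b - F a) :=
    fun a b => f.measure_Ioc a b
  obtain ⟨M, hM⟩ := hC.isBounded.subset_closedBall (0 : ℝ)
  rw [Real.closedBall_eq_Icc] at hM
  set m := (H C).toReal with hm
  have hmpos : 0 < m := ENNReal.toReal_pos hH0 hfin.ne
  have hFM : F M = m := by
    rw [hm, hF]; simp only
    rw [Set.inter_eq_left.2 (fun c hc => by have := hM hc; simp at this; exact this.2)]
  have hFM' : F (-M - 1) = 0 := by
    rw [hF]; simp only
    rw [(Set.eq_empty_iff_forall_notMem (s := C ∩ Set.Iic (-M - 1))).2]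
    · simp
    · rintro c ⟨hc, hc'⟩
      have := hM hc
      simp at this hc'
      linarith
  refine ⟨f.measure.restrict (Set.Ioc (-M - 1) M), 3 ^ s + m * (3 / r0) ^ s, ?_, ?_, ?_, ?_, ?_⟩
  · constructor
    rw [Measure.restrict_apply_univ, hfI]
    exact ENNReal.ofReal_lt_top
  · rw [Measure.restrict_apply_univ, hfI, hFM, hFM']
    simpa using hmpos
  · refine le_antisymm ((Measure.restrict_apply_le _ _).trans ?_) bot_le
    refine le_of_eq (measure_null_of_locally_null _ fun x hx => ?_)
    obtain ⟨e, he, hb⟩ := Metric.isOpen_iff.1 hC.isClosed.isOpen_compl x hx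
    refine ⟨Set.Ioc (x - e / 2) (x + e / 2), mem_nhdsWithin_of_mem_nhds
      (Ioc_mem_nhds (by linarith) (by linarith)), ?_⟩
    rw [hfI, ENNReal.ofReal_eq_zero]
    refine (hdiff _ _ (by linarith)).trans ?_
    rw [(Set.eq_empty_iff_forall_notMem (s := C ∩ Set.Ioc (x - e / 2) (x + e / 2))).2]
    · simp
    · rintro c ⟨hc, hc'⟩
      refine hb (a := c) ?_ hc
      rw [Real.ball_eq_Ioo]
      exact ⟨by linarith [hc'.1], by linarith [hc'.2]⟩
  · positivity
  · intro c ρ hρ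
    refine (Measure.restrict_apply_le _ _).trans ?_
    have hsub : Metric.closedBall c ρ ⊆ Set.Ioc (c - 2 * ρ) (c + ρ) := by
      rw [Real.closedBall_eq_Icc]
      intro y hy
      exact ⟨by linarith [hy.1], hy.2⟩
    refine (measure_mono hsub).trans ?_
    rw [hfI]
    apply ENNReal.ofReal_le_ofReal
    rw [add_mul, mul_assoc, ← Real.mul_rpow (by norm_num) hρ.le,
      ← Real.mul_rpow (by positivity) hρ.le]
    have p1 : 0 ≤ (3 * ρ) ^ s := by positivity
    have p2 : 0 ≤ (3 / r0 * ρ) ^ s := by positivity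
    by_cases hle : 3 * ρ ≤ r0
    · have := hhol (c - 2 * ρ) (c + ρ) (by linarith) (by linarith)
      have e : c + ρ - (c - 2 * ρ) = 3 * ρ := by ring
      rw [e] at this
      have := mul_nonneg hmpos.le p2
      linarith
    · have : 1 ≤ (3 / r0 * ρ) ^ s := by
        apply Real.one_le_rpow _ hs.le
        rw [div_mul_eq_mul_div, le_div_iff₀ hr0]; linarith
      have := hFle (c + ρ)
      have := hF0 (c - 2 * ρ)
      nlinarith

theorem cover_aux (B : Set ℝ) (β : ℝ) (hβ : 0 < β) (h : Measure.hausdorffMeasure β B = 0) (K : ℕ) :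
    ∃ (a : ℕ → ℝ) (κ : ℕ → ℕ), (∀ n, K ≤ κ n) ∧
      B ⊆ ⋃ n, Metric.closedBall (a n) ((1 / 2) ^ κ n) ∧
      ∀ (k : ℕ) (T : Finset ℕ), (∀ n ∈ T, κ n = k) → (T.card : ℝ) ≤ ((2 : ℝ) ^ β) ^ k := by
  set b : ℝ := (2 : ℝ) ^ β with hb
  have hb1 : 1 < b := Real.one_lt_rpow (by norm_num) hβ
  have hb0 : 0 < b := by linarith
  rw [Measure.hausdorffMeasure_apply] at h
  have h1 := (ENNReal.iSup_eq_zero.1 ((ENNReal.iSup_eq_zero.1 h)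
    (ENNReal.ofReal ((1 / 2) ^ K)))) (by rw [ENNReal.ofReal_pos]; positivity)
  have h2 : (0 : ℝ≥0∞) < ENNReal.ofReal (1 / (2 * b)) := by rw [ENNReal.ofReal_pos]; positivity
  rw [← h1] at h2
  simp only [iInf_lt_iff] at h2
  obtain ⟨t, hBt, htd, hsum⟩ := h2
  have key : ∀ n, ∃ (a : ℝ) (k : ℕ), K ≤ k ∧ t n ⊆ Metric.closedBall a ((1 / 2) ^ k) ∧
      ENNReal.ofReal (b⁻¹ ^ k) ≤ ENNReal.ofReal b * (⨆ _ : (t n).Nonempty, Metric.ediam (t n) ^ β)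
        + ENNReal.ofReal ((1 / 2) ^ n / 4) := by
    intro n
    by_cases hd : Metric.ediam (t n) = 0
    · have hsub : (t n).Subsingleton := Metric.ediam_eq_zero_iff.1 hd
      obtain ⟨k, hk⟩ := exists_pow_lt_of_lt_one (show (0 : ℝ) < (1 / 2) ^ n / 4 by positivity)
        (inv_lt_one_of_one_lt₀ hb1)
      obtain ⟨a, ha⟩ : ∃ a, t n ⊆ {a} := by
        rcases hsub.eq_empty_or_singleton with h | ⟨a, h⟩
        · exact ⟨0, by simp [h]⟩
        · exact ⟨a, h.le⟩
      refine ⟨a, max k K, le_max_right _ _, ha.trans ?_, ?_⟩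
      · simp
      · refine le_trans (ENNReal.ofReal_le_ofReal ?_) le_add_self
        refine le_trans ?_ hk.le
        exact pow_le_pow_of_le_one (by positivity) (inv_lt_one_of_one_lt₀ hb1).le (le_max_left _ _)
    · have hne : (t n).Nonempty := by
        by_contra hcon
        rw [Set.not_nonempty_iff_eq_empty] at hcon
        simp [hcon] at hd
      have htop : Metric.ediam (t n) ≠ ⊤ := ((htd n).trans_lt ENNReal.ofReal_lt_top).ne
      set d := (Metric.ediam (t n)).toReal with hdd
      have hdpos : 0 < d := ENNReal.toReal_pos hd htop
      have hed : Metric.ediam (t n) = ENNReal.ofReal d := (ENNReal.ofReal_toReal htop).symm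
      have hdK : d ≤ (1 / 2) ^ K := ENNReal.toReal_le_of_le_ofReal (by positivity) (htd n)
      obtain ⟨k, hk1, hk2⟩ := exists_nat_pow_near_of_lt_one hdpos
        (hdK.trans (pow_le_one₀ (by norm_num) (by norm_num)))
        (show (0 : ℝ) < 1 / 2 by norm_num) (by norm_num)
      obtain ⟨a, ha⟩ := hne
      refine ⟨a, k, ?_, ?_, ?_⟩
      · have := (pow_lt_pow_iff_right_of_lt_one₀ (show (0 : ℝ) < 1 / 2 by norm_num)
          (by norm_num)).1 (hk1.trans_le hdK)
        omega
      · intro y hy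
        rw [Metric.mem_closedBall]
        refine le_trans ?_ hk2
        have := Metric.edist_le_ediam_of_mem hy ha
        rw [hed, edist_dist] at this
        exact (ENNReal.ofReal_le_ofReal_iff hdpos.le).1 this
      · refine le_trans ?_ le_self_add
        rw [ciSup_pos ⟨a, ha⟩, hed, ENNReal.ofReal_rpow_of_pos hdpos, ← ENNReal.ofReal_mul hb0.le]
        apply ENNReal.ofReal_le_ofReal
        have h3 : ((1 / 2 : ℝ) ^ (k + 1)) ^ β ≤ d ^ β :=
          Real.rpow_le_rpow (by positivity) hk1.le hβ.le
        have h4 : ((1 / 2 : ℝ) ^ (k + 1)) ^ β = b⁻¹ ^ (k + 1) := by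
          rw [← Real.rpow_natCast, ← Real.rpow_mul (by norm_num), mul_comm, Real.rpow_mul (by norm_num),
            Real.rpow_natCast, one_div, Real.inv_rpow (by norm_num)]
        rw [h4] at h3
        calc b⁻¹ ^ k = b * b⁻¹ ^ (k + 1) := by rw [pow_succ]; field_simp
          _ ≤ b * d ^ β := by gcongr
  choose a κ hκ hsub hle using key
  refine ⟨a, κ, hκ, hBt.trans (Set.iUnion_mono hsub), ?_⟩
  intro k T hT
  have htot : ∑' n, ENNReal.ofReal (b⁻¹ ^ κ n) ≤ 1 := by
    refine (ENNReal.tsum_le_tsum hle).trans ?_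
    rw [ENNReal.tsum_add, ENNReal.tsum_mul_left]
    have e2 : ∑' n : ℕ, ENNReal.ofReal ((1 / 2) ^ n / 4) = ENNReal.ofReal (1 / 2) := by
      rw [← ENNReal.ofReal_tsum_of_nonneg (fun n => by positivity)
        (summable_geometric_two.div_const 4), tsum_div_const, tsum_geometric_two]
      norm_num
    rw [e2]
    calc _ ≤ ENNReal.ofReal b * ENNReal.ofReal (1 / (2 * b)) + ENNReal.ofReal (1 / 2) := by gcongr
      _ = 1 := by
        rw [← ENNReal.ofReal_mul hb0.le, ← ENNReal.ofReal_add (by positivity) (by norm_num)]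
        rw [← ENNReal.ofReal_one]
        congr 1
        field_simp; norm_num
  have h5 := (ENNReal.sum_le_tsum T).trans htot
  rw [Finset.sum_congr rfl (fun n hn => by rw [hT n hn]), Finset.sum_const, nsmul_eq_mul,
    ← ENNReal.ofReal_natCast, ← ENNReal.ofReal_mul (by positivity), ← ENNReal.ofReal_one,
    ENNReal.ofReal_le_ofReal_iff (by norm_num), inv_pow] at h5
  rwa [mul_inv_le_iff₀ (by positivity), one_mul] at h5

theorem count_aux (μ : Measure ℝ) [IsFiniteMeasure μ] (M : ℝ) (hM : 0 < M)
    (hμM : μ (Metric.closedBall (0 : ℝ) M)ᶜ = 0) (T : Finset ℕ) (a : ℕ → ℝ) (ε δ p : ℝ)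
    (hε : 0 < ε) (hδ : 0 < δ) (hp : 0 < p)
    (hball : ∀ c, μ (Metric.closedBall c δ) ≤ ENNReal.ofReal (p / 2))
    (J : Finset ℤ) (x r : ℤ → ℝ) (hx : ∀ j ∈ J, x j ∈ Set.Icc (j * ε) ((j + 1) * ε))
    (hE : ∀ j ∈ J, ENNReal.ofReal p ≤
      μ {c | x j + r j * c ∈ ⋃ n ∈ T, Metric.closedBall (a n) ε}) :
    (J.card : ℝ) * (p ^ 2 / 2) ≤ (T.card : ℝ) ^ 2 * (4 * M / δ + 2) * (μ.real Set.univ) ^ 2 := by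
  set U : Set ℝ := ⋃ n ∈ T, Metric.closedBall (a n) ε with hU
  have hUm : MeasurableSet U :=
    Finset.measurableSet_biUnion _ fun n _ => Metric.isClosed_closedBall.measurableSet
  set D := Metric.closedBall (0 : ℝ) M with hD
  have hDm : MeasurableSet D := Metric.isClosed_closedBall.measurableSet
  let Q : ℤ → Set ℝ := fun j => {c | x j + r j * c ∈ U} ∩ D
  have hQm : ∀ j, MeasurableSet (Q j) := fun j =>
    (hUm.preimage (by fun_prop : Measurable fun c => x j + r j * c)).inter hDm
  have hQ : ∀ j ∈ J, ENNReal.ofReal p ≤ μ (Q j) := by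
    intro j hj
    refine (hE j hj).trans ?_
    rw [← measure_inter_add_sdiff {c | x j + r j * c ∈ U} hDm]
    have : μ ({c | x j + r j * c ∈ U} \ D) = 0 := measure_mono_null (fun c hc => hc.2) hμM
    rw [this, add_zero]
  let P : ℤ → Set (ℝ × ℝ) := fun j => (Q j ×ˢ Q j) ∩ {z | δ < |z.1 - z.2|}
  have hPm : ∀ j, MeasurableSet (P j) := fun j =>
    ((hQm j).prod (hQm j)).inter (measurableSet_lt (by fun_prop) (by fun_prop))
  have hP : ∀ j ∈ J, ENNReal.ofReal (p ^ 2 / 2) ≤ μ.prod μ (P j) := by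
    intro j hj
    rw [Measure.prod_apply (hPm j)]
    calc ENNReal.ofReal (p ^ 2 / 2) = ENNReal.ofReal (p / 2) * ENNReal.ofReal p := by
          rw [← ENNReal.ofReal_mul (by positivity)]; congr 1; ring
      _ ≤ ENNReal.ofReal (p / 2) * μ (Q j) := by gcongr; exact hQ j hj
      _ = ∫⁻ _ in Q j, ENNReal.ofReal (p / 2) ∂μ := by rw [setLIntegral_const]
      _ ≤ ∫⁻ c in Q j, μ (Prod.mk c ⁻¹' P j) ∂μ := by
          refine setLIntegral_mono' (hQm j) fun c hc => ?_
          have h1 : Q j \ Metric.closedBall c δ ⊆ Prod.mk c ⁻¹' P j := by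
            rintro d ⟨hd, hd2⟩
            refine ⟨⟨hc, hd⟩, ?_⟩
            rw [Metric.mem_closedBall, dist_comm, Real.dist_eq, not_le] at hd2
            exact hd2
          refine le_trans ?_ (measure_mono h1)
          refine le_trans ?_ (le_measure_sdiff)
          have h2 := tsub_le_tsub (hQ j hj) (hball c)
          rw [← ENNReal.ofReal_sub _ (by positivity)] at h2
          convert h2 using 2
          ring
      _ ≤ ∫⁻ c, μ (Prod.mk c ⁻¹' P j) ∂μ := setLIntegral_le_lintegral _ _
  set L : ℝ := 4 * M / δ + 2 with hL
  have hL0 : 0 < L := by positivity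
  classical
  have hcount : ∀ z : ℝ × ℝ, ((J.filter fun j => z ∈ P j).card : ℝ) ≤ (T.card : ℝ) ^ 2 * L := by
    rintro ⟨c, d⟩
    by_cases hcd : c ∈ D ∧ d ∈ D ∧ δ < |c - d|
    swap
    · rw [Finset.filter_false_of_mem]
      · simp; positivity
      · rintro j _ ⟨⟨h1, h2⟩, h3⟩
        exact hcd ⟨h1.2, h2.2, h3⟩
    obtain ⟨hc, hd, hcd⟩ := hcd
    have hc' : |c| ≤ M := by simpa [hD] using hc
    have hd' : |d| ≤ M := by simpa [hD] using hd
    have hne : d - c ≠ 0 := by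
      intro h0
      have : c - d = 0 := by linarith
      rw [this, abs_zero] at hcd
      linarith
    let x0 : ℕ × ℕ → ℝ := fun nm => (a nm.1 * d - a nm.2 * c) / (d - c)
    let R : ℝ := 2 * M * ε / δ
    let I : ℕ × ℕ → Finset ℤ := fun nm => Finset.Icc ⌈(x0 nm - R) / ε - 1⌉ ⌊(x0 nm + R) / ε⌋
    have hIcard : ∀ nm, ((I nm).card : ℝ) ≤ L := by
      intro nm
      simp only [I, Int.card_Icc]
      have h1 : (((⌊(x0 nm + R) / ε⌋ + 1 - ⌈(x0 nm - R) / ε - 1⌉).toNat : ℤ) : ℝ)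
          = max ((⌊(x0 nm + R) / ε⌋ : ℝ) + 1 - (⌈(x0 nm - R) / ε - 1⌉ : ℝ)) 0 := by
        rw [Int.toNat_eq_max]; push_cast; rfl
      rw [← Int.cast_natCast, h1]
      refine max_le ?_ hL0.le
      have h2 := Int.floor_le ((x0 nm + R) / ε)
      have h3 := Int.le_ceil ((x0 nm - R) / ε - 1)
      have h4 : (x0 nm + R) / ε - (x0 nm - R) / ε = 4 * M / δ := by
        simp only [R]; field_simp; ring
      linarith
    have hsub : (J.filter fun j => (c, d) ∈ P j) ⊆ (T ×ˢ T).biUnion I := by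
      intro j hj
      rw [Finset.mem_filter] at hj
      obtain ⟨hjJ, ⟨⟨h1, -⟩, ⟨h2, -⟩⟩, -⟩ := hj
      simp only [hU, Set.mem_ofPred_eq, Set.mem_iUnion, Metric.mem_closedBall, Real.dist_eq,
        exists_prop] at h1 h2
      obtain ⟨n, hn, h1⟩ := h1
      obtain ⟨m, hm, h2⟩ := h2
      rw [Finset.mem_biUnion]
      refine ⟨(n, m), Finset.mk_mem_product hn hm, ?_⟩
      have hdist : |x j - x0 (n, m)| ≤ R := by
        have e : x j - x0 (n, m)
            = ((x j + r j * c - a n) * d - (x j + r j * d - a m) * c) / (d - c) := by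
          simp only [x0]; field_simp; ring
        rw [e, abs_div]
        have h5 : |(x j + r j * c - a n) * d - (x j + r j * d - a m) * c| ≤ 2 * M * ε := by
          refine (abs_sub _ _).trans ?_
          rw [abs_mul, abs_mul]
          have := mul_le_mul h1 hd' (abs_nonneg _) hε.le
          have := mul_le_mul h2 hc' (abs_nonneg _) hε.le
          linarith
        rw [abs_sub_comm d c]
        simp only [R]
        gcongr
      obtain ⟨hl, hu⟩ := abs_le.1 hdist
      obtain ⟨hj1, hj2⟩ := hx j hjJ
      simp only [I, Finset.mem_Icc]
      constructor
      · rw [Int.ceil_le, sub_le_iff_le_add, div_le_iff₀ hε]; linarith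
      · rw [Int.le_floor, le_div_iff₀ hε]; linarith
    calc ((J.filter fun j => (c, d) ∈ P j).card : ℝ) ≤ (((T ×ˢ T).biUnion I).card : ℝ) := by
          exact_mod_cast Finset.card_le_card hsub
      _ ≤ ∑ nm ∈ T ×ˢ T, ((I nm).card : ℝ) := by exact_mod_cast Finset.card_biUnion_le
      _ ≤ ∑ nm ∈ T ×ˢ T, L := Finset.sum_le_sum fun nm _ => hIcard nm
      _ = (T.card : ℝ) ^ 2 * L := by
          rw [Finset.sum_const, Finset.card_product, nsmul_eq_mul]; push_cast; ring
  have hfinal : ENNReal.ofReal ((J.card : ℝ) * (p ^ 2 / 2)) ≤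
      ENNReal.ofReal ((T.card : ℝ) ^ 2 * L * (μ.real Set.univ) ^ 2) := by
    calc ENNReal.ofReal ((J.card : ℝ) * (p ^ 2 / 2))
        = ∑ j ∈ J, ENNReal.ofReal (p ^ 2 / 2) := by
          rw [Finset.sum_const, nsmul_eq_mul, ENNReal.ofReal_mul (by positivity),
            ENNReal.ofReal_natCast]
      _ ≤ ∑ j ∈ J, μ.prod μ (P j) := Finset.sum_le_sum hP
      _ = ∑ j ∈ J, ∫⁻ z, (P j).indicator 1 z ∂(μ.prod μ) := by
          refine Finset.sum_congr rfl fun j _ => ?_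
          rw [lintegral_indicator_one (hPm j)]
      _ = ∫⁻ z, ∑ j ∈ J, (P j).indicator 1 z ∂(μ.prod μ) := by
          rw [lintegral_finsetSum]
          exact fun j _ => measurable_one.indicator (hPm j)
      _ ≤ ∫⁻ _, ENNReal.ofReal ((T.card : ℝ) ^ 2 * L) ∂(μ.prod μ) := by
          refine lintegral_mono fun z => ?_
          have e : ∑ j ∈ J, (P j).indicator (1 : ℝ × ℝ → ℝ≥0∞) z
              = ((J.filter fun j => z ∈ P j).card : ℝ≥0∞) := by
            rw [Finset.card_filter]
            push_cast
            refine Finset.sum_congr rfl fun j _ => ?_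
            by_cases hz : z ∈ P j <;> simp [hz]
          simp only [e]
          rw [← ENNReal.ofReal_natCast]
          exact ENNReal.ofReal_le_ofReal (hcount z)
      _ = ENNReal.ofReal ((T.card : ℝ) ^ 2 * L * (μ.real Set.univ) ^ 2) := by
          rw [lintegral_const, ← Set.univ_prod_univ, Measure.prod_prod,
            ENNReal.ofReal_mul (p := (T.card : ℝ) ^ 2 * L) (by positivity), pow_two (μ.real _),
            ENNReal.ofReal_mul measureReal_nonneg, ofReal_measureReal]
  exact (ENNReal.ofReal_le_ofReal_iff (by positivity)).1 hfinal

theorem haus_zero_aux (S : Set ℝ) (t D ρ : ℝ) (ht : 0 < t) (hD : 0 ≤ D) (hρ0 : 0 ≤ ρ) (hρ1 : ρ < 1)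
    (h : ∀ K : ℕ, ∃ J : ℕ → Set ℤ,
      (∀ x ∈ S, ∃ k, ∃ j ∈ J k,
        x ∈ Set.Icc ((j : ℝ) * (1 / 2) ^ (k + K)) (((j : ℝ) + 1) * (1 / 2) ^ (k + K))) ∧
      ∀ k (J' : Finset ℤ), (∀ j ∈ J', j ∈ J k) →
        (J'.card : ℝ) * ((1 / 2 : ℝ) ^ (k + K)) ^ t ≤ D * ρ ^ (k + K)) :
    Measure.hausdorffMeasure t S = 0 := by
  classical
  choose J hcov hcard using h
  let V : ℕ → ℕ × ℤ → Set ℝ := fun K kj => if kj.2 ∈ J K kj.1 then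
    Set.Icc ((kj.2 : ℝ) * (1 / 2) ^ (kj.1 + K)) (((kj.2 : ℝ) + 1) * (1 / 2) ^ (kj.1 + K)) else ∅
  have hdiam : ∀ K k j, Metric.ediam (V K (k, j)) =
      if j ∈ J K k then ENNReal.ofReal ((1 / 2) ^ (k + K)) else 0 := by
    intro K k j
    simp only [V]
    split_ifs
    · rw [Real.ediam_Icc]; congr 1; ring
    · simp
  have hlim : Filter.Tendsto (fun K : ℕ => ENNReal.ofReal ((1 / 2) ^ K)) Filter.atTop (nhds 0) := by
    rw [← ENNReal.ofReal_zero]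
    exact ENNReal.tendsto_ofReal (tendsto_pow_atTop_nhds_zero_of_lt_one (by norm_num) (by norm_num))
  have hle := Measure.hausdorffMeasure_le_liminf_tsum t S (l := Filter.atTop)
    (fun K : ℕ => ENNReal.ofReal ((1 / 2) ^ K)) hlim V
    (Filter.Eventually.of_forall fun K ⟨k, j⟩ => by
      rw [hdiam]
      split_ifs
      · apply ENNReal.ofReal_le_ofReal
        exact pow_le_pow_of_le_one (by norm_num) (by norm_num) (by omega)
      · exact bot_le)
    (Filter.Eventually.of_forall fun K x hx => by
      obtain ⟨k, j, hj, hx⟩ := hcov K x hx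
      refine Set.mem_iUnion.2 ⟨(k, j), ?_⟩
      simp only [V]
      rwa [if_pos hj])
  refine le_antisymm (hle.trans ?_) bot_le
  have hbound : ∀ K, ∑' i, Metric.ediam (V K i) ^ t ≤ ENNReal.ofReal (D * (1 - ρ)⁻¹ * ρ ^ K) := by
    intro K
    rw [ENNReal.tsum_prod']
    calc ∑' k, ∑' j, Metric.ediam (V K (k, j)) ^ t
        ≤ ∑' k, ENNReal.ofReal (D * ρ ^ (k + K)) := by
          refine ENNReal.tsum_le_tsum fun k => ?_
          rw [ENNReal.tsum_eq_iSup_sum]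
          refine iSup_le fun F => ?_
          have e : ∀ j, Metric.ediam (V K (k, j)) ^ t =
              if j ∈ J K k then ENNReal.ofReal (((1 / 2) ^ (k + K)) ^ t) else 0 := by
            intro j
            rw [hdiam]
            split_ifs
            · rw [ENNReal.ofReal_rpow_of_pos (by positivity)]
            · rw [ENNReal.zero_rpow_of_pos ht]
          simp only [e]
          rw [← Finset.sum_filter, Finset.sum_const, nsmul_eq_mul, ← ENNReal.ofReal_natCast,
            ← ENNReal.ofReal_mul (by positivity)]
          apply ENNReal.ofReal_le_ofReal
          exact hcard K k _ fun j hj => (Finset.mem_filter.1 hj).2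
      _ = ENNReal.ofReal (D * (1 - ρ)⁻¹ * ρ ^ K) := by
          have e : ∀ k, D * ρ ^ (k + K) = (D * ρ ^ K) * ρ ^ k := fun k => by rw [pow_add]; ring
          simp only [e]
          rw [← ENNReal.ofReal_tsum_of_nonneg (fun k => by positivity)
            ((summable_geometric_of_lt_one hρ0 hρ1).mul_left _), tsum_mul_left,
            tsum_geometric_of_lt_one hρ0 hρ1]
          congr 1; ring
  have hlim2 : Filter.Tendsto (fun K : ℕ => ENNReal.ofReal (D * (1 - ρ)⁻¹ * ρ ^ K))
      Filter.atTop (nhds 0) := by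
    rw [← ENNReal.ofReal_zero]
    apply ENNReal.tendsto_ofReal
    simpa using (tendsto_pow_atTop_nhds_zero_of_lt_one hρ0 hρ1).const_mul (D * (1 - ρ)⁻¹)
  rw [← hlim2.liminf_eq]
  exact Filter.liminf_le_liminf (Filter.Eventually.of_forall hbound)

theorem main_aux (S C B : Set ℝ) (hC : IsCompact C) (s β t : ℝ) (hs : 0 < s) (hβ : 0 < β)
    (ht : 2 * β < t) (hCs : Measure.hausdorffMeasure s C ≠ 0)
    (hBβ : Measure.hausdorffMeasure β B = 0)
    (hB : ∀ x ∈ S, ∃ r : ℝ, ∀ c ∈ C, x + r * c ∈ B) :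
    Measure.hausdorffMeasure t S = 0 := by
  obtain ⟨μ, A, hfin, hμ0, hμC, hA, hfr⟩ := frostman_aux C hC s hs hCs
  obtain ⟨M', hM'⟩ := hC.isBounded.subset_closedBall (0 : ℝ)
  set M := max M' 1 with hMdef
  have hM : 0 < M := lt_of_lt_of_le one_pos (le_max_right _ _)
  have hμM : μ (Metric.closedBall (0 : ℝ) M)ᶜ = 0 := by
    refine measure_mono_null (Set.compl_subset_compl.2 ?_) hμC
    exact hM'.trans (Metric.closedBall_subset_closedBall (le_max_left _ _))
  set m := μ.real Set.univ with hm
  have hm0 : 0 < m := ENNReal.toReal_pos hμ0 (measure_ne_top _ _)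
  set b : ℝ := 2 ^ β with hb
  have hb0 : 0 < b := by positivity
  -- small exponential rate
  set η : ℝ := (t - 2 * β) / (2 * (1 + 2 * s)) with hη
  have hη0 : 0 < η := by apply div_pos <;> linarith
  set q : ℝ := 2 ^ η with hq
  have hq1 : 1 < q := Real.one_lt_rpow (by norm_num) hη0
  have hq0 : 0 < q := by linarith
  set w : ℝ := (q ^ s)⁻¹ with hw
  have hw0 : 0 < w := by positivity
  have hw1 : w < 1 := inv_lt_one_of_one_lt₀ (Real.one_lt_rpow hq1 hs)
  set ρ : ℝ := b ^ 2 * q * (w⁻¹) ^ 2 * (1 / 2) ^ t with hρ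
  have hρ0 : 0 ≤ ρ := by positivity
  have hρ1 : ρ < 1 := by
    have e : ρ = 2 ^ (β * 2 + η + η * s * 2 - t) := by
      rw [hρ, hw, inv_inv, hb, hq, one_div, Real.inv_rpow (by norm_num),
        Real.rpow_sub (by norm_num), Real.rpow_add (by norm_num), Real.rpow_add (by norm_num),
        Real.rpow_mul (by norm_num) β, Real.rpow_mul (by norm_num) (η * s),
        Real.rpow_mul (by norm_num) η s, Real.rpow_two, Real.rpow_two]
      rfl
    rw [e]
    apply Real.rpow_lt_one_of_one_lt_of_neg (by norm_num)
    have : η * (2 * (1 + 2 * s)) = t - 2 * β := by rw [hη]; field_simp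
    nlinarith
  set p0 : ℝ := m * (1 - w) / 2 with hp0
  have hp0' : 0 < p0 := by have : 0 < 1 - w := by linarith
                           positivity
  set δ0 : ℝ := (p0 / (2 * A)) ^ s⁻¹ with hδ0
  have hδ0' : 0 < δ0 := by positivity
  have hδs : A * δ0 ^ s = p0 / 2 := by
    rw [hδ0, ← Real.rpow_mul (by positivity), inv_mul_cancel₀ hs.ne', Real.rpow_one]
    field_simp
  have hball : ∀ (k : ℕ) (c : ℝ), μ (Metric.closedBall c (δ0 * q⁻¹ ^ k)) ≤
      ENNReal.ofReal (p0 * w ^ k / 2) := by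
    intro k c
    refine (hfr c _ (by positivity)).trans (ENNReal.ofReal_le_ofReal (le_of_eq ?_))
    rw [Real.mul_rpow (by positivity) (by positivity), ← mul_assoc, hδs]
    have : (q⁻¹ ^ k) ^ s = w ^ k := by
      rw [hw, ← Real.rpow_natCast, ← Real.rpow_mul (by positivity), mul_comm,
        Real.rpow_mul (by positivity), Real.rpow_natCast, Real.inv_rpow hq0.le]
    rw [this]; ring
  refine haus_zero_aux S t (2 * (4 * M / δ0 + 2) * m ^ 2 / p0 ^ 2) ρ (by linarith) (by positivity)
    hρ0 hρ1 fun K => ?_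
  obtain ⟨a, κ, hκ, hcov, hcard⟩ := cover_aux B β hβ hBβ K
  have hTfin : ∀ k, {n | κ n = k}.Finite := by
    intro k
    by_contra hinf
    obtain ⟨N, hN⟩ := exists_nat_gt (((2 : ℝ) ^ β) ^ k)
    obtain ⟨T, hT, hTc⟩ := Set.Infinite.exists_subset_card_eq hinf N
    have := hcard k T (fun n hn => hT hn)
    rw [hTc] at this
    linarith
  let T : ℕ → Finset ℕ := fun k => (hTfin k).toFinset
  have hTmem : ∀ k n, n ∈ T k ↔ κ n = k := fun k n => by simp [T]
  choose! r hr using hB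
  let E : ℝ → ℕ → Set ℝ := fun x k =>
    {c | x + r x * c ∈ ⋃ n ∈ T k, Metric.closedBall (a n) ((1 / 2) ^ k)}
  have hex : ∀ x ∈ S, ∃ k : ℕ, ENNReal.ofReal (p0 * w ^ (k + K)) ≤ μ (E x (k + K)) := by
    intro x hx
    by_contra! hcon
    have hsub : C ⊆ ⋃ k, E x (k + K) := by
      intro c hc
      obtain ⟨n, hn⟩ := Set.mem_iUnion.1 (hcov (hr x hx c hc))
      refine Set.mem_iUnion.2 ⟨κ n - K, ?_⟩
      rw [Nat.sub_add_cancel (hκ n)]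
      exact Set.mem_iUnion₂.2 ⟨n, (hTmem _ _).2 rfl, hn⟩
    have h1 : μ Set.univ ≤ ∑' k, μ (E x (k + K)) := by
      calc μ Set.univ ≤ μ C + μ Cᶜ := by rw [← Set.union_compl_self C]; exact measure_union_le _ _
        _ = μ C := by rw [hμC, add_zero]
        _ ≤ _ := (measure_mono hsub).trans (measure_iUnion_le _)
    have h2 : ∑' k, μ (E x (k + K)) ≤ ENNReal.ofReal (m / 2) := by
      calc ∑' k, μ (E x (k + K)) ≤ ∑' k, ENNReal.ofReal (p0 * w ^ k) := by
            refine ENNReal.tsum_le_tsum fun k => (hcon k).le.trans (ENNReal.ofReal_le_ofReal ?_)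
            exact mul_le_mul_of_nonneg_left
              (pow_le_pow_of_le_one hw0.le hw1.le (by omega)) hp0'.le
        _ = ENNReal.ofReal (m / 2) := by
            rw [← ENNReal.ofReal_tsum_of_nonneg (fun k => by positivity)
              ((summable_geometric_of_lt_one hw0.le hw1).mul_left _), tsum_mul_left,
              tsum_geometric_of_lt_one hw0.le hw1]
            have : 1 - w ≠ 0 := by linarith
            congr 1; rw [hp0]; field_simp
    have h3 := ENNReal.toReal_le_of_le_ofReal (by positivity) (h1.trans h2)
    change m ≤ m / 2 at h3
    linarith
  refine ⟨fun k => {j | ∃ x ∈ S, ENNReal.ofReal (p0 * w ^ (k + K)) ≤ μ (E x (k + K)) ∧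
    x ∈ Set.Icc ((j : ℝ) * (1 / 2) ^ (k + K)) (((j : ℝ) + 1) * (1 / 2) ^ (k + K))}, ?_, ?_⟩
  · intro x hx
    obtain ⟨k, hk⟩ := hex x hx
    have hε : (0 : ℝ) < (1 / 2) ^ (k + K) := by positivity
    have hI : x ∈ Set.Icc ((⌊x / (1 / 2) ^ (k + K)⌋ : ℝ) * (1 / 2) ^ (k + K))
        (((⌊x / (1 / 2) ^ (k + K)⌋ : ℝ) + 1) * (1 / 2) ^ (k + K)) := by
      constructor
      · rw [← le_div_iff₀ hε]; exact Int.floor_le _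
      · rw [← div_le_iff₀ hε]; exact (Int.lt_floor_add_one _).le
    exact ⟨k, _, ⟨x, hx, hk, hI⟩, hI⟩
  · intro k J' hJ'
    choose! x hxS hxE hxI using hJ'
    generalize k + K = l at hxE hxI ⊢
    have hc := count_aux μ M hM hμM (T l) a ((1 / 2) ^ l) (δ0 * q⁻¹ ^ l) (p0 * w ^ l)
      (by positivity) (by positivity) (by positivity) (hball l) J' x (fun j => r (x j)) hxI hxE
    have hT := hcard l (T l) (fun n hn => (hTmem _ _).1 hn)
    rw [← hb] at hT
    have hql : 1 ≤ q ^ l := one_le_pow₀ hq1.le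
    have h1 : 4 * M / (δ0 * q⁻¹ ^ l) + 2 ≤ (4 * M / δ0 + 2) * q ^ l := by
      have e : 4 * M / (δ0 * q⁻¹ ^ l) = 4 * M / δ0 * q ^ l := by
        rw [inv_pow]; field_simp
      rw [e, add_mul]
      linarith
    have h2 : (J'.card : ℝ) * ((p0 * w ^ l) ^ 2 / 2) ≤
        (b ^ l) ^ 2 * ((4 * M / δ0 + 2) * q ^ l) * m ^ 2 := by
      refine hc.trans ?_
      have : (0 : ℝ) ≤ 4 * M / (δ0 * q⁻¹ ^ l) + 2 := by positivity
      gcongr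
    have h3 : (J'.card : ℝ) ≤ (b ^ l) ^ 2 * ((4 * M / δ0 + 2) * q ^ l) * m ^ 2 /
        ((p0 * w ^ l) ^ 2 / 2) := by
      rwa [le_div_iff₀ (by positivity)]
    have h4 : ((1 / 2 : ℝ) ^ l) ^ t = ((1 / 2 : ℝ) ^ t) ^ l := by
      rw [← Real.rpow_natCast, ← Real.rpow_mul (by norm_num), mul_comm,
        Real.rpow_mul (by norm_num), Real.rpow_natCast]
    rw [h4]
    calc (J'.card : ℝ) * ((1 / 2 : ℝ) ^ t) ^ l ≤ (b ^ l) ^ 2 * ((4 * M / δ0 + 2) * q ^ l) * m ^ 2 /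
        ((p0 * w ^ l) ^ 2 / 2) * ((1 / 2 : ℝ) ^ t) ^ l := by gcongr
      _ = _ := by
        generalize 4 * M / δ0 + 2 = Y
        rw [hρ]
        generalize ((1 / 2 : ℝ) ^ t) = Z
        simp only [mul_pow, inv_pow, ← pow_mul]
        rw [mul_comm 2 l]
        field_simp

/-- If `S` and `C` are compact subsets of `ℝ` with `dimH C > 0` and the Borel set `B`
contains a scaled copy `x + r • C` of `C` around every `x ∈ S` (for some `r ∈ ℝ`), then
`dimH B ≥ dimH S / 2`. -/
theorem dimH_ge_half (S C : Set ℝ) (hS : IsCompact S) (hC : IsCompact C)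
    (hdimC : 0 < dimH C) (B : Set ℝ) (hBmeas : MeasurableSet B)
    (hB : ∀ x ∈ S, ∃ r : ℝ, x +ᵥ (r • C : Set ℝ) ⊆ B) :
    dimH S / 2 ≤ dimH B := by
  by_contra! hlt
  obtain ⟨β, hβ1, hβ2⟩ := ENNReal.lt_iff_exists_nnreal_btwn.1 hlt
  have h2 : ((2 * β : NNReal) : ℝ≥0∞) < dimH S := by
    rw [ENNReal.lt_div_iff_mul_lt (by simp) (by simp)] at hβ2
    push_cast
    rwa [mul_comm]
  obtain ⟨t, ht1, ht2⟩ := ENNReal.lt_iff_exists_nnreal_btwn.1 h2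
  obtain ⟨s, hs1, hs2⟩ := ENNReal.lt_iff_exists_nnreal_btwn.1 hdimC
  have hβ0 : 0 < β := by
    exact ENNReal.coe_pos.1 (lt_of_le_of_lt zero_le hβ1)
  have hCs := hausdorffMeasure_of_lt_dimH hs2
  have hBβ := hausdorffMeasure_of_dimH_lt hβ1
  have hSt := hausdorffMeasure_of_lt_dimH ht2
  have := main_aux S C B hC s β t (by exact_mod_cast hs1) (by exact_mod_cast hβ0)
    (by exact_mod_cast ht1) (by rw [hCs]; simp) hBβ (fun x hx => by
      obtain ⟨r, hr⟩ := hB x hx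
      exact ⟨r, fun c hc => hr ⟨r • c, ⟨c, hc, rfl⟩, rfl⟩⟩)
  rw [this] at hSt
  simp at hSt
end

section
/- There exists a set B ⊆ ℝ × ℝ of Hausdorff dimension exactly 1 that contains the boundary of an axis-parallel square centered at every point of the plane: for every (x, y) ∈ ℝ × ℝ there exists r > 0 such that the square boundary {(u, v) : max(|u − x|, |v − y|) = r} is contained in B. -/
open MeasureTheory
open scoped ENNReal

namespace SquareBd

open Set Filter Topology

/-- Reciprocal of the radius of the `k`-th interval at level `n`. -/
def mm (n k : ℕ) : ℕ := 2 ^ ((n + 1) * (k + 1))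

lemma mm_pos (n k : ℕ) : (0 : ℝ) < (mm n k : ℝ) := by
  unfold mm; positivity

/-- The open dense set at level `n`. -/
noncomputable def U (n : ℕ) : Set ℝ :=
  ⋃ k : ℕ, Metric.ball (TopologicalSpace.denseSeq ℝ k) (1 / (mm n k : ℝ))

/-- The dense `G_δ` set. -/
noncomputable def A : Set ℝ := ⋂ n : ℕ, U n

lemma A_residual : A ∈ residual ℝ := by
  unfold A
  rw [countable_iInter_mem]
  intro n
  apply residual_of_dense_open
  · exact isOpen_iUnion fun k => Metric.isOpen_ball
  · apply (TopologicalSpace.denseRange_denseSeq ℝ).mono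
    rintro _ ⟨k, rfl⟩
    refine mem_iUnion.2 ⟨k, Metric.mem_ball_self ?_⟩
    have := mm_pos n k
    positivity

lemma exists_r (x y : ℝ) : ∃ r > (0 : ℝ), x + r ∈ A ∧ x - r ∈ A ∧ y + r ∈ A ∧ y - r ∈ A := by
  have key : ∀ e : ℝ ≃ₜ ℝ, e ⁻¹' A ∈ residual ℝ := by
    intro e
    unfold A
    rw [preimage_iInter, countable_iInter_mem]
    intro n
    have ho : IsOpen (U n) := isOpen_iUnion fun k => Metric.isOpen_ball
    have hd : Dense (U n) :=
      (dense_of_mem_residual A_residual).mono (iInter_subset _ n)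
    exact residual_of_dense_open (ho.preimage e.continuous) (hd.preimage e.isOpenMap)
  have h := inter_mem (inter_mem (key (Homeomorph.addLeft x)) (key (Homeomorph.subLeft x)))
    (inter_mem (key (Homeomorph.addLeft y)) (key (Homeomorph.subLeft y)))
  obtain ⟨r, hr, hr2⟩ := (dense_of_mem_residual h).inter_open_nonempty (Ioi 0) isOpen_Ioi
    ⟨1, by simp⟩
  refine ⟨r, hr, ?_⟩
  simp only [mem_inter_iff, mem_preimage, Homeomorph.coe_addLeft, Homeomorph.subLeft_apply] at hr2
  tauto

lemma real_bound (d : ℝ) (n k : ℕ) (hn : 1 ≤ ((n : ℝ) + 1) * (d - 1)) :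
    (mm n k : ℝ) * (2 / (mm n k : ℝ)) ^ d ≤ 2 ^ d * (1 / 2 : ℝ) ^ (k + 1) := by
  have hm := mm_pos n k
  rw [Real.div_rpow (by norm_num) hm.le]
  have h1 : (mm n k : ℝ) * (2 ^ d / (mm n k : ℝ) ^ d) = 2 ^ d * (mm n k : ℝ) ^ (1 - d) := by
    rw [Real.rpow_sub hm, Real.rpow_one]; ring
  rw [h1]
  gcongr
  have h2 : (mm n k : ℝ) = (2 : ℝ) ^ (((n : ℝ) + 1) * (k + 1)) := by
    unfold mm
    push_cast
    rw [← Real.rpow_natCast]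
    push_cast
    rfl
  have h3 : (1 / 2 : ℝ) ^ (k + 1) = (2 : ℝ) ^ (-((k : ℝ) + 1)) := by
    rw [Real.rpow_neg (by norm_num), one_div, inv_pow, ← Real.rpow_natCast]
    push_cast
    rfl
  rw [h2, h3, ← Real.rpow_mul (by norm_num)]
  apply Real.rpow_le_rpow_of_exponent_le (by norm_num)
  have hk : (0 : ℝ) ≤ (k : ℝ) := Nat.cast_nonneg k
  nlinarith

/-- The covering squares. -/
noncomputable def T (i : ℤ) (n : ℕ) (p : Σ k : ℕ, Fin (mm n k)) : Set (ℝ × ℝ) :=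
  Metric.ball (TopologicalSpace.denseSeq ℝ p.1) (1 / (mm n p.1 : ℝ)) ×ˢ
    Icc ((i : ℝ) + (p.2 : ℕ) / (mm n p.1 : ℝ)) ((i : ℝ) + ((p.2 : ℕ) + 1) / (mm n p.1 : ℝ))

lemma T_diam (i : ℤ) (n : ℕ) (p : Σ k : ℕ, Fin (mm n k)) :
    Metric.ediam (T i n p) ≤ ENNReal.ofReal (2 / (mm n p.1 : ℝ)) := by
  have hm := mm_pos n p.1
  apply Metric.ediam_le
  rintro ⟨a, b⟩ ⟨ha, hb⟩ ⟨a', b'⟩ ⟨ha', hb'⟩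
  rw [edist_dist]
  apply ENNReal.ofReal_le_ofReal
  rw [Prod.dist_eq]
  simp only [Metric.mem_ball, Real.dist_eq, mem_Icc, abs_lt] at *
  have e1 : 2 / (mm n p.1 : ℝ) = 2 * (1 / (mm n p.1 : ℝ)) := by ring
  have e2 : (((p.2 : ℕ) : ℝ) + 1) / (mm n p.1 : ℝ)
    = ((p.2 : ℕ) : ℝ) / (mm n p.1 : ℝ) + 1 / (mm n p.1 : ℝ) := by ring
  have e3 : 0 < 1 / (mm n p.1 : ℝ) := by positivity
  rw [e2] at hb hb'
  rw [e1]
  apply max_le <;> rw [abs_le] <;> constructor <;> linarith [hb.1, hb.2, hb'.1, hb'.2]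

lemma T_cover (i : ℤ) (n : ℕ) : A ×ˢ Ico (i : ℝ) (i + 1) ⊆ ⋃ p, T i n p := by
  rintro ⟨a, b⟩ ⟨ha, hb⟩
  have ha' : a ∈ U n := mem_iInter.1 ha n
  obtain ⟨k, hk⟩ := mem_iUnion.1 ha'
  have hm := mm_pos n k
  have hb1 : 0 ≤ b - i := by have := hb.1; simp only at this; linarith
  have hb2 : b - i < 1 := by have := hb.2; simp only at this; linarith
  have hnn : 0 ≤ (b - i) * (mm n k : ℝ) := by positivity
  have hlt : ⌊(b - i) * (mm n k : ℝ)⌋₊ < mm n k := by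
    rw [Nat.floor_lt hnn]
    nlinarith
  refine mem_iUnion.2 ⟨⟨k, ⟨_, hlt⟩⟩, hk, ?_, ?_⟩
  · have := Nat.floor_le hnn
    rw [← div_le_iff₀ hm] at this
    simp only
    linarith
  · have := (Nat.lt_floor_add_one ((b - i) * (mm n k : ℝ))).le
    rw [← le_div_iff₀ hm] at this
    simp only
    linarith

lemma strip_ne_top (i : ℤ) (d : ℝ) (hd : 1 < d) :
    μH[d] (A ×ˢ Ico (i : ℝ) (i + 1)) ≠ ∞ := by
  have hsum : Summable fun k : ℕ => (2 : ℝ) ^ d * (1 / 2 : ℝ) ^ (k + 1) :=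
    ((summable_nat_add_iff 1).2 summable_geometric_two).mul_left _
  refine ne_top_of_le_ne_top (b := ∑' k : ℕ, ENNReal.ofReal ((2 : ℝ) ^ d * (1 / 2 : ℝ) ^ (k + 1)))
    hsum.tsum_ofReal_ne_top ?_
  have hr : Tendsto (fun n : ℕ => ENNReal.ofReal (2 / ((n : ℝ) + 1))) atTop (𝓝 0) := by
    have : Tendsto (fun n : ℕ => 2 * (1 / ((n : ℝ) + 1))) atTop (𝓝 (2 * 0)) :=
      tendsto_one_div_add_atTop_nhds_zero_nat.const_mul 2
    have h2 := ENNReal.tendsto_ofReal this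
    simpa [div_eq_mul_inv] using h2
  refine (Measure.hausdorffMeasure_le_liminf_tsum d _ _ hr (T i) ?_
    (Eventually.of_forall fun n => T_cover i n)).trans ?_
  · refine Eventually.of_forall fun n p => (T_diam i n p).trans ?_
    apply ENNReal.ofReal_le_ofReal
    gcongr
    have h1 : n + 1 ≤ mm n p.1 :=
      calc n + 1 ≤ (n + 1) * (p.1 + 1) := Nat.le_mul_of_pos_right _ (by omega)
        _ ≤ _ := Nat.lt_two_pow_self.le
    exact_mod_cast h1
  · refine (liminf_le_liminf (v := fun _ =>
      ∑' k : ℕ, ENNReal.ofReal ((2 : ℝ) ^ d * (1 / 2 : ℝ) ^ (k + 1))) ?_).trans_eq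
      (liminf_const _)
    obtain ⟨N, hN⟩ := exists_nat_gt (1 / (d - 1))
    filter_upwards [eventually_ge_atTop N] with n hn
    have hd' : 0 < d - 1 := by linarith
    have hn1 : 1 ≤ ((n : ℝ) + 1) * (d - 1) := by
      rw [div_lt_iff₀ hd'] at hN
      have : (N : ℝ) ≤ n := by exact_mod_cast hn
      nlinarith
    rw [ENNReal.tsum_sigma']
    refine ENNReal.tsum_le_tsum fun k => ?_
    have hm := mm_pos n k
    calc ∑' b : Fin (mm n k), Metric.ediam (T i n ⟨k, b⟩) ^ d
        ≤ ∑' b : Fin (mm n k), ENNReal.ofReal ((2 / (mm n k : ℝ)) ^ d) := by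
          refine ENNReal.tsum_le_tsum fun b => ?_
          rw [← ENNReal.ofReal_rpow_of_pos (by positivity)]
          exact ENNReal.rpow_le_rpow (T_diam i n ⟨k, b⟩) (by linarith)
      _ = ENNReal.ofReal ((mm n k : ℝ) * (2 / (mm n k : ℝ)) ^ d) := by
          rw [tsum_fintype, Finset.sum_const, Finset.card_univ, Fintype.card_fin, nsmul_eq_mul,
            ENNReal.ofReal_mul hm.le, ENNReal.ofReal_natCast]
      _ ≤ _ := ENNReal.ofReal_le_ofReal (real_bound d n k hn1)

lemma dim_strip : dimH (A ×ˢ (univ : Set ℝ)) ≤ 1 := by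
  have hU : A ×ˢ (univ : Set ℝ) = ⋃ i : ℤ, A ×ˢ Ico (i : ℝ) (i + 1) := by
    rw [← prod_iUnion, iUnion_Ico_intCast]
  rw [hU, dimH_iUnion]
  refine iSup_le fun i => dimH_le fun d hd => ?_
  by_contra h
  have : (1 : ℝ) < d := by
    rw [not_le] at h
    exact_mod_cast h
  exact strip_ne_top i d this hd

end SquareBd

/-- There exists a set `B ⊆ ℝ × ℝ` of Hausdorff dimension `1` containing the boundary of
an axis-parallel square centered at every point of the plane. -/
theorem square_boundaries_dimH_one :
    ∃ B : Set (ℝ × ℝ), dimH B = 1 ∧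
      ∀ x y : ℝ, ∃ r > (0 : ℝ),
        {p : ℝ × ℝ | max |p.1 - x| |p.2 - y| = r} ⊆ B := by
  refine ⟨SquareBd.A ×ˢ Set.univ ∪ Set.univ ×ˢ SquareBd.A, le_antisymm ?_ ?_, ?_⟩
  · rw [dimH_union]
    refine max_le SquareBd.dim_strip ?_
    have : (Set.univ : Set ℝ) ×ˢ SquareBd.A = Prod.swap '' (SquareBd.A ×ˢ (Set.univ : Set ℝ)) := by
      rw [Set.image_swap_prod]
    rw [this]
    have hl : LipschitzWith 1 (Prod.swap : ℝ × ℝ → ℝ × ℝ) :=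
      LipschitzWith.of_dist_le_mul fun p q => by
        simp [Prod.dist_eq, max_comm]
    exact (hl.dimH_image_le _).trans SquareBd.dim_strip
  · obtain ⟨r, -, hr, -⟩ := SquareBd.exists_r 0 0
    rw [← Real.dimH_univ]
    have : (Set.univ : Set ℝ) ⊆
        Prod.fst '' (SquareBd.A ×ˢ Set.univ ∪ Set.univ ×ˢ SquareBd.A) :=
      fun z _ => ⟨(z, 0 + r), Or.inr ⟨trivial, hr⟩, rfl⟩
    exact (dimH_mono this).trans (LipschitzWith.prod_fst.dimH_image_le _)
  · intro x y
    obtain ⟨r, hr, h1, h2, h3, h4⟩ := SquareBd.exists_r x y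
    refine ⟨r, hr, ?_⟩
    rintro ⟨u, v⟩ h
    simp only [Set.mem_ofPred_eq] at h
    rcases max_choice |u - x| |v - y| with hc | hc <;> rw [hc] at h
    · left
      refine ⟨?_, trivial⟩
      rcases (abs_eq hr.le).1 h with h | h
      · rwa [show u = x + r by linarith]
      · rwa [show u = x - r by linarith]
    · right
      refine ⟨trivial, ?_⟩
      rcases (abs_eq hr.le).1 h with h | h
      · rwa [show v = y + r by linarith]
      · rwa [show v = y - r by linarith]
end

section
/- Let A ⊆ ℝ be a finite set and S ⊆ ℝ × ℝ be a finite set such that for every (x, y) ∈ S there exists r > 0 with x − r, x + r, y − r, y + r ∈ A. Then |A| ≥ (1/√2) · |S|^(3/8). (1-Dimensional Main Lemma.) -/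
open Classical in
/-- Summing the reciprocal fibre sizes counts the fibres. -/
lemma sum_inv_fiber_le {α β : Type*} (S : Finset α) (f : α → β) (B : Finset β)
    (hf : ∀ p ∈ S, f p ∈ B) :
    ∑ p ∈ S, ((S.filter (fun q => f q = f p)).card : ℝ)⁻¹ ≤ (B.card : ℝ) := by
  rw [← Finset.sum_fiberwise_of_maps_to hf]
  have : ∀ b ∈ B, ∑ p ∈ S with f p = b, ((S.filter (fun q => f q = f p)).card : ℝ)⁻¹ ≤ 1 := by
    intro b _
    have h1 : ∑ p ∈ S with f p = b, ((S.filter (fun q => f q = f p)).card : ℝ)⁻¹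
        = ∑ p ∈ S with f p = b, ((S.filter (fun q => f q = b)).card : ℝ)⁻¹ := by
      apply Finset.sum_congr rfl
      intro p hp
      rw [(Finset.mem_filter.mp hp).2]
    rw [h1, Finset.sum_const, nsmul_eq_mul]
    exact mul_inv_le_one
  calc _ ≤ ∑ b ∈ B, (1 : ℝ) := Finset.sum_le_sum this
    _ = _ := by simp

/-- Weighted AM-GM for three terms. -/
lemma amgm_aux (u v s : ℝ) (hu : 0 < u) (hv : 0 < v) (hs : 0 ≤ s) :
    3 * s ^ 2 ≤ u * v + s ^ 3 * u⁻¹ + s ^ 3 * v⁻¹ := by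
  obtain ⟨x, hx, rfl⟩ : ∃ x : ℝ, 0 < x ∧ x ^ 2 = u := ⟨√u, Real.sqrt_pos.mpr hu, Real.sq_sqrt hu.le⟩
  obtain ⟨y, hy, rfl⟩ : ∃ x : ℝ, 0 < x ∧ x ^ 2 = v := ⟨√v, Real.sqrt_pos.mpr hv, Real.sq_sqrt hv.le⟩
  have hw : 0 < x * y := mul_pos hx hy
  have h1 : 0 ≤ ((x * y - s) ^ 2 * (x * y + 2 * s)) / (x * y) := by positivity
  have h2 : 0 ≤ s ^ 3 * (x⁻¹ - y⁻¹) ^ 2 := by positivity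
  have h3 : x ^ 2 * y ^ 2 + s ^ 3 * (x ^ 2)⁻¹ + s ^ 3 * (y ^ 2)⁻¹ - 3 * s ^ 2
      = ((x * y - s) ^ 2 * (x * y + 2 * s)) / (x * y) + s ^ 3 * (x⁻¹ - y⁻¹) ^ 2 := by
    field_simp
    ring
  linarith

open Classical in
/-- The bound `|S|^3 ≤ |A|^8`. -/
lemma card_cube_le (A : Finset ℝ) (S : Finset (ℝ × ℝ)) (r : ℝ × ℝ → ℝ)
    (h : ∀ p ∈ S, p.1 - r p ∈ A ∧ p.1 + r p ∈ A ∧ p.2 - r p ∈ A ∧ p.2 + r p ∈ A) :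
    (S.card : ℝ) ^ 3 ≤ (A.card : ℝ) ^ 8 := by
  set f : ℝ × ℝ → ℝ × ℝ := fun p => (p.1 - r p, p.2 + r p) with hf
  set g : ℝ × ℝ → ℝ × ℝ := fun p => (p.1 - r p, p.2 - r p) with hg
  set F : ℝ × ℝ → Finset (ℝ × ℝ) := fun p => S.filter (fun q => f q = f p) with hF
  set G : ℝ × ℝ → Finset (ℝ × ℝ) := fun p => S.filter (fun q => g q = g p) with hG
  have hfS : ∑ p ∈ S, ((F p).card : ℝ)⁻¹ ≤ (A.card : ℝ) ^ 2 := by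
    have := sum_inv_fiber_le S f (A ×ˢ A) (fun p hp => by
      obtain ⟨h1, h2, h3, h4⟩ := h p hp
      exact Finset.mem_product.mpr ⟨h1, h4⟩)
    rw [Finset.card_product] at this
    push_cast at this
    rw [sq]; convert this
  have hgS : ∑ p ∈ S, ((G p).card : ℝ)⁻¹ ≤ (A.card : ℝ) ^ 2 := by
    have := sum_inv_fiber_le S g (A ×ˢ A) (fun p hp => by
      obtain ⟨h1, h2, h3, h4⟩ := h p hp
      exact Finset.mem_product.mpr ⟨h1, h3⟩)
    rw [Finset.card_product] at this
    push_cast at this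
    rw [sq]; convert this
  have hT : ∑ p ∈ S, ((F p).card : ℝ) * (G p).card ≤ (A.card : ℝ) ^ 4 := by
    have key : (S.sigma (fun p => F p ×ˢ G p)).card ≤ (A ×ˢ A ×ˢ A ×ˢ A).card := by
      apply Finset.card_le_card_of_injOn
        (fun t => (t.2.1.1 + r t.2.1, t.2.1.2 - r t.2.1, t.2.2.1 + r t.2.2, t.2.2.2 + r t.2.2))
      · rintro ⟨p, q, w⟩ ht
        simp only [Finset.mem_coe, Finset.mem_sigma, Finset.mem_product, hF, hG,
          Finset.mem_filter] at ht ⊢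
        obtain ⟨hp, ⟨hq, -⟩, hw, -⟩ := ht
        exact ⟨(h q hq).2.1, (h q hq).2.2.1, (h w hw).2.1, (h w hw).2.2.2⟩
      · rintro ⟨p, q, w⟩ ht ⟨p₂, q₂, w₂⟩ ht₂ he
        simp only [Finset.mem_coe, Finset.mem_sigma, Finset.mem_product, hF, hG, hf, hg,
          Finset.mem_filter, Prod.mk.injEq] at ht ht₂ he
        obtain ⟨-, ⟨-, e1, e2⟩, -, e3, e4⟩ := ht
        obtain ⟨-, ⟨-, k1, k2⟩, -, k3, k4⟩ := ht₂
        obtain ⟨m1, m2, m3, m4⟩ := he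
        have hp : p = p₂ := Prod.ext (by linarith) (by linarith)
        subst hp
        have hq : q = q₂ := Prod.ext (by linarith) (by linarith)
        have hw : w = w₂ := Prod.ext (by linarith) (by linarith)
        rw [hq, hw]
    simp only [Finset.card_sigma, Finset.card_product] at key
    have key2 : ((∑ p ∈ S, (F p).card * (G p).card : ℕ) : ℝ)
        ≤ ((A.card * (A.card * (A.card * A.card)) : ℕ) : ℝ) := by exact_mod_cast key
    push_cast at key2
    calc _ ≤ _ := key2
      _ = _ := by ring
  rcases S.eq_empty_or_nonempty with rfl | ⟨p0, hp0⟩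
  · simp
  have hA : 0 < (A.card : ℝ) := by
    exact_mod_cast Finset.card_pos.mpr ⟨_, (h p0 hp0).1⟩
  set n : ℝ := (A.card : ℝ)
  set N : ℝ := (S.card : ℝ) with hN
  have hN0 : 0 ≤ N := by positivity
  set s : ℝ := N / n ^ 2 with hs
  have hs0 : 0 ≤ s := by positivity
  have hsum : ∑ p ∈ S, 3 * s ^ 2 ≤ ∑ p ∈ S, (((F p).card : ℝ) * (G p).card
      + s ^ 3 * ((F p).card : ℝ)⁻¹ + s ^ 3 * ((G p).card : ℝ)⁻¹) := by
    apply Finset.sum_le_sum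
    intro p hp
    apply amgm_aux _ _ _ _ _ hs0
    · exact_mod_cast Finset.card_pos.mpr ⟨p, by simp [hF, hp]⟩
    · exact_mod_cast Finset.card_pos.mpr ⟨p, by simp [hG, hp]⟩
  rw [Finset.sum_add_distrib, Finset.sum_add_distrib, ← Finset.mul_sum, ← Finset.mul_sum, ← Finset.mul_sum,
    Finset.sum_const, nsmul_eq_mul, ← hN] at hsum
  have hs3 : 0 ≤ s ^ 3 := by positivity
  have i1 := mul_le_mul_of_nonneg_left hfS hs3
  have i2 := mul_le_mul_of_nonneg_left hgS hs3
  have hNs : N = s * n ^ 2 := by rw [hs]; field_simp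
  have i3 : s ^ 3 * n ^ 2 ≤ n ^ 4 := by
    have : N * (3 * s ^ 2) = 3 * (s ^ 3 * n ^ 2) := by rw [hNs]; ring
    linarith
  calc N ^ 3 = (s ^ 3 * n ^ 2) * n ^ 4 := by rw [hNs]; ring
    _ ≤ n ^ 4 * n ^ 4 := mul_le_mul_of_nonneg_right i3 (pow_nonneg hA.le 4)
    _ = n ^ 8 := by ring


/-- **1-Dimensional Main Lemma.** If `A ⊆ ℝ` and `S ⊆ ℝ²` are finite sets such that for
every `(x, y) ∈ S` there is `r > 0` with `x - r, x + r, y - r, y + r ∈ A`, then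
`|A| ≥ (1/√2) · |S|^(3/8)`. -/
theorem main_lemma_1d (A : Finset ℝ) (S : Finset (ℝ × ℝ))
    (h : ∀ p ∈ S, ∃ r > (0 : ℝ),
      p.1 - r ∈ A ∧ p.1 + r ∈ A ∧ p.2 - r ∈ A ∧ p.2 + r ∈ A) :
    (1 / Real.sqrt 2) * (S.card : ℝ) ^ ((3 : ℝ) / 8) ≤ (A.card : ℝ) := by
  have hex : ∀ p : ℝ × ℝ, ∃ r : ℝ, p ∈ S →
      p.1 - r ∈ A ∧ p.1 + r ∈ A ∧ p.2 - r ∈ A ∧ p.2 + r ∈ A := by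
    intro p
    by_cases hp : p ∈ S
    · obtain ⟨r, -, hr⟩ := h p hp
      exact ⟨r, fun _ => hr⟩
    · exact ⟨0, fun hq => absurd hq hp⟩
  choose r hr using hex
  have hc := card_cube_le A S r hr
  have h1 : (S.card : ℝ) ^ ((3 : ℝ) / 8) ≤ (A.card : ℝ) := by
    have e1 : (S.card : ℝ) ^ ((3 : ℝ) / 8) = ((S.card : ℝ) ^ 3) ^ ((1 : ℝ) / 8) := by
      rw [← Real.rpow_natCast, ← Real.rpow_mul (by positivity)]
      norm_num
    have e2 : (A.card : ℝ) = ((A.card : ℝ) ^ 8) ^ ((1 : ℝ) / 8) := by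
      rw [← Real.rpow_natCast, ← Real.rpow_mul (by positivity)]
      norm_num
    rw [e1, e2]
    exact Real.rpow_le_rpow (pow_nonneg (Nat.cast_nonneg _) 3) hc (by norm_num)
  have h2 : 1 / Real.sqrt 2 ≤ 1 := by
    rw [div_le_one (by positivity)]
    exact Real.one_le_sqrt.mpr (by norm_num)
  have h3 : 0 ≤ (S.card : ℝ) ^ ((3 : ℝ) / 8) := by positivity
  calc _ ≤ 1 * (S.card : ℝ) ^ ((3 : ℝ) / 8) := mul_le_mul_of_nonneg_right h2 h3
    _ ≤ _ := by rw [one_mul]; exact h1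
end

section
/- Let l ≤ n be positive integers. There exists a constant C > 0, depending only on n and l, such that: whenever A ⊆ ℝ^l and S ⊆ ℝⁿ are finite sets with the property that for every x ∈ S there exists r > 0 such that for every strictly increasing map ι : Fin l → Fin n (i.e. every choice of indices 1 ≤ i₁ < … < i_l ≤ n) and every sign vector ε ∈ {−1, +1}^l the point (x_{ι(1)} + ε₁·r, …, x_{ι(l)} + ε_l·r) belongs to A, then |A| ≥ C · |S|^(l(2n−1)/(2n²)). (Thornton's (n,l)-dimensional Main Lemma.) -/
/-- Multi-function Hölder inequality, power form. -/
lemma thornton_holder {T : Type*} (s : Finset T) (m : ℕ) (hm : 0 < m) (c : T → ℝ)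
    (a : Fin m → T → ℝ) (hc : ∀ t ∈ s, 0 ≤ c t) (ha : ∀ i, ∀ t ∈ s, 0 ≤ a i t)
    (h : ∀ t ∈ s, c t ^ m ≤ ∏ i, a i t) :
    (∑ t ∈ s, c t) ^ m ≤ ∏ i, ∑ t ∈ s, a i t := by
  have hm' : (0 : ℝ) < m := by exact_mod_cast hm
  by_cases hz : ∃ i, ∑ t ∈ s, a i t = 0
  · obtain ⟨i, hi⟩ := hz
    have h0 := (Finset.sum_eq_zero_iff_of_nonneg (ha i)).1 hi
    have hc0 : ∑ t ∈ s, c t = 0 := by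
      refine Finset.sum_eq_zero fun t ht => ?_
      have h1 := h t ht
      rw [Finset.prod_eq_zero (Finset.mem_univ i) (h0 t ht)] at h1
      have h2 : c t ^ m = 0 := le_antisymm h1 (pow_nonneg (hc t ht) _)
      exact pow_eq_zero_iff hm.ne' |>.1 h2
    rw [hc0, zero_pow hm.ne']
    exact Finset.prod_nonneg fun i _ => Finset.sum_nonneg (ha i)
  · push Not at hz
    have hA : ∀ i, 0 < ∑ t ∈ s, a i t := fun i =>
      lt_of_le_of_ne (Finset.sum_nonneg (ha i)) (hz i).symm
    set A : Fin m → ℝ := fun i => ∑ t ∈ s, a i t with hAdef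
    set P : ℝ := (∏ i, A i) ^ ((m : ℝ)⁻¹) with hP
    have hprod : 0 < ∏ i, A i := Finset.prod_pos fun i _ => hA i
    have hPpos : 0 < P := Real.rpow_pos_of_pos hprod _
    have hPm : P ^ m = ∏ i, A i := Real.rpow_inv_natCast_pow hprod.le hm.ne'
    have key : ∀ t ∈ s, c t ≤ P * ∑ i, (m : ℝ)⁻¹ * (a i t / A i) := by
      intro t ht
      have hnn : ∀ i, 0 ≤ a i t / A i := fun i => div_nonneg (ha i t ht) (hA i).le
      have amgm := Real.geom_mean_le_arith_mean_weighted Finset.univ (fun _ : Fin m => (m : ℝ)⁻¹)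
        (fun i => a i t / A i) (fun _ _ => by positivity) (by simp [hm'.ne'])
        (fun i _ => hnn i)
      rw [Real.finsetProd_rpow _ _ (fun i _ => hnn i)] at amgm
      refine le_trans ?_ (mul_le_mul_of_nonneg_left amgm hPpos.le)
      refine le_of_pow_le_pow_left₀ hm.ne'
        (mul_nonneg hPpos.le (Real.rpow_nonneg (Finset.prod_nonneg fun i _ => hnn i) _)) ?_
      rw [mul_pow, hPm, Real.rpow_inv_natCast_pow (Finset.prod_nonneg fun i _ => hnn i) hm.ne',
        ← Finset.prod_mul_distrib]
      refine (h t ht).trans (le_of_eq ?_)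
      refine Finset.prod_congr rfl fun i _ => ?_
      have : A i ≠ 0 := (hA i).ne'
      field_simp
    have hsum : ∑ t ∈ s, c t ≤ P := by
      refine (Finset.sum_le_sum key).trans (le_of_eq ?_)
      rw [← Finset.mul_sum, Finset.sum_comm]
      have : ∀ i, ∑ t ∈ s, (m : ℝ)⁻¹ * (a i t / A i) = (m : ℝ)⁻¹ := by
        intro i
        rw [← Finset.mul_sum, ← Finset.sum_div, div_self (hA i).ne', mul_one]
      simp [this, hm'.ne']
    rw [← hPm]
    exact pow_le_pow_left₀ (Finset.sum_nonneg hc) hsum m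

/-- Delete the coordinate `i`. -/
def thorntonRem {n : ℕ} (i : Fin (n + 1)) (x : Fin (n + 1) → ℝ) : Fin n → ℝ :=
  fun j => x (i.succAbove j)

lemma thorntonRem_succ {n : ℕ} (i : Fin (n + 1)) (x : Fin (n + 2) → ℝ) :
    thorntonRem i.succ x = Fin.cons (x 0) (thorntonRem i (thorntonRem 0 x)) := by
  funext j
  refine Fin.cases ?_ (fun j => ?_) j
  · simp [thorntonRem]
  · simp [thorntonRem]

/-- The discrete Loomis–Whitney inequality. -/
lemma thornton_LW (n : ℕ) : ∀ S : Finset (Fin (n + 1) → ℝ), S.Nonempty →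
    (S.card : ℝ) ^ n ≤ ∏ i, ((S.image (thorntonRem i)).card : ℝ) := by
  classical
  induction n with
  | zero =>
    intro S hS
    simp only [pow_zero]
    rw [Fin.prod_univ_one]
    have : 0 < (S.image (thorntonRem (0 : Fin 1))).card := (hS.image _).card_pos
    exact_mod_cast this
  | succ n ih =>
    intro S hS
    set T := S.image (fun x => x 0) with hT
    let F : ℝ → Finset (Fin (n + 2) → ℝ) := fun t => S.filter (fun x => x 0 = t)
    let G : ℝ → Finset (Fin (n + 1) → ℝ) := fun t => (F t).image (thorntonRem 0)
    have hGcard : ∀ t, (G t).card = (F t).card := by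
      intro t
      refine Finset.card_image_of_injOn ?_
      intro x hx y hy hxy
      have hx0 : x 0 = t := (Finset.mem_filter.1 hx).2
      have hy0 : y 0 = t := (Finset.mem_filter.1 hy).2
      funext j
      refine Fin.cases (hx0.trans hy0.symm) (fun j => ?_) j
      have := congrFun hxy j
      simpa [thorntonRem] using this
    have hcard : (S.card : ℝ) = ∑ t ∈ T, ((F t).card : ℝ) := by
      exact_mod_cast Finset.card_eq_sum_card_image (fun x : Fin (n + 2) → ℝ => x 0) S
    have hM : ∀ t, ((F t).card : ℝ) ≤ ((S.image (thorntonRem 0)).card : ℝ) := by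
      intro t
      rw [← hGcard]
      exact_mod_cast Finset.card_le_card (Finset.image_subset_image (Finset.filter_subset _ _))
    set M : ℝ := ((S.image (thorntonRem 0)).card : ℝ) with hMdef
    have hproj : ∀ i : Fin (n + 1), ∑ t ∈ T, (((G t).image (thorntonRem i)).card : ℝ)
        ≤ ((S.image (thorntonRem i.succ)).card : ℝ) := by
      intro i
      have hfib : (S.image (thorntonRem i.succ)).card =
          ∑ t ∈ T, ((S.image (thorntonRem i.succ)).filter (fun y => y 0 = t)).card := by
        refine Finset.card_eq_sum_card_fiberwise ?_
        intro y hy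
        obtain ⟨x, hx, rfl⟩ := Finset.mem_image.1 hy
        refine Finset.mem_image.2 ⟨x, hx, ?_⟩
        simp [thorntonRem]
      rw [hfib]
      push_cast
      refine Finset.sum_le_sum fun t _ => ?_
      have : ((G t).image (thorntonRem i)).card ≤
          ((S.image (thorntonRem i.succ)).filter (fun y => y 0 = t)).card := by
        refine Finset.card_le_card_of_injOn (fun z => (Fin.cons t z : Fin (n + 1) → ℝ)) ?_ ?_
        · intro z hz
          obtain ⟨w, hw, rfl⟩ := Finset.mem_image.1 hz
          obtain ⟨x, hx, rfl⟩ := Finset.mem_image.1 hw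
          obtain ⟨hxS, hx0⟩ := Finset.mem_filter.1 hx
          refine Finset.mem_coe.2 (Finset.mem_filter.2 ⟨Finset.mem_image.2 ⟨x, hxS, ?_⟩, ?_⟩)
          · rw [thorntonRem_succ, hx0]
          · simp
        · intro z _ w _ hzw
          exact Fin.cons_right_injective (α := fun _ => ℝ) t hzw
      exact_mod_cast this
    -- apply Hölder after absorbing M
    have hslice : ∀ t ∈ T, ((F t).card : ℝ) ^ (n + 1) ≤
        M * ∏ i, (((G t).image (thorntonRem i)).card : ℝ) := by
      intro t ht
      obtain ⟨x, hx, hxt⟩ := Finset.mem_image.1 ht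
      have hne : (G t).Nonempty :=
        ⟨_, Finset.mem_image_of_mem _ (Finset.mem_filter.2 ⟨hx, hxt⟩)⟩
      have h1 := ih (G t) hne
      rw [hGcard] at h1
      rw [pow_succ, mul_comm]
      exact mul_le_mul (hM t) h1 (by positivity) (by positivity)
    have hMpos : 0 < M := by
      have : 0 < (S.image (thorntonRem 0)).card := (hS.image _).card_pos
      rw [hMdef]
      exact_mod_cast this
    have hH := thornton_holder T (n + 1) (Nat.succ_pos n) (fun t => ((F t).card : ℝ))
      (fun i t => (if i = 0 then M else 1) * (((G t).image (thorntonRem i)).card : ℝ))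
      (fun _ _ => by positivity)
      (fun i _ _ => by split_ifs <;> positivity)
      (fun t ht => by
        rw [Finset.prod_mul_distrib, Finset.prod_ite_eq' Finset.univ (0 : Fin (n + 1)) (fun _ => M)]
        simpa using hslice t ht)
    rw [hcard]
    refine hH.trans ?_
    have hpull : ∀ i : Fin (n + 1), ∑ t ∈ T, (if i = 0 then M else 1) *
        (((G t).image (thorntonRem i)).card : ℝ) =
        (if i = 0 then M else 1) * ∑ t ∈ T, (((G t).image (thorntonRem i)).card : ℝ) :=
      fun i => (Finset.mul_sum _ _ _).symm
    rw [Finset.prod_congr rfl (fun i _ => hpull i)]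
    rw [Finset.prod_mul_distrib, Finset.prod_ite_eq' Finset.univ (0 : Fin (n + 1)) (fun _ => M),
      if_pos (Finset.mem_univ _)]
    rw [Fin.prod_univ_succ (fun i : Fin (n + 2) => ((S.image (thorntonRem i)).card : ℝ))]
    refine mul_le_mul_of_nonneg_left ?_ hMpos.le
    exact Finset.prod_le_prod (fun i _ => Finset.sum_nonneg fun t _ => Nat.cast_nonneg _)
      (fun i _ => hproj i)

/-- Shearer-type inequality for the `l`-dimensional coordinate projections. -/
lemma thornton_shearer (l : ℕ) (hl : 0 < l) (A : Finset (Fin l → ℝ)) (n : ℕ) (hn : l ≤ n) :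
    ∀ B : Finset (Fin n → ℝ),
      (∀ x ∈ B, ∀ ι : Fin l → Fin n, StrictMono ι → (fun j => x (ι j)) ∈ A) →
      (B.card : ℝ) ^ l ≤ (A.card : ℝ) ^ n := by
  classical
  induction n, hn using Nat.le_induction with
  | base =>
    intro B hB
    have : B ⊆ A := fun x hx => hB x hx id strictMono_id
    gcongr
  | succ n hn ih =>
    intro B hB
    rcases B.eq_empty_or_nonempty with rfl | hne
    · simp [hl.ne']
    have hn0 : n ≠ 0 := by omega
    refine le_of_pow_le_pow_left₀ hn0 (by positivity) ?_
    calc ((B.card : ℝ) ^ l) ^ n = ((B.card : ℝ) ^ n) ^ l := by ring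
      _ ≤ (∏ i, ((B.image (thorntonRem i)).card : ℝ)) ^ l :=
          pow_le_pow_left₀ (by positivity) (thornton_LW n B hne) l
      _ = ∏ i, ((B.image (thorntonRem i)).card : ℝ) ^ l := by rw [Finset.prod_pow]
      _ ≤ ∏ _i : Fin (n + 1), (A.card : ℝ) ^ n := by
          refine Finset.prod_le_prod (fun i _ => by positivity) fun i _ => ?_
          refine ih _ ?_
          intro x hx ι hι
          obtain ⟨y, hy, rfl⟩ := Finset.mem_image.1 hx
          exact hB y hy (fun j => i.succAbove (ι j)) ((Fin.strictMono_succAbove i).comp hι)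
      _ = ((A.card : ℝ) ^ (n + 1)) ^ n := by
          simp only [Finset.prod_const, Finset.card_univ, Fintype.card_fin]; ring

lemma thorntonRem_update {n : ℕ} (i : Fin (n + 1)) (y : Fin (n + 1) → ℝ) (c : ℝ) :
    thorntonRem i (Function.update y i c) = thorntonRem i y := by
  funext j
  simp [thorntonRem, Fin.succAbove_ne]

/-- Axis-parallel version of the main counting argument. -/
lemma thornton_axis (n : ℕ) (S B : Finset (Fin (n + 1) → ℝ))
    (h : ∀ y ∈ S, ∃ r : ℝ, ∀ i, Function.update y i (y i + r) ∈ B ∧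
      Function.update y i (y i - r) ∈ B) :
    (S.card : ℝ) ^ (2 * n + 1) ≤
      (2 ^ n * (2 * (n + 1 : ℝ)) ^ (n + 1)) * (B.card : ℝ) ^ (2 * (n + 1)) := by
  classical
  rcases S.eq_empty_or_nonempty with rfl | hne
  · simp
    positivity
  choose! r hr using h
  have hspos : (0 : ℝ) < S.card := by exact_mod_cast hne.card_pos
  have hbpos : (0 : ℝ) < B.card := by
    obtain ⟨y, hy⟩ := hne
    have : 0 < B.card := Finset.card_pos.2 ⟨_, (hr y hy 0).1⟩
    exact_mod_cast this
  set s : ℝ := (S.card : ℝ) with hs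
  set b : ℝ := (B.card : ℝ) with hb
  let j : ℝ := s / (2 * (n + 1) * b)
  have hjpos : 0 < j := by positivity
  let D : Fin (n + 1) → (Fin (n + 1) → ℝ) → Finset (Fin (n + 1) → ℝ) :=
    fun i y => B.filter (fun z => thorntonRem i z = thorntonRem i y)
  have hDcongr : ∀ i y z, thorntonRem i y = thorntonRem i z → D i y = D i z := by
    intro i y z hyz
    simp only [D, hyz]
  let P : Fin (n + 1) → Finset (Fin (n + 1) → ℝ) :=
    fun i => S.filter (fun y => ((D i y).card : ℝ) < j)
  let R : Finset (Fin (n + 1) → ℝ) := S.filter (fun y => ∀ i, j ≤ ((D i y).card : ℝ))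
  have hP : ∀ i, ((P i).card : ℝ) ≤ b * j := by
    intro i
    let Q := B.filter (fun z => ((D i z).card : ℝ) < j)
    have h1 : (P i).card ≤ (Q.sigma (fun z => D i z)).card := by
      refine Finset.card_le_card_of_injOn
        (fun y => ⟨Function.update y i (y i + r y), Function.update y i (y i - r y)⟩) ?_ ?_
      · intro y hy
        obtain ⟨hyS, hyj⟩ := Finset.mem_filter.1 hy
        refine Finset.mem_coe.2 (Finset.mem_sigma.2 ⟨Finset.mem_filter.2 ⟨(hr y hyS i).1, ?_⟩,
          Finset.mem_filter.2 ⟨(hr y hyS i).2, ?_⟩⟩)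
        · rw [hDcongr i _ y (thorntonRem_update i y _)]
          exact hyj
        · rw [thorntonRem_update, thorntonRem_update]
      · intro y _ z _ hyz
        simp only [Sigma.mk.injEq, heq_eq_eq] at hyz
        obtain ⟨h1, h2⟩ := hyz
        funext k
        have e1 := congrFun h1 k
        have e2 := congrFun h2 k
        by_cases hk : k = i
        · subst hk
          simp only [Function.update_self] at e1 e2
          linarith
        · simpa [Function.update_of_ne hk] using e1
    rw [Finset.card_sigma] at h1
    have h2 : ((P i).card : ℝ) ≤ ∑ z ∈ Q, ((D i z).card : ℝ) := by exact_mod_cast h1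
    calc ((P i).card : ℝ) ≤ ∑ z ∈ Q, ((D i z).card : ℝ) := h2
      _ ≤ ∑ _z ∈ Q, j := Finset.sum_le_sum fun z hz => (Finset.mem_filter.1 hz).2.le
      _ = Q.card * j := by simp
      _ ≤ b * j := by
        refine mul_le_mul_of_nonneg_right ?_ hjpos.le
        rw [hb]
        exact_mod_cast Finset.card_le_card (Finset.filter_subset _ _)
  have hcover : s ≤ R.card + ∑ i, ((P i).card : ℝ) := by
    have hsub : S ⊆ R ∪ Finset.univ.biUnion P := by
      intro y hy
      by_cases hyR : ∀ i, j ≤ ((D i y).card : ℝ)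
      · exact Finset.mem_union_left _ (Finset.mem_filter.2 ⟨hy, hyR⟩)
      · push Not at hyR
        obtain ⟨i, hi⟩ := hyR
        exact Finset.mem_union_right _
          (Finset.mem_biUnion.2 ⟨i, Finset.mem_univ _, Finset.mem_filter.2 ⟨hy, hi⟩⟩)
    have : S.card ≤ R.card + ∑ i, (P i).card :=
      (Finset.card_le_card hsub).trans ((Finset.card_union_le _ _).trans
        (Nat.add_le_add_left Finset.card_biUnion_le _))
    rw [hs]
    exact_mod_cast this
  have hsumP : ∑ i, ((P i).card : ℝ) ≤ s / 2 := by
    calc ∑ i, ((P i).card : ℝ) ≤ ∑ _i : Fin (n + 1), b * j := Finset.sum_le_sum fun i _ => hP i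
      _ = s / 2 := by
        simp only [Finset.sum_const, Finset.card_univ, Fintype.card_fin, nsmul_eq_mul, j]
        push_cast
        field_simp
  have hRcard : s / 2 ≤ R.card := by linarith
  have hRne : R.Nonempty := by
    rw [← Finset.card_pos]
    have : (0 : ℝ) < R.card := by linarith
    exact_mod_cast this
  have hRproj : ∀ i, ((R.image (thorntonRem i)).card : ℝ) ≤ b / j := by
    intro i
    rw [le_div_iff₀ hjpos]
    have hsub : R.image (thorntonRem i) ⊆ B.image (thorntonRem i) := by
      intro z hz
      obtain ⟨y, hy, rfl⟩ := Finset.mem_image.1 hz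
      have hyS := (Finset.mem_filter.1 hy).1
      exact Finset.mem_image.2 ⟨_, (hr y hyS i).1, thorntonRem_update i y _⟩
    have hBc : b = ∑ z ∈ B.image (thorntonRem i),
        ((B.filter (fun w => thorntonRem i w = z)).card : ℝ) := by
      rw [hb]
      exact_mod_cast Finset.card_eq_sum_card_image (thorntonRem i) B
    calc ((R.image (thorntonRem i)).card : ℝ) * j
        = ∑ _z ∈ R.image (thorntonRem i), j := by simp
      _ ≤ ∑ z ∈ R.image (thorntonRem i),
          ((B.filter (fun w => thorntonRem i w = z)).card : ℝ) := by
          refine Finset.sum_le_sum fun z hz => ?_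
          obtain ⟨y, hy, rfl⟩ := Finset.mem_image.1 hz
          exact (Finset.mem_filter.1 hy).2 i
      _ ≤ b := by
          rw [hBc]
          exact Finset.sum_le_sum_of_subset_of_nonneg hsub (fun _ _ _ => by positivity)
  have hfin : (s / 2) ^ n ≤ (b / j) ^ (n + 1) := by
    calc (s / 2) ^ n ≤ (R.card : ℝ) ^ n := pow_le_pow_left₀ (by positivity) hRcard n
      _ ≤ ∏ i, ((R.image (thorntonRem i)).card : ℝ) := thornton_LW n R hRne
      _ ≤ ∏ _i : Fin (n + 1), b / j :=
          Finset.prod_le_prod (fun i _ => by positivity) fun i _ => hRproj i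
      _ = (b / j) ^ (n + 1) := by
          rw [Finset.prod_const, Finset.card_univ, Fintype.card_fin]
  have hbj : b / j = 2 * (n + 1) * b ^ 2 / s := by
    simp only [j]
    field_simp
  rw [hbj, div_pow, div_pow, div_le_div_iff₀ (by positivity) (by positivity)] at hfin
  calc s ^ (2 * n + 1) = s ^ n * s ^ (n + 1) := by ring
    _ ≤ _ := hfin
    _ = _ := by rw [mul_pow, ← pow_mul]; ring

/-- Skew coordinates adapted to `n + 1` independent main diagonals. -/
noncomputable def thorntonPsi {n : ℕ} (x : Fin (n + 1) → ℝ) : Fin (n + 1) → ℝ :=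
  Fin.cons (x 0 - ∑ i : Fin n, (x 0 - x i.succ) / 2) (fun i : Fin n => (x 0 - x i.succ) / 2)

/-- The chosen diagonal directions. -/
def thorntonV {n : ℕ} (i k : Fin (n + 1)) : ℝ := if i = k ∧ k ≠ 0 then -1 else 1

lemma thorntonPsi_injective {n : ℕ} : Function.Injective (thorntonPsi (n := n)) := by
  intro x y hxy
  have h0 := congrFun hxy 0
  have hs : ∀ i : Fin n, (x 0 - x i.succ) / 2 = (y 0 - y i.succ) / 2 := by
    intro i
    simpa [thorntonPsi] using congrFun hxy i.succ
  simp only [thorntonPsi, Fin.cons_zero] at h0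
  rw [Finset.sum_congr rfl (fun i _ => hs i)] at h0
  have h0' : x 0 = y 0 := by linarith
  funext k
  refine Fin.cases h0' (fun k => ?_) k
  have := hs k
  linarith

lemma thorntonPsi_add {n : ℕ} (x : Fin (n + 1) → ℝ) (i : Fin (n + 1)) (c : ℝ) :
    thorntonPsi (fun k => x k + thorntonV i k * c) =
      Function.update (thorntonPsi x) i (thorntonPsi x i + c) := by
  have hsucc : ∀ k : Fin n, thorntonPsi (fun k => x k + thorntonV i k * c) k.succ =
      thorntonPsi x k.succ + if i = k.succ then c else 0 := by
    intro k
    simp only [thorntonPsi, Fin.cons_succ, thorntonV]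
    by_cases hk : i = k.succ
    · simp [hk]; ring
    · simp [hk]
  funext k
  refine Fin.cases ?_ (fun k => ?_) k
  · have hz : ∀ z : Fin (n + 1) → ℝ, thorntonPsi z 0 = z 0 - ∑ k : Fin n, thorntonPsi z k.succ := by
      intro z
      simp [thorntonPsi]
    rw [hz, Finset.sum_congr rfl (fun k _ => hsucc k), Finset.sum_add_distrib]
    refine Fin.cases ?_ (fun p => ?_) i
    · rw [Function.update_self, hz x]
      simp [thorntonV, (Fin.succ_ne_zero _).symm]
      ring
    · rw [Function.update_of_ne (Fin.succ_ne_zero _).symm, hz x]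
      simp [thorntonV]
  · rw [hsucc]
    by_cases hk : i = k.succ
    · subst hk
      simp
    · rw [Function.update_of_ne (Ne.symm hk)]
      simp [hk]

lemma thorntonV_sign {n : ℕ} (i k : Fin (n + 1)) : thorntonV i k = 1 ∨ thorntonV i k = -1 := by
  unfold thorntonV
  split_ifs <;> simp

/-- **Thornton's (n,l)-dimensional Main Lemma.** For positive integers `l ≤ n` there is a
constant `C > 0` depending only on `n` and `l` such that: if `A ⊆ ℝ^l` and `S ⊆ ℝⁿ` are
finite sets with the property that for every `x ∈ S` there is `r > 0` such that for every
strictly increasing `ι : Fin l → Fin n` and every sign vector `ε ∈ {-1, +1}^l` the point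
`(x (ι j) + ε j * r)_j` is in `A`, then `|A| ≥ C · |S|^(l(2n-1)/(2n²))`. -/
theorem thornton_main_lemma (n l : ℕ) (hl : 0 < l) (hln : l ≤ n) :
    ∃ C > (0 : ℝ), ∀ (A : Finset (Fin l → ℝ)) (S : Finset (Fin n → ℝ)),
      (∀ x ∈ S, ∃ r > (0 : ℝ), ∀ ι : Fin l → Fin n, StrictMono ι →
        ∀ ε : Fin l → ℝ, (∀ j, ε j = 1 ∨ ε j = -1) →
          (fun j => x (ι j) + ε j * r) ∈ A) →
      C * (S.card : ℝ) ^ (((l : ℝ) * (2 * n - 1)) / (2 * (n : ℝ) ^ 2)) ≤ (A.card : ℝ) := by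
  classical
  obtain ⟨m, rfl⟩ : ∃ m, n = m + 1 := ⟨n - 1, by omega⟩
  set K : ℝ := 2 ^ m * (2 * (m + 1 : ℝ)) ^ (m + 1) with hK
  have hKpos : 0 < K := by positivity
  set q : ℕ := 2 * (m + 1) ^ 2 with hq
  have hq0 : q ≠ 0 := by positivity
  refine ⟨((K ^ l)⁻¹) ^ ((q : ℝ)⁻¹), Real.rpow_pos_of_pos (by positivity) _, ?_⟩
  intro A S h
  choose! r hr hA using h
  let B : Finset (Fin (m + 1) → ℝ) :=
    S.biUnion fun x => Finset.univ.biUnion fun i : Fin (m + 1) =>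
      {(fun k => x k + thorntonV i k * r x), (fun k => x k + thorntonV i k * (-r x))}
  have hBA : ∀ z ∈ B, ∀ ι : Fin l → Fin (m + 1), StrictMono ι → (fun j => z (ι j)) ∈ A := by
    intro z hz ι hι
    simp only [B, Finset.mem_biUnion, Finset.mem_univ, true_and, Finset.mem_insert,
      Finset.mem_singleton] at hz
    obtain ⟨x, hx, i, rfl | rfl⟩ := hz
    · exact hA x hx ι hι (fun j => thorntonV i (ι j)) (fun j => thorntonV_sign _ _)
    · have := hA x hx ι hι (fun j => -thorntonV i (ι j)) (fun j => by
        rcases thorntonV_sign i (ι j) with h | h <;> simp [h])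
      simpa using this
  have h1 := thornton_shearer l hl A (m + 1) hln B hBA
  have h2 := thornton_axis m (S.image thorntonPsi) (B.image thorntonPsi) (by
    intro y hy
    obtain ⟨x, hx, rfl⟩ := Finset.mem_image.1 hy
    refine ⟨r x, fun i => ⟨?_, ?_⟩⟩
    · rw [← thorntonPsi_add]
      refine Finset.mem_image_of_mem _ ?_
      simp only [B, Finset.mem_biUnion, Finset.mem_univ, true_and, Finset.mem_insert,
        Finset.mem_singleton]
      exact ⟨x, hx, i, Or.inl rfl⟩
    · rw [sub_eq_add_neg, ← thorntonPsi_add]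
      refine Finset.mem_image_of_mem _ ?_
      simp only [B, Finset.mem_biUnion, Finset.mem_univ, true_and, Finset.mem_insert,
        Finset.mem_singleton]
      exact ⟨x, hx, i, Or.inr rfl⟩)
  rw [Finset.card_image_of_injective _ thorntonPsi_injective,
    Finset.card_image_of_injective _ thorntonPsi_injective, ← hK] at h2
  have h3 : (S.card : ℝ) ^ (l * (2 * m + 1)) ≤ K ^ l * (A.card : ℝ) ^ q := by
    calc (S.card : ℝ) ^ (l * (2 * m + 1)) = ((S.card : ℝ) ^ (2 * m + 1)) ^ l := by
          rw [← pow_mul, mul_comm]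
      _ ≤ (K * (B.card : ℝ) ^ (2 * (m + 1))) ^ l := pow_le_pow_left₀ (by positivity) h2 l
      _ = K ^ l * ((B.card : ℝ) ^ l) ^ (2 * (m + 1)) := by
          rw [mul_pow, ← pow_mul, ← pow_mul, mul_comm l]
      _ ≤ K ^ l * ((A.card : ℝ) ^ (m + 1)) ^ (2 * (m + 1)) := by gcongr
      _ = K ^ l * (A.card : ℝ) ^ q := by
          rw [← pow_mul, hq]; ring_nf
  refine le_of_pow_le_pow_left₀ hq0 (by positivity) ?_
  rw [mul_pow, Real.rpow_inv_natCast_pow (by positivity) hq0]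
  have hexp : ((S.card : ℝ) ^ (((l : ℝ) * (2 * ((m + 1 : ℕ) : ℝ) - 1)) /
      (2 * ((m + 1 : ℕ) : ℝ) ^ 2))) ^ q = (S.card : ℝ) ^ (l * (2 * m + 1)) := by
    have he : ((l : ℝ) * (2 * ((m + 1 : ℕ) : ℝ) - 1)) / (2 * ((m + 1 : ℕ) : ℝ) ^ 2) * (q : ℝ) =
        ((l * (2 * m + 1) : ℕ) : ℝ) := by
      rw [hq]
      push_cast
      field_simp
      ring
    rw [← Real.rpow_natCast, ← Real.rpow_mul (by positivity), he, Real.rpow_natCast]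
  rw [hexp, inv_mul_le_iff₀ (by positivity)]
  exact h3
end

section
/- For every s ∈ [0, 2] there exist compact sets S, B ⊆ ℝ × ℝ such that dimH S = s, dimH B = max(s − 1, 0), and B contains the four vertices of an axis-parallel square centered at every point of S: for every (x, y) ∈ S there exists r > 0 with (x − r, y − r), (x − r, y + r), (x + r, y − r), (x + r, y + r) ∈ B. -/
open scoped ENNReal

namespace SqV

open MeasureTheory Filter Topology Set

open Classical in
/-- number of free binary positions below `n` -/
noncomputable def cnt (F : ℕ → Prop) (n : ℕ) : ℕ := Nat.count F n

open Classical in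
lemma cnt_succ (F : ℕ → Prop) (n : ℕ) : cnt F (n + 1) = cnt F n + if F n then 1 else 0 := by
  unfold cnt
  rw [Nat.count_succ]

lemma cnt_zero (F : ℕ → Prop) : cnt F 0 = 0 := by simp [cnt]

lemma cnt_le (F : ℕ → Prop) (n : ℕ) : cnt F n ≤ n := by
  induction n with
  | zero => simp [cnt_zero]
  | succ n ih => rw [cnt_succ]; split_ifs <;> omega

open Classical in
/-- spread the binary digits of `m` over the free positions -/
noncomputable def spread (F : ℕ → Prop) : ℕ → ℕ → ℕ
  | 0, _ => 0
  | n + 1, m => if F n then 2 * spread F n (m / 2) + m % 2 else 2 * spread F n m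

lemma spread_inj (F : ℕ → Prop) (n : ℕ) : ∀ m m' : ℕ, m < 2 ^ cnt F n → m' < 2 ^ cnt F n →
    spread F n m = spread F n m' → m = m' := by
  induction n with
  | zero => intro m m' h h' _; simp [cnt_zero] at h h'; omega
  | succ n ih =>
    intro m m' h h' he
    rw [cnt_succ] at h h'
    simp only [spread] at he
    split_ifs at h h' he with hF
    · rw [pow_succ] at h h'
      have := ih (m / 2) (m' / 2) (by omega) (by omega) (by omega)
      omega
    · exact ih m m' h h' (by omega)

noncomputable def idx (F : ℕ → Prop) (n : ℕ) (t : ℝ) : ℕ := ⌊2 ^ cnt F n * t⌋₊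

noncomputable def gapp (F : ℕ → Prop) (t : ℝ) (n : ℕ) : ℝ := (spread F n (idx F n t) : ℝ) / 2 ^ n

lemma idx_half (F : ℕ → Prop) (n : ℕ) (hF : F n) (t : ℝ) : idx F (n + 1) t / 2 = idx F n t := by
  unfold idx
  rw [cnt_succ, if_pos hF, pow_succ]
  have := Nat.floor_div_natCast (2 ^ cnt F n * 2 * t) 2
  rw [← this]
  congr 1
  push_cast
  ring

lemma gapp_step (F : ℕ → Prop) (t : ℝ) (n : ℕ) :
    dist (gapp F t n) (gapp F t (n + 1)) ≤ 1 / 2 / 2 ^ n := by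
  unfold gapp
  rw [Real.dist_eq]
  have key : ∃ e : ℕ, e ≤ 1 ∧
      spread F (n + 1) (idx F (n + 1) t) = 2 * spread F n (idx F n t) + e := by
    simp only [spread]
    split_ifs with hF
    · exact ⟨idx F (n + 1) t % 2, by omega, by rw [idx_half F n hF]⟩
    · refine ⟨0, by omega, ?_⟩
      have : idx F (n + 1) t = idx F n t := by
        unfold idx; rw [cnt_succ, if_neg hF, add_zero]
      rw [this]; omega
  obtain ⟨e, he, h⟩ := key
  rw [h]
  have he' : (e : ℝ) ≤ 1 := by exact_mod_cast he
  have he0 : (0 : ℝ) ≤ e := by positivity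
  push_cast
  have : (spread F n (idx F n t) : ℝ) / 2 ^ n - (2 * (spread F n (idx F n t) : ℝ) + e) / 2 ^ (n + 1)
      = - (e / 2 / 2 ^ n) := by
    rw [pow_succ]; field_simp; ring
  rw [this, abs_neg, abs_of_nonneg (by positivity)]
  gcongr

noncomputable def g (F : ℕ → Prop) (t : ℝ) : ℝ := limUnder atTop (gapp F t)

lemma g_near (F : ℕ → Prop) (t : ℝ) (n : ℕ) : |gapp F t n - g F t| ≤ 1 / 2 ^ n := by
  have h1 : Tendsto (gapp F t) atTop (𝓝 (g F t)) :=
    (cauchySeq_of_le_geometric_two (C := 1) (gapp_step F t)).tendsto_limUnder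
  have := dist_le_of_le_geometric_two_of_tendsto (C := 1) (gapp_step F t) h1 n
  rwa [Real.dist_eq] at this

lemma idx_lt (F : ℕ → Prop) (n : ℕ) (t : ℝ) (h0 : 0 ≤ t) (h1 : t < 1) :
    idx F n t < 2 ^ cnt F n := by
  unfold idx
  rw [Nat.floor_lt (by positivity)]
  push_cast
  nlinarith [pow_pos (two_pos : (0 : ℝ) < 2) (cnt F n)]

lemma idx_vol (F : ℕ → Prop) (n : ℕ) (z : ℤ) :
    volume {t : ℝ | t ∈ Ico (0 : ℝ) 1 ∧ (spread F n (idx F n t) : ℤ) = z}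
      ≤ ENNReal.ofReal (1 / 2 ^ cnt F n) := by
  rcases Set.eq_empty_or_nonempty
    {t : ℝ | t ∈ Ico (0 : ℝ) 1 ∧ (spread F n (idx F n t) : ℤ) = z} with h | ⟨t1, ht1, hz1⟩
  · rw [h]; simp
  · have hsub : {t : ℝ | t ∈ Ico (0 : ℝ) 1 ∧ (spread F n (idx F n t) : ℤ) = z} ⊆
        Ico ((idx F n t1 : ℝ) / 2 ^ cnt F n) (((idx F n t1 : ℝ) + 1) / 2 ^ cnt F n) := by
      rintro t ⟨ht, hz⟩
      have : idx F n t = idx F n t1 := by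
        apply spread_inj F n _ _ (idx_lt F n t ht.1 ht.2) (idx_lt F n t1 ht1.1 ht1.2)
        have := hz.trans hz1.symm
        exact_mod_cast this
      rw [← this]
      unfold idx
      constructor
      · rw [div_le_iff₀ (by positivity), mul_comm t]
        exact Nat.floor_le (mul_nonneg (by positivity) ht.1)
      · rw [lt_div_iff₀ (by positivity), mul_comm t]
        exact Nat.lt_floor_add_one _
    refine (measure_mono hsub).trans ?_
    rw [Real.volume_Ico]
    apply ENNReal.ofReal_le_ofReal
    apply le_of_eq
    ring

lemma g_vol (F : ℕ → Prop) (n : ℕ) (U : Set ℝ) (hU : ∀ x ∈ U, ∀ y ∈ U, |x - y| ≤ 1 / 2 ^ n) :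
    volume {t : ℝ | t ∈ Ico (0 : ℝ) 1 ∧ g F t ∈ U} ≤ ENNReal.ofReal (7 / 2 ^ cnt F n) := by
  rcases Set.eq_empty_or_nonempty {t : ℝ | t ∈ Ico (0 : ℝ) 1 ∧ g F t ∈ U} with h | ⟨t0, ht0, hU0⟩
  · rw [h]; simp
  · have hsub : {t : ℝ | t ∈ Ico (0 : ℝ) 1 ∧ g F t ∈ U} ⊆ ⋃ i ∈ Finset.Icc (-3 : ℤ) 3,
        {t : ℝ | t ∈ Ico (0 : ℝ) 1 ∧
          (spread F n (idx F n t) : ℤ) = spread F n (idx F n t0) + i} := by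
      rintro t ⟨ht, hUt⟩
      have h1 := abs_le.1 (g_near F t n)
      have h2 := abs_le.1 (g_near F t0 n)
      have h3 := abs_le.1 (hU _ hUt _ hU0)
      have h4 : |gapp F t n - gapp F t0 n| ≤ 3 * (1 / 2 ^ n) := by
        rw [abs_le]; constructor <;> linarith
      have h5 : |((spread F n (idx F n t) : ℤ) : ℝ) - (spread F n (idx F n t0) : ℤ)| ≤ 3 := by
        unfold gapp at h4
        rw [← sub_div, abs_div, abs_of_pos (by positivity : (0 : ℝ) < 2 ^ n),
          div_le_iff₀ (by positivity)] at h4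
        have : 3 * (1 / (2 : ℝ) ^ n) * 2 ^ n = 3 := by field_simp
        rw [this] at h4
        exact_mod_cast h4
      have h6 : |(spread F n (idx F n t) : ℤ) - (spread F n (idx F n t0) : ℤ)| ≤ 3 := by
        exact_mod_cast h5
      simp only [mem_iUnion, Finset.mem_Icc]
      rw [abs_le] at h6
      exact ⟨(spread F n (idx F n t) : ℤ) - (spread F n (idx F n t0) : ℤ), h6, ht, by ring⟩
    calc _ ≤ _ := measure_mono hsub
      _ ≤ _ := measure_biUnion_finset_le _ _
      _ ≤ ∑ i ∈ Finset.Icc (-3 : ℤ) 3, ENNReal.ofReal (1 / 2 ^ cnt F n) :=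
          Finset.sum_le_sum fun i _ => idx_vol F n _
      _ = _ := by
        rw [Finset.sum_const, Int.card_Icc, nsmul_eq_mul, ← ENNReal.ofReal_natCast,
          ← ENNReal.ofReal_mul (by positivity)]
        congr 1
        have : ((3 : ℤ) + 1 - -3).toNat = 7 := rfl
        rw [this]
        push_cast
        ring

/-- the digit set -/
noncomputable def dset (F : ℕ → Prop) : Set ℝ := closure (g F '' Ico (0 : ℝ) 1)

lemma g_bdd (F : ℕ → Prop) (t : ℝ) : |g F t| ≤ 1 := by
  have := g_near F t 0
  simpa [gapp, spread] using this

lemma dset_bdd (F : ℕ → Prop) : ∀ x ∈ dset F, |x| ≤ 1 := by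
  intro x hx
  have : dset F ⊆ Metric.closedBall 0 1 := by
    apply closure_minimal _ Metric.isClosed_closedBall
    rintro _ ⟨t, _, rfl⟩
    simpa using g_bdd F t
  simpa using this hx

lemma dset_compact (F : ℕ → Prop) : IsCompact (dset F) := by
  apply (isCompact_closedBall (0 : ℝ) 1).of_isClosed_subset isClosed_closure
  intro x hx
  simpa using dset_bdd F x hx

lemma dset_cover (F : ℕ → Prop) (n : ℕ) : ∃ T : Finset ℝ, (T.card : ℝ) ≤ 2 ^ cnt F n ∧
    ∀ x ∈ dset F, ∃ c ∈ T, |x - c| ≤ 1 / 2 ^ n := by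
  refine ⟨(Finset.range (2 ^ cnt F n)).image fun m => (spread F n m : ℝ) / 2 ^ n, ?_, ?_⟩
  · have := Finset.card_image_le (s := Finset.range (2 ^ cnt F n))
      (f := fun m => (spread F n m : ℝ) / 2 ^ n)
    rw [Finset.card_range] at this
    exact_mod_cast this
  · have : dset F ⊆ ⋃ c ∈ (Finset.range (2 ^ cnt F n)).image fun m => (spread F n m : ℝ) / 2 ^ n,
        Metric.closedBall c (1 / 2 ^ n) := by
      apply closure_minimal
      · rintro _ ⟨t, ht, rfl⟩
        simp only [mem_iUnion]
        refine ⟨gapp F t n, ?_, ?_⟩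
        · rw [Finset.mem_image]
          exact ⟨idx F n t, by rw [Finset.mem_range]; exact idx_lt F n t ht.1 ht.2, rfl⟩
        · rw [Metric.mem_closedBall, dist_comm, Real.dist_eq]
          exact g_near F t n
      · apply Set.Finite.isClosed_biUnion (Finset.finite_toSet _)
        intro i _
        exact Metric.isClosed_closedBall
    intro x hx
    have := this hx
    simp only [mem_iUnion] at this
    obtain ⟨c, hc, h⟩ := this
    exact ⟨c, hc, by rwa [Metric.mem_closedBall, Real.dist_eq] at h⟩

lemma zero_mem_empty : ∀ t, g (fun _ => False) t = 0 := by
  intro t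
  have h0 : ∀ n m, spread (fun _ => False) n m = 0 := by
    intro n
    induction n with
    | zero => intro m; rfl
    | succ n ih => intro m; simp [spread, ih]
  have : gapp (fun _ => False) t = fun _ => 0 := by
    funext n; simp [gapp, h0]
  unfold g
  rw [this]
  exact tendsto_const_nhds.limUnder_eq

/-- mass distribution principle for products of digit sets -/
lemma lower (F G : ℕ → Prop) (s K : ℝ) (hs : 0 < s)
    (h : ∀ n : ℕ, s * n - K ≤ (cnt F n : ℝ) + cnt G n) (X : Set (ℝ × ℝ))
    (hX : ∀ t ∈ Ico (0 : ℝ) 1, ∀ u ∈ Ico (0 : ℝ) 1, (g F t, g G u) ∈ X) :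
    ENNReal.ofReal s ≤ dimH X := by
  set C : ℝ := 49 * (2 : ℝ) ^ (K + s) with hC
  have hC0 : 0 < C := by positivity
  let ν : Measure (ℝ × ℝ) := (volume : Measure (ℝ × ℝ)).restrict (Ico (0 : ℝ) 1 ×ˢ Ico (0 : ℝ) 1)
  have hQ : MeasurableSet (Ico (0 : ℝ) 1 ×ˢ Ico (0 : ℝ) 1) := measurableSet_Ico.prod measurableSet_Ico
  let μ : OuterMeasure (ℝ × ℝ) :=
    OuterMeasure.map (fun p : ℝ × ℝ => (g F p.1, g G p.2)) ν.toOuterMeasure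
  have hμ : ∀ U, μ U = volume ((fun p : ℝ × ℝ => (g F p.1, g G p.2)) ⁻¹' U ∩
      (Ico (0 : ℝ) 1 ×ˢ Ico (0 : ℝ) 1)) := by
    intro U
    simp only [μ, OuterMeasure.map_apply]
    exact Measure.restrict_apply' hQ
  -- basic estimate
  have h1 : ∀ U : Set (ℝ × ℝ), ∀ ε : ℝ, 0 < ε → ε ≤ 1 → Metric.ediam U ≤ ENNReal.ofReal ε →
      μ U ≤ ENNReal.ofReal (C * ε ^ s) := by
    intro U ε hε hε1 hd
    obtain ⟨n, hn1, hn2⟩ := exists_nat_pow_near_of_lt_one hε hε1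
      (by norm_num : (0 : ℝ) < 1 / 2) (by norm_num)
    rw [one_div_pow] at hn1 hn2
    have hdist : ∀ x ∈ U, ∀ y ∈ U, dist x y ≤ 1 / 2 ^ n := by
      intro x hx y hy
      have := (Metric.edist_le_ediam_of_mem hx hy).trans hd
      rw [edist_dist, ENNReal.ofReal_le_ofReal_iff hε.le] at this
      linarith
    have hsub : (fun p : ℝ × ℝ => (g F p.1, g G p.2)) ⁻¹' U ∩
      (Ico (0 : ℝ) 1 ×ˢ Ico (0 : ℝ) 1) ⊆ {t : ℝ | t ∈ Ico (0 : ℝ) 1 ∧ g F t ∈ Prod.fst '' U} ×ˢ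
        {t : ℝ | t ∈ Ico (0 : ℝ) 1 ∧ g G t ∈ Prod.snd '' U} := by
      rintro ⟨a, b⟩ ⟨hab, ha, hb⟩
      exact ⟨⟨ha, _, hab, rfl⟩, ⟨hb, _, hab, rfl⟩⟩
    rw [hμ]
    refine (measure_mono hsub).trans ?_
    rw [Measure.volume_eq_prod, Measure.prod_prod]
    refine (mul_le_mul' (g_vol F n _ ?_) (g_vol G n _ ?_)).trans ?_
    · rintro _ ⟨x, hx, rfl⟩ _ ⟨y, hy, rfl⟩
      have := hdist x hx y hy
      rw [Prod.dist_eq] at this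
      exact (le_max_left _ _).trans this
    · rintro _ ⟨x, hx, rfl⟩ _ ⟨y, hy, rfl⟩
      have := hdist x hx y hy
      rw [Prod.dist_eq] at this
      exact (le_max_right _ _).trans this
    · rw [← ENNReal.ofReal_mul (by positivity)]
      apply ENNReal.ofReal_le_ofReal
      have e1 : (7 : ℝ) / 2 ^ cnt F n * (7 / 2 ^ cnt G n) =
          49 * (2 : ℝ) ^ (-((cnt F n : ℝ) + cnt G n)) := by
        rw [Real.rpow_neg (by norm_num), Real.rpow_add (by norm_num), Real.rpow_natCast,
          Real.rpow_natCast]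
        field_simp
        norm_num
      have e2 : (2 : ℝ) ^ (-((cnt F n : ℝ) + cnt G n)) ≤ 2 ^ (K - s * n) :=
        Real.rpow_le_rpow_of_exponent_le (by norm_num) (by linarith [h n])
      have e3 : (2 : ℝ) ^ (K - s * n) = 2 ^ (K + s) * (1 / 2 ^ (n + 1)) ^ s := by
        rw [one_div, ← Real.rpow_natCast, ← Real.rpow_neg (by norm_num),
          ← Real.rpow_mul (by norm_num), ← Real.rpow_add (by norm_num)]
        congr 1
        push_cast
        ring
      have e4 : (1 / 2 ^ (n + 1) : ℝ) ^ s ≤ ε ^ s :=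
        Real.rpow_le_rpow (by positivity) hn1.le hs.le
      rw [e1, hC, mul_assoc]
      have : (0 : ℝ) < 2 ^ (K + s) := by positivity
      rw [e3] at e2
      nlinarith
  have h2 : ∀ U : Set (ℝ × ℝ), Metric.ediam U ≤ ENNReal.ofReal (1 / 2) →
      μ U ≤ ENNReal.ofReal C * Metric.ediam U ^ s := by
    intro U hU
    obtain ⟨δ, hδ0, hδ⟩ : ∃ δ : ℝ, 0 ≤ δ ∧ Metric.ediam U = ENNReal.ofReal δ :=
      ⟨(Metric.ediam U).toReal, ENNReal.toReal_nonneg,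
        (ENNReal.ofReal_toReal (ne_top_of_le_ne_top ENNReal.ofReal_ne_top hU)).symm⟩
    have hδ1 : δ ≤ 1 / 2 := by
      rw [hδ, ENNReal.ofReal_le_ofReal_iff (by norm_num)] at hU; exact hU
    rw [hδ, ENNReal.ofReal_rpow_of_nonneg hδ0 hs.le, ← ENNReal.ofReal_mul hC0.le]
    have hcont : Tendsto (fun ε : ℝ => ENNReal.ofReal (C * ε ^ s)) (𝓝[>] δ)
        (𝓝 (ENNReal.ofReal (C * δ ^ s))) := by
      apply ENNReal.tendsto_ofReal
      apply Tendsto.const_mul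
      exact ((Real.continuous_rpow_const hs.le).tendsto δ).mono_left nhdsWithin_le_nhds
    refine ge_of_tendsto hcont ?_
    have : Ioo δ 1 ∈ 𝓝[>] δ := Ioo_mem_nhdsGT (by linarith)
    filter_upwards [this] with ε hε
    exact h1 U ε (by linarith [hε.1]) hε.2.le (hδ ▸ ENNReal.ofReal_le_ofReal hε.1.le)
  have hCne : ENNReal.ofReal C ≠ 0 := by simpa using hC0
  have h3 : (ENNReal.ofReal C)⁻¹ • μ ≤ OuterMeasure.mkMetric fun r => r ^ s := by
    apply OuterMeasure.le_mkMetric _ _ (ENNReal.ofReal (1 / 2)) (by simp)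
    intro U hU
    have := h2 U hU
    rw [_root_.smul_apply, smul_eq_mul, mul_comm, ← div_eq_mul_inv]
    apply ENNReal.div_le_of_le_mul
    rwa [mul_comm]
  have hμX : μ X = 1 := by
    rw [hμ]
    have : (fun p : ℝ × ℝ => (g F p.1, g G p.2)) ⁻¹' X ∩ (Ico (0 : ℝ) 1 ×ˢ Ico (0 : ℝ) 1) =
        (Ico (0 : ℝ) 1 ×ˢ Ico (0 : ℝ) 1) := by
      apply inter_eq_right.2
      rintro ⟨a, b⟩ ⟨ha, hb⟩
      exact hX a ha b hb
    rw [this, Measure.volume_eq_prod, Measure.prod_prod]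
    simp
  have h4 : Measure.hausdorffMeasure s X ≠ 0 := by
    have h5 := h3 X
    rw [_root_.smul_apply, hμX] at h5
    have h6 : Measure.hausdorffMeasure s X = (OuterMeasure.mkMetric fun r => r ^ s) X := by
      exact (congrFun (OuterMeasure.coe_mkMetric _) X).symm
    rw [h6]
    intro h0
    rw [h0] at h5
    simp at h5
  have h7 := le_dimH_of_hausdorffMeasure_ne_zero (d := ⟨s, hs.le⟩) h4
  convert h7 using 1
  exact ENNReal.ofReal_eq_coe_nnreal hs.le

/-- upper bound by box counting along a sequence of scales -/
lemma upper (d C : ℝ) (hd : 0 ≤ d) (hC : 0 ≤ C) (X : Set (ℝ × ℝ))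
    (h : ∀ N : ℕ, ∃ n ≥ N, ∃ T : Finset (ℝ × ℝ), (T.card : ℝ) ≤ C * 2 ^ (d * n) ∧
      ∀ x ∈ X, ∃ c ∈ T, dist x c ≤ C / 2 ^ n) :
    dimH X ≤ ENNReal.ofReal d := by
  choose n hn T hT hcov using h
  have hnt : Tendsto n atTop atTop := tendsto_atTop_mono hn tendsto_id
  have hr : Tendsto (fun N => ENNReal.ofReal (2 * (C / 2 ^ n N))) atTop (𝓝 0) := by
    rw [← ENNReal.ofReal_zero]
    apply ENNReal.tendsto_ofReal
    have : Tendsto (fun k : ℕ => 2 * (C / (2 : ℝ) ^ k)) atTop (𝓝 (2 * 0)) := by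
      apply Tendsto.const_mul
      apply Tendsto.const_div_atTop
      exact tendsto_pow_atTop_atTop_of_one_lt (by norm_num)
    rw [mul_zero] at this
    exact this.comp hnt
  have hdi : ∀ N, ∀ i : T N, Metric.ediam (Metric.closedBall (i : ℝ × ℝ) (C / 2 ^ n N)) ≤
      ENNReal.ofReal (2 * (C / 2 ^ n N)) := by
    intro N i
    apply Metric.ediam_le
    intro x hx y hy
    rw [edist_dist]
    apply ENNReal.ofReal_le_ofReal
    have h1 := Metric.mem_closedBall.1 hx
    have h2 := Metric.mem_closedBall.1 hy
    have h3 := dist_triangle_right x y (i : ℝ × ℝ)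
    linarith
  have key := Measure.hausdorffMeasure_le_liminf_sum (ι := fun N => T N) d X
    (fun N => ENNReal.ofReal (2 * (C / 2 ^ n N))) hr
    (fun N i => Metric.closedBall (i : ℝ × ℝ) (C / 2 ^ n N))
    (Eventually.of_forall hdi) (Eventually.of_forall fun N x hx => by
      obtain ⟨c, hc, hd⟩ := hcov N x hx
      exact mem_iUnion.2 ⟨⟨c, hc⟩, hd⟩)
  have hb : ∀ N, ∑ i : T N, Metric.ediam (Metric.closedBall (i : ℝ × ℝ) (C / 2 ^ n N)) ^ d ≤
      ENNReal.ofReal (C * (2 * C) ^ d) := by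
    intro N
    calc _ ≤ ∑ i : T N, ENNReal.ofReal (2 * (C / 2 ^ n N)) ^ d :=
          Finset.sum_le_sum fun i _ => ENNReal.rpow_le_rpow (hdi N i) hd
      _ = ENNReal.ofReal ((T N).card * (2 * (C / 2 ^ n N)) ^ d) := by
          rw [Finset.sum_const, nsmul_eq_mul, ENNReal.ofReal_rpow_of_nonneg (by positivity) hd,
            ← ENNReal.ofReal_natCast, ← ENNReal.ofReal_mul (by positivity)]
          simp
      _ ≤ _ := by
          apply ENNReal.ofReal_le_ofReal
          have e : (2 * (C / 2 ^ n N)) ^ d = (2 * C) ^ d * (2 ^ (d * n N))⁻¹ := by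
            rw [← mul_div_assoc, Real.div_rpow (by positivity) (by positivity), div_eq_mul_inv,
              ← Real.rpow_natCast, ← Real.rpow_mul (by norm_num), mul_comm d]
          rw [e]
          calc _ ≤ (C * 2 ^ (d * n N)) * ((2 * C) ^ d * (2 ^ (d * n N))⁻¹) := by
                gcongr; exact hT N
            _ = _ := by field_simp
  have hfin : Measure.hausdorffMeasure d X ≠ ⊤ := by
    refine ne_top_of_le_ne_top ENNReal.ofReal_ne_top (key.trans ?_ : _ ≤ ENNReal.ofReal (C * (2 * C) ^ d))
    refine (liminf_le_liminf (Eventually.of_forall hb)).trans ?_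
    simp
  have := dimH_le_of_hausdorffMeasure_ne_top (d := ⟨d, hd⟩) hfin
  convert this using 1
  exact ENNReal.ofReal_eq_coe_nnreal hd

/-- rapidly growing scales -/
def nk (k : ℕ) : ℕ := (k + 1).factorial

lemma nk_succ (k : ℕ) : nk (k + 1) = (k + 2) * nk k := by
  unfold nk; rw [Nat.factorial_succ]

lemma nk_pos (k : ℕ) : 0 < nk k := Nat.factorial_pos _

lemma nk_strictMono : StrictMono nk := by
  apply strictMono_nat_of_lt_succ
  intro k
  rw [nk_succ]
  nlinarith [nk_pos k]

/-- `n` lies in an even block -/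
def ev (n : ℕ) : Prop := ∃ k, k % 2 = 0 ∧ nk k ≤ n ∧ n < nk (k + 1)

lemma not_ev (k n : ℕ) (hk : k % 2 = 1) (h1 : nk k ≤ n) (h2 : n < nk (k + 1)) : ¬ ev n := by
  rintro ⟨j, hj, h3, h4⟩
  have a := nk_strictMono.lt_iff_lt.1 (h1.trans_lt h4)
  have b := nk_strictMono.lt_iff_lt.1 (h3.trans_lt h2)
  omega

def mix (e F G : ℕ → Prop) (n : ℕ) : Prop := (e n ∧ F n) ∨ (¬ e n ∧ G n)

lemma cnt_mix (e F G : ℕ → Prop) (n : ℕ) :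
    cnt (mix e F G) n + cnt (mix e G F) n = cnt F n + cnt G n := by
  induction n with
  | zero => simp [cnt_zero]
  | succ n ih =>
    simp only [cnt_succ]
    by_cases h : e n <;> by_cases h1 : F n <;> by_cases h2 : G n <;> simp [mix, h, h1, h2] <;> omega

lemma cnt_block (H G : ℕ → Prop) (a b : ℕ) (hab : a ≤ b)
    (h : ∀ n, a ≤ n → n < b → H n → G n) : cnt H b ≤ a + cnt G b := by
  induction b, hab using Nat.le_induction with
  | base => have := cnt_le H a; omega
  | succ b hb ih =>
    have := ih fun n h1 h2 => h n h1 (by omega)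
    have h3 := h b hb (by omega)
    rw [cnt_succ, cnt_succ]
    by_cases hH : H b
    · simp only [hH, h3 hH, if_true]; omega
    · simp only [hH, if_false]; omega

/-- positions with density `α` -/
def dens (α : ℝ) (n : ℕ) : Prop := ⌊α * n⌋₊ < ⌊α * (n + 1 : ℕ)⌋₊

lemma cnt_dens (α : ℝ) (h0 : 0 ≤ α) (h1 : α ≤ 1) (n : ℕ) : cnt (dens α) n = ⌊α * n⌋₊ := by
  induction n with
  | zero => simp [cnt_zero]
  | succ n ih =>
    rw [cnt_succ, ih]
    have hle : ⌊α * n⌋₊ ≤ ⌊α * (n + 1 : ℕ)⌋₊ := by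
      apply Nat.floor_le_floor; push_cast; nlinarith
    have hle2 : ⌊α * (n + 1 : ℕ)⌋₊ ≤ ⌊α * n⌋₊ + 1 := by
      rw [← Nat.floor_add_one (by positivity)]
      apply Nat.floor_le_floor; push_cast; nlinarith
    split_ifs with h
    · unfold dens at h; omega
    · unfold dens at h; omega

/-- the sparse sets -/
def A (j : ℕ) : Set ℝ := {x | |x| ≤ 10 ∧ ∀ k, k % 4 = j →
  ∃ m : ℤ, |x - m / 2 ^ nk k| ≤ 2 / 2 ^ nk (k + 1)}

lemma A_cover (j k : ℕ) (hk : k % 4 = j) : ∃ T : Finset ℝ, (T.card : ℝ) ≤ 23 * 2 ^ nk k ∧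
    ∀ x ∈ A j, ∃ c ∈ T, |x - c| ≤ 2 / 2 ^ nk (k + 1) := by
  refine ⟨(Finset.Icc (-(11 * 2 ^ nk k : ℤ)) (11 * 2 ^ nk k)).image
    fun m : ℤ => (m : ℝ) / 2 ^ nk k, ?_, ?_⟩
  · have := Finset.card_image_le (s := Finset.Icc (-(11 * 2 ^ nk k : ℤ)) (11 * 2 ^ nk k))
      (f := fun m : ℤ => (m : ℝ) / 2 ^ nk k)
    rw [Int.card_Icc] at this
    have h2 : ((11 * 2 ^ nk k + 1 - -(11 * 2 ^ nk k) : ℤ)).toNat = 22 * 2 ^ nk k + 1 := by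
      have : ((11 * 2 ^ nk k + 1 - -(11 * 2 ^ nk k) : ℤ)) = ((22 * 2 ^ nk k + 1 : ℕ) : ℤ) := by
        push_cast; ring
      rw [this]; exact Int.toNat_natCast _
    rw [h2] at this
    have h3 : 1 ≤ 2 ^ nk k := Nat.one_le_two_pow
    have h4 := this.trans (show 22 * 2 ^ nk k + 1 ≤ 23 * 2 ^ nk k by omega)
    exact_mod_cast h4
  · rintro x ⟨hx, h⟩
    obtain ⟨m, hm⟩ := h k hk
    refine ⟨_, Finset.mem_image_of_mem _ ?_, hm⟩
    have h1 : (2 : ℝ) / 2 ^ nk (k + 1) ≤ 1 := by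
      rw [div_le_one (by positivity)]
      exact le_self_pow₀ (by norm_num) (nk_pos _).ne'
    have h2 : |(m : ℝ) / 2 ^ nk k| ≤ 11 := by
      rw [abs_le] at hx hm ⊢
      constructor <;> linarith [hx.1, hx.2, hm.1, hm.2]
    rw [abs_div, abs_of_pos (by positivity : (0 : ℝ) < 2 ^ nk k), div_le_iff₀ (by positivity)] at h2
    have h3 : |m| ≤ 11 * 2 ^ nk k := by exact_mod_cast h2
    rw [Finset.mem_Icc]
    exact abs_le.1 h3

lemma zero_mem_A (j : ℕ) : (0 : ℝ) ∈ A j := by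
  refine ⟨by simp, fun k _ => ⟨0, ?_⟩⟩
  simp only [Int.cast_zero, zero_div, sub_zero, abs_zero]
  positivity

lemma A_compact (j : ℕ) : IsCompact (A j) := by
  have hb : A j ⊆ Metric.closedBall 0 10 := by
    intro x hx
    simpa using hx.1
  have hc : A j = {x : ℝ | |x| ≤ 10} ∩ ⋂ k, ⋂ (_ : k % 4 = j),
      ⋃ m ∈ Finset.Icc (-(11 * 2 ^ nk k : ℤ)) (11 * 2 ^ nk k),
        {x : ℝ | |x - m / 2 ^ nk k| ≤ 2 / 2 ^ nk (k + 1)} := by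
    ext x
    simp only [mem_inter_iff, mem_ofPred_eq, mem_iInter, mem_iUnion]
    constructor
    · rintro ⟨hx, h⟩
      refine ⟨hx, fun k hk => ?_⟩
      obtain ⟨m, hm⟩ := h k hk
      refine ⟨m, ?_, hm⟩
      have h1 : (2 : ℝ) / 2 ^ nk (k + 1) ≤ 1 := by
        rw [div_le_one (by positivity)]
        exact le_self_pow₀ (by norm_num) (nk_pos _).ne'
      have h2 : |(m : ℝ) / 2 ^ nk k| ≤ 11 := by
        rw [abs_le] at hx hm ⊢
        constructor <;> linarith [hx.1, hx.2, hm.1, hm.2]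
      rw [abs_div, abs_of_pos (by positivity : (0 : ℝ) < 2 ^ nk k),
        div_le_iff₀ (by positivity)] at h2
      have h3 : |m| ≤ 11 * 2 ^ nk k := by exact_mod_cast h2
      rw [Finset.mem_Icc]
      exact abs_le.1 h3
    · rintro ⟨hx, h⟩
      refine ⟨hx, fun k hk => ?_⟩
      obtain ⟨m, _, hm⟩ := h k hk
      exact ⟨m, hm⟩
  refine (isCompact_closedBall (0 : ℝ) 10).of_isClosed_subset ?_ hb
  rw [hc]
  refine (isClosed_le (by fun_prop) (by fun_prop)).inter ?_
  refine isClosed_iInter fun k => isClosed_iInter fun _ => ?_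
  apply Set.Finite.isClosed_biUnion (Finset.finite_toSet _)
  intro m _
  exact isClosed_le (by fun_prop) (by fun_prop)

/-- simultaneous choice of the radius -/
lemma exists_rho (c : ℕ → ℝ) : ∃ ρ : ℝ, |3 - ρ| ≤ 1 ∧
    ∀ k, ∃ m : ℤ, |ρ - c k - m / 2 ^ nk k| ≤ 2 / 2 ^ nk (k + 1) := by
  let ρs : ℕ → ℝ := fun k => Nat.rec 3
    (fun k r => c k + (round ((r - c k) * 2 ^ nk k) : ℝ) / 2 ^ nk k) k
  have hstep : ∀ k, ρs (k + 1) = c k + (round ((ρs k - c k) * 2 ^ nk k) : ℝ) / 2 ^ nk k :=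
    fun k => rfl
  have hd : ∀ k, dist (ρs k) (ρs (k + 1)) ≤ 1 / 2 ^ nk k := by
    intro k
    have h1 := abs_sub_round ((ρs k - c k) * 2 ^ nk k)
    rw [hstep, Real.dist_eq]
    have : ρs k - (c k + (round ((ρs k - c k) * 2 ^ nk k) : ℝ) / 2 ^ nk k) =
        ((ρs k - c k) * 2 ^ nk k - round ((ρs k - c k) * 2 ^ nk k)) / 2 ^ nk k := by
      field_simp; ring
    rw [this, abs_div, abs_of_pos (by positivity : (0 : ℝ) < 2 ^ nk k)]
    gcongr
    linarith
  have hadd : ∀ k j, nk k + j ≤ nk (k + j) := by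
    intro k j
    induction j with
    | zero => simp
    | succ j ih =>
      have := nk_strictMono (show k + j < k + (j + 1) by omega)
      omega
  have hgeo : ∀ k j, dist (ρs (k + j)) (ρs (k + (j + 1))) ≤ (2 / 2 ^ nk k) / 2 / 2 ^ j := by
    intro k j
    refine (hd (k + j)).trans ?_
    have : (2 / 2 ^ nk k : ℝ) / 2 / 2 ^ j = 1 / 2 ^ (nk k + j) := by
      rw [pow_add]; field_simp
    rw [this]
    apply one_div_le_one_div_of_le (by positivity)
    exact pow_le_pow_right₀ (by norm_num) (hadd k j)
  obtain ⟨ρ, hρ⟩ : ∃ ρ, Tendsto ρs atTop (𝓝 ρ) := by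
    apply cauchySeq_tendsto_of_complete
    have := cauchySeq_of_le_geometric_two (f := fun j => ρs (0 + j)) (hgeo 0)
    simpa using this
  have hlim : ∀ k, |ρs k - ρ| ≤ 2 / 2 ^ nk k := by
    intro k
    have ht : Tendsto (fun j => ρs (k + j)) atTop (𝓝 ρ) := by
      have := (tendsto_add_atTop_iff_nat k).2 hρ
      simpa [add_comm] using this
    have := dist_le_of_le_geometric_two_of_tendsto (f := fun j => ρs (k + j)) (hgeo k) ht 0
    simpa [Real.dist_eq] using this
  refine ⟨ρ, ?_, fun k => ⟨round ((ρs k - c k) * 2 ^ nk k), ?_⟩⟩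
  · have := hlim 0
    have h1 : ρs 0 = 3 := rfl
    rw [h1] at this
    simpa [nk] using this
  · have := hlim (k + 1)
    rw [hstep, abs_sub_comm] at this
    rwa [sub_sub]

lemma piece (j : ℕ) (hj : j < 4) (F : ℕ → Prop) (α : ℝ) (hα : 0 ≤ α)
    (hF : ∀ k, k % 4 = j → (cnt F (nk (k + 1)) : ℝ) ≤ nk k + α * nk (k + 1)) :
    dimH (A j ×ˢ dset F) ≤ ENNReal.ofReal α := by
  have main : ∀ ε : ℝ, 0 < ε → dimH (A j ×ˢ dset F) ≤ ENNReal.ofReal (α + ε) := by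
    intro ε hε
    apply upper (α + ε) 23 (by positivity) (by norm_num)
    intro N
    set k := 4 * (N + ⌈2 / ε⌉₊) + j with hk
    have hk4 : k % 4 = j := by omega
    obtain ⟨T1, hT1, hc1⟩ := A_cover j k hk4
    obtain ⟨T2, hT2, hc2⟩ := dset_cover F (nk (k + 1))
    have hid : k + 1 ≤ nk (k + 1) := nk_strictMono.id_le _
    refine ⟨nk (k + 1), by omega, T1 ×ˢ T2, ?_, ?_⟩
    · rw [Finset.card_product]
      push_cast
      have e1 : (2 : ℝ) ^ nk k * 2 ^ cnt F (nk (k + 1)) ≤ 2 ^ ((α + ε) * nk (k + 1)) := by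
        rw [← Real.rpow_natCast, ← Real.rpow_natCast, ← Real.rpow_add (by norm_num)]
        apply Real.rpow_le_rpow_of_exponent_le (by norm_num)
        have a := hF k hk4
        have b : (2 : ℝ) * nk k ≤ ε * nk (k + 1) := by
          rw [nk_succ]
          push_cast
          have h1 : 2 / ε ≤ (k : ℝ) + 2 := by
            have h2 : ⌈2 / ε⌉₊ ≤ k + 2 := by omega
            calc 2 / ε ≤ ⌈2 / ε⌉₊ := Nat.le_ceil _
              _ ≤ ((k + 2 : ℕ) : ℝ) := by exact_mod_cast h2
              _ = _ := by push_cast; ring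
          rw [div_le_iff₀ hε] at h1
          have h3 : (0 : ℝ) ≤ nk k := by positivity
          nlinarith
        linarith
      calc (T1.card : ℝ) * T2.card ≤ (23 * 2 ^ nk k) * 2 ^ cnt F (nk (k + 1)) := by gcongr
        _ ≤ _ := by rw [mul_assoc]; gcongr
    · rintro ⟨x, y⟩ ⟨hx, hy⟩
      obtain ⟨a, ha, hxa⟩ := hc1 x hx
      obtain ⟨b, hb, hyb⟩ := hc2 y hy
      refine ⟨(a, b), Finset.mk_mem_product ha hb, ?_⟩
      rw [Prod.dist_eq]
      simp only [Real.dist_eq]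
      apply max_le
      · exact hxa.trans (by gcongr; norm_num)
      · exact hyb.trans (by gcongr; norm_num)
  have hcont : Tendsto (fun ε : ℝ => ENNReal.ofReal (α + ε)) (𝓝[>] 0)
      (𝓝 (ENNReal.ofReal (α + 0))) := by
    apply ENNReal.tendsto_ofReal
    exact ((continuous_const.add continuous_id).tendsto 0).mono_left nhdsWithin_le_nhds
  rw [add_zero] at hcont
  refine ge_of_tendsto hcont ?_
  filter_upwards [self_mem_nhdsWithin] with ε hε
  exact main ε hε

lemma piece' (j : ℕ) (hj : j < 4) (F : ℕ → Prop) (α : ℝ) (hα : 0 ≤ α)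
    (hF : ∀ k, k % 4 = j → (cnt F (nk (k + 1)) : ℝ) ≤ nk k + α * nk (k + 1)) :
    dimH (dset F ×ˢ A j) ≤ ENNReal.ofReal α := by
  have h := (ContinuousLinearEquiv.prodComm ℝ ℝ ℝ).dimH_image (A j ×ˢ dset F)
  have e : (ContinuousLinearEquiv.prodComm ℝ ℝ ℝ) '' (A j ×ˢ dset F) = dset F ×ˢ A j :=
    image_swap_prod _ _
  rw [← e, h]
  exact piece j hj F α hα hF

/-- the version in rotated coordinates -/
lemma rotated (s : ℝ) (hs₀ : 0 ≤ s) (hs₂ : s ≤ 2) :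
    ∃ S B : Set (ℝ × ℝ), IsCompact S ∧ IsCompact B ∧
      dimH S = ENNReal.ofReal s ∧ dimH B = ENNReal.ofReal (max (s - 1) 0) ∧
      ∀ p ∈ S, ∃ r > (0 : ℝ),
        (p.1 - r, p.2) ∈ B ∧ (p.1 + r, p.2) ∈ B ∧ (p.1, p.2 - r) ∈ B ∧ (p.1, p.2 + r) ∈ B := by
  set α := max (s - 1) 0 with hα
  set β := min s 1 with hβ
  have hαβ : α + β = s := by
    rcases le_total s 1 with h | h
    · rw [hα, hβ, max_eq_right (by linarith), min_eq_left h]; ring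
    · rw [hα, hβ, max_eq_left (by linarith), min_eq_right h]; ring
  have hα0 : 0 ≤ α := le_max_right _ _
  have hα1 : α ≤ 1 := max_le (by linarith) (by norm_num)
  have hβ0 : 0 ≤ β := le_min hs₀ (by norm_num)
  have hβ1 : β ≤ 1 := min_le_right _ _
  set FP := mix ev (dens β) (dens α) with hFP
  set FQ := mix ev (dens α) (dens β) with hFQ
  have hcnt : ∀ n, cnt FP n + cnt FQ n = ⌊β * n⌋₊ + ⌊α * n⌋₊ := by
    intro n
    rw [hFP, hFQ, cnt_mix, cnt_dens β hβ0 hβ1, cnt_dens α hα0 hα1]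
  have hcntle : ∀ n : ℕ, (cnt FP n : ℝ) + cnt FQ n ≤ s * n := by
    intro n
    have h1 : ((cnt FP n : ℝ) + cnt FQ n) = (⌊β * n⌋₊ : ℝ) + ⌊α * n⌋₊ := by exact_mod_cast hcnt n
    have h2 := Nat.floor_le (show 0 ≤ β * (n : ℝ) by positivity)
    have h3 := Nat.floor_le (show 0 ≤ α * (n : ℝ) by positivity)
    rw [h1, ← hαβ]; linarith
  have hcntge : ∀ n : ℕ, s * n - 2 ≤ (cnt FP n : ℝ) + cnt FQ n := by
    intro n
    have h1 : ((cnt FP n : ℝ) + cnt FQ n) = (⌊β * n⌋₊ : ℝ) + ⌊α * n⌋₊ := by exact_mod_cast hcnt n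
    have h2 := Nat.lt_floor_add_one (β * (n : ℝ))
    have h3 := Nat.lt_floor_add_one (α * (n : ℝ))
    rw [h1, ← hαβ]; linarith
  have hlow : ∀ H : ℕ → Prop, ∀ k, (∀ n, nk k ≤ n → n < nk (k + 1) → H n → dens α n) →
      (cnt H (nk (k + 1)) : ℝ) ≤ nk k + α * nk (k + 1) := by
    intro H k h
    have h1 := cnt_block H (dens α) (nk k) (nk (k + 1)) (nk_strictMono (Nat.lt_succ_self k)).le h
    rw [cnt_dens α hα0 hα1] at h1
    have h2 := Nat.floor_le (show 0 ≤ α * (nk (k + 1) : ℝ) by positivity)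
    have h3 : (cnt H (nk (k + 1)) : ℝ) ≤ nk k + (⌊α * (nk (k + 1) : ℝ)⌋₊ : ℝ) := by
      exact_mod_cast h1
    linarith
  have hQ : ∀ k, k % 2 = 0 → (cnt FQ (nk (k + 1)) : ℝ) ≤ nk k + α * nk (k + 1) := by
    intro k hk
    apply hlow
    rintro n h1 h2 (⟨_, h⟩ | ⟨h, _⟩)
    · exact h
    · exact absurd ⟨k, hk, h1, h2⟩ h
  have hP : ∀ k, k % 2 = 1 → (cnt FP (nk (k + 1)) : ℝ) ≤ nk k + α * nk (k + 1) := by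
    intro k hk
    apply hlow
    rintro n h1 h2 (⟨h, _⟩ | ⟨_, h⟩)
    · exact absurd h (not_ev k n hk h1 h2)
    · exact h
  refine ⟨dset FP ×ˢ dset FQ,
    ((A 0 ×ˢ dset FQ) ∪ (A 2 ×ˢ dset FQ)) ∪ ((dset FP ×ˢ A 1) ∪ (dset FP ×ˢ A 3)),
    (dset_compact _).prod (dset_compact _),
    (((A_compact 0).prod (dset_compact _)).union ((A_compact 2).prod (dset_compact _))).union
      (((dset_compact _).prod (A_compact 1)).union ((dset_compact _).prod (A_compact 3))),
    ?_, ?_, ?_⟩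
  · apply le_antisymm
    · apply upper s 1 hs₀ (by norm_num)
      intro N
      obtain ⟨T1, hT1, hc1⟩ := dset_cover FP N
      obtain ⟨T2, hT2, hc2⟩ := dset_cover FQ N
      refine ⟨N, le_rfl, T1 ×ˢ T2, ?_, ?_⟩
      · rw [Finset.card_product]
        push_cast
        calc (T1.card : ℝ) * T2.card ≤ 2 ^ cnt FP N * 2 ^ cnt FQ N := by gcongr
          _ ≤ 1 * 2 ^ (s * N) := by
            rw [one_mul, ← Real.rpow_natCast, ← Real.rpow_natCast, ← Real.rpow_add (by norm_num)]
            exact Real.rpow_le_rpow_of_exponent_le (by norm_num) (hcntle N)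
      · rintro ⟨x, y⟩ ⟨hx, hy⟩
        obtain ⟨a, ha, hxa⟩ := hc1 x hx
        obtain ⟨b, hb, hyb⟩ := hc2 y hy
        refine ⟨(a, b), Finset.mk_mem_product ha hb, ?_⟩
        rw [Prod.dist_eq]
        exact max_le hxa hyb
    · rcases hs₀.eq_or_lt with h | h
      · rw [← h]; simp
      · exact lower FP FQ s 2 h hcntge _ fun t ht u hu =>
          ⟨subset_closure ⟨t, ht, rfl⟩, subset_closure ⟨u, hu, rfl⟩⟩
  · apply le_antisymm
    · rw [dimH_union, dimH_union, dimH_union]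
      refine max_le (max_le ?_ ?_) (max_le ?_ ?_)
      · exact piece 0 (by norm_num) FQ α hα0 fun k hk => hQ k (by omega)
      · exact piece 2 (by norm_num) FQ α hα0 fun k hk => hQ k (by omega)
      · exact piece' 1 (by norm_num) FP α hα0 fun k hk => hP k (by omega)
      · exact piece' 3 (by norm_num) FP α hα0 fun k hk => hP k (by omega)
    · rcases hα0.eq_or_lt with h | h
      · rw [← h]; simp
      · have hs1 : α = s - 1 := by
          rw [hα] at h ⊢
          rcases lt_max_iff.1 h with h' | h'
          · exact max_eq_left h'.le
          · exact absurd h' (lt_irrefl _)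
        refine lower (fun _ => False) FQ α 2 h ?_ _ fun t ht u hu => ?_
        · intro n
          have h1 := hcntge n
          have h2 : (cnt FP n : ℝ) ≤ n := by exact_mod_cast cnt_le FP n
          have h3 : (0 : ℝ) ≤ cnt (fun _ => False) n := by positivity
          rw [hs1]
          linarith
        · rw [zero_mem_empty]
          exact Or.inl (Or.inl ⟨zero_mem_A 0, subset_closure ⟨u, hu, rfl⟩⟩)
  · rintro ⟨p, q⟩ ⟨hp, hq⟩
    have hp1 := abs_le.1 (dset_bdd _ p hp)
    have hq1 := abs_le.1 (dset_bdd _ q hq)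
    obtain ⟨ρ, hρ, h⟩ := exists_rho fun k =>
      if k % 4 = 0 then -p else if k % 4 = 1 then -q else if k % 4 = 2 then p else q
    rw [abs_le] at hρ
    have m0 : p + ρ ∈ A 0 := by
      refine ⟨abs_le.2 ⟨by linarith, by linarith⟩, fun k hk => ?_⟩
      obtain ⟨m, hm⟩ := h k
      simp only [hk, if_true] at hm
      exact ⟨m, by convert hm using 2; ring⟩
    have m1 : q + ρ ∈ A 1 := by
      refine ⟨abs_le.2 ⟨by linarith, by linarith⟩, fun k hk => ?_⟩
      obtain ⟨m, hm⟩ := h k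
      norm_num [hk] at hm
      exact ⟨m, by convert hm using 2; ring⟩
    have m2 : p - ρ ∈ A 2 := by
      refine ⟨abs_le.2 ⟨by linarith, by linarith⟩, fun k hk => ?_⟩
      obtain ⟨m, hm⟩ := h k
      norm_num [hk] at hm
      refine ⟨-m, ?_⟩
      rw [← abs_neg]
      convert hm using 2
      push_cast; ring
    have m3 : q - ρ ∈ A 3 := by
      refine ⟨abs_le.2 ⟨by linarith, by linarith⟩, fun k hk => ?_⟩
      obtain ⟨m, hm⟩ := h k
      norm_num [hk] at hm
      refine ⟨-m, ?_⟩
      rw [← abs_neg]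
      convert hm using 2
      push_cast; ring
    exact ⟨ρ, by linarith, Or.inl (Or.inr ⟨m2, hq⟩), Or.inl (Or.inl ⟨m0, hq⟩),
      Or.inr (Or.inr ⟨hp, m3⟩), Or.inr (Or.inl ⟨hp, m1⟩)⟩

/-- the rotation (with scaling) -/
noncomputable def rot : (ℝ × ℝ) ≃ₗ[ℝ] (ℝ × ℝ) where
  toFun p := (p.1 + p.2, p.1 - p.2)
  invFun p := ((p.1 + p.2) / 2, (p.1 - p.2) / 2)
  map_add' p q := by ext <;> simp <;> ring
  map_smul' c p := by ext <;> simp <;> ring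
  left_inv p := by ext <;> simp
  right_inv p := by ext <;> simp <;> ring

lemma unrotated (s : ℝ) (hs₀ : 0 ≤ s) (hs₂ : s ≤ 2) :
    ∃ S B : Set (ℝ × ℝ), IsCompact S ∧ IsCompact B ∧
      dimH S = ENNReal.ofReal s ∧ dimH B = ENNReal.ofReal (max (s - 1) 0) ∧
      ∀ p ∈ S, ∃ r > (0 : ℝ),
        (p.1 - r, p.2 - r) ∈ B ∧ (p.1 - r, p.2 + r) ∈ B ∧
        (p.1 + r, p.2 - r) ∈ B ∧ (p.1 + r, p.2 + r) ∈ B := by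
  obtain ⟨S, B, hS, hB, dS, dB, h⟩ := rotated s hs₀ hs₂
  let φ : (ℝ × ℝ) ≃L[ℝ] (ℝ × ℝ) := rot.toContinuousLinearEquiv
  have hφ : ∀ p, φ p = (p.1 + p.2, p.1 - p.2) := fun p => rfl
  refine ⟨φ '' S, φ '' B, hS.image φ.continuous, hB.image φ.continuous,
    by rw [φ.dimH_image, dS], by rw [φ.dimH_image, dB], ?_⟩
  rintro _ ⟨⟨p, q⟩, hp, rfl⟩
  obtain ⟨r, hr, h1, h2, h3, h4⟩ := h _ hp
  simp only [hφ]
  refine ⟨r, hr, ⟨_, h1, ?_⟩, ⟨_, h3, ?_⟩, ⟨_, h4, ?_⟩, ⟨_, h2, ?_⟩⟩ <;>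
  · ext <;> simp <;> ring

end SqV

/-- For every `s ∈ [0, 2]` there exist compact sets `S, B ⊆ ℝ × ℝ` with `dimH S = s`,
`dimH B = max (s - 1) 0`, such that `B` contains the four vertices of an axis-parallel
square centered at every point of `S`. -/
theorem square_vertices_hausdorff_sharp (s : ℝ) (hs₀ : 0 ≤ s) (hs₂ : s ≤ 2) :
    ∃ S B : Set (ℝ × ℝ), IsCompact S ∧ IsCompact B ∧
      dimH S = ENNReal.ofReal s ∧ dimH B = ENNReal.ofReal (max (s - 1) 0) ∧
      ∀ p ∈ S, ∃ r > (0 : ℝ),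
        (p.1 - r, p.2 - r) ∈ B ∧ (p.1 - r, p.2 + r) ∈ B ∧
        (p.1 + r, p.2 - r) ∈ B ∧ (p.1 + r, p.2 + r) ∈ B := by
  exact SqV.unrotated s hs₀ hs₂
end

section
/- Let 0 ≤ k < n be integers and let s ∈ [0, n]. There exist compact sets S, B ⊆ ℝⁿ such that dimH S = s, for every x ∈ S there exists r > 0 with skelₖ(x, r) ⊆ B, and dimH B = max(s − 1, k). (Thornton's conjecture, proved by Chang–Csörnyei–Héra–Keleti.) -/
open scoped ENNReal

/-- The `k`-skeleton of the axis-parallel cube in `ℝⁿ` with center `x` and half side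
length `r`: points `y` of the cube surface lying on a face of dimension at most `k`,
i.e. `|yᵢ - xᵢ| ≤ r` for all `i` and `|yᵢ - xᵢ| = r` for at least `n - k` indices `i`. -/
def cubeSkeleton (n k : ℕ) (x : EuclideanSpace ℝ (Fin n)) (r : ℝ) :
    Set (EuclideanSpace ℝ (Fin n)) :=
  {y | (∀ i, |y i - x i| ≤ r) ∧ n - k ≤ {i | |y i - x i| = r}.ncard}

open MeasureTheory Filter Topology Set
open scoped ENNReal NNReal

namespace Thornton

/-- Upper bound for the Hausdorff dimension of the range of a map via finite labellings. -/
theorem dimH_range_le_of_label {P X : Type*} [MetricSpace X] (h : P → X) (t : ℝ) (ht : 0 ≤ t)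
    (H : ∀ t' > t, ∀ δ > (0 : ℝ), ∃ (L : Type) (F : Finset L) (lab : P → L) (c : ℝ),
      0 < c ∧ c ≤ δ ∧ (∀ p, lab p ∈ F) ∧
      (∀ p p', lab p = lab p' → dist (h p) (h p') ≤ c) ∧ (F.card : ℝ) * c ^ t' ≤ 1) :
    dimH (range h) ≤ ENNReal.ofReal t := by
  let _ : MeasurableSpace X := borel X
  have : BorelSpace X := ⟨rfl⟩
  have key : ∀ t' : ℝ≥0, t < t' → dimH (range h) ≤ t' := by
    intro t' ht'
    apply dimH_le_of_hausdorffMeasure_ne_top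
    choose L F lab c hc0 hcδ hF hd hcard using
      fun m : ℕ => H t' ht' (1 / ((m : ℝ) + 1)) (by positivity)
    have hpos : 0 < (t' : ℝ) := lt_of_le_of_lt ht ht'
    have hle : μH[(t' : ℝ)] (range h) ≤
        liminf (fun m => ∑ i : F m, Metric.ediam (h '' {p | lab m p = i.1}) ^ (t' : ℝ)) atTop := by
      refine Measure.hausdorffMeasure_le_liminf_sum (t' : ℝ) (range h)
        (fun m => ENNReal.ofReal (c m)) ?_
        (fun m (i : F m) => h '' {p | lab m p = i.1}) ?_ ?_
      · rw [← ENNReal.ofReal_zero]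
        refine ENNReal.tendsto_ofReal ?_
        exact squeeze_zero (fun m => (hc0 m).le) hcδ tendsto_one_div_add_atTop_nhds_zero_nat
      · refine Eventually.of_forall fun m i => Metric.ediam_le ?_
        rintro _ ⟨p, hp, rfl⟩ _ ⟨p', hp', rfl⟩
        rw [edist_dist]
        exact ENNReal.ofReal_le_ofReal (hd m p p' (by rw [hp, hp']))
      · refine Eventually.of_forall fun m => ?_
        rintro _ ⟨p, rfl⟩
        exact mem_iUnion.2 ⟨⟨lab m p, hF m p⟩, ⟨p, rfl, rfl⟩⟩
    have h1 : ∀ m, ∑ i : F m, Metric.ediam (h '' {p | lab m p = i.1}) ^ (t' : ℝ) ≤ 1 := by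
      intro m
      calc ∑ i : F m, Metric.ediam (h '' {p | lab m p = i.1}) ^ (t' : ℝ)
          ≤ ∑ i : F m, ENNReal.ofReal (c m ^ (t' : ℝ)) := by
            refine Finset.sum_le_sum fun i _ => ?_
            rw [← ENNReal.ofReal_rpow_of_pos (hc0 m)]
            refine ENNReal.rpow_le_rpow (Metric.ediam_le ?_) hpos.le
            rintro _ ⟨p, hp, rfl⟩ _ ⟨p', hp', rfl⟩
            rw [edist_dist]
            exact ENNReal.ofReal_le_ofReal (hd m p p' (by rw [hp, hp']))
        _ = ENNReal.ofReal ((F m).card * c m ^ (t' : ℝ)) := by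
            rw [ENNReal.ofReal_mul (by positivity)]
            simp
        _ ≤ 1 := by
            rw [← ENNReal.ofReal_one]
            exact ENNReal.ofReal_le_ofReal (hcard m)
    have h2 : μH[(t' : ℝ)] (range h) ≤ 1 := by
      refine hle.trans ?_
      refine (liminf_le_liminf (Eventually.of_forall h1)).trans ?_
      simp
    exact (lt_of_le_of_lt h2 ENNReal.one_lt_top).ne
  refine le_of_forall_gt fun b hb => ?_
  obtain ⟨r, hr1, hr2⟩ := ENNReal.lt_iff_exists_nnreal_btwn.1 hb
  refine lt_of_le_of_lt (key r ?_) hr2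
  rw [ENNReal.ofReal_lt_iff_lt_toReal ht (by simp)] at hr1
  simpa using hr1

/-- Mass distribution principle. -/
theorem le_dimH_range_of_mass {Ω X : Type*} [MeasurableSpace Ω] [MetricSpace X]
    [MeasurableSpace X] [BorelSpace X] (μ : Measure Ω) [IsProbabilityMeasure μ] (g : Ω → X)
    (hg : Measurable g) (s : ℝ)
    (H : ∀ s', 0 < s' → s' < s → ∃ ρ₀ > (0 : ℝ), ∀ ρ, 0 < ρ → ρ < ρ₀ → ∀ U : Set X,
      (∀ x ∈ U, ∀ y ∈ U, dist x y ≤ ρ) → μ (g ⁻¹' U) ≤ ENNReal.ofReal (ρ ^ s')) :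
    ENNReal.ofReal s ≤ dimH (range g) := by
  have key : ∀ s' : ℝ≥0, 0 < s' → (s' : ℝ) < s → (s' : ℝ≥0∞) ≤ dimH (range g) := by
    intro s' h0 hs'
    obtain ⟨ρ₀, hρ₀, hH⟩ := H s' h0 hs'
    have hle : μ.map g ≤ μH[(s' : ℝ)] := by
      refine Measure.le_hausdorffMeasure (s' : ℝ) _ (ENNReal.ofReal (ρ₀ / 2)) (by simpa using hρ₀) ?_
      intro U hU
      have hfin : Metric.ediam U ≠ ∞ := (lt_of_le_of_lt hU ENNReal.ofReal_lt_top).ne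
      set d := (Metric.ediam U).toReal with hd
      have hUd : Metric.ediam U = ENNReal.ofReal d := (ENNReal.ofReal_toReal hfin).symm
      have hd0 : 0 ≤ d := ENNReal.toReal_nonneg
      have hdρ : d < ρ₀ := by
        have : d ≤ ρ₀ / 2 := by
          rw [hUd] at hU
          exact (ENNReal.ofReal_le_ofReal_iff (by positivity)).1 hU
        linarith
      have hb : ∀ ρ, d < ρ → ρ < ρ₀ → μ.map g U ≤ ENNReal.ofReal (ρ ^ (s' : ℝ)) := by
        intro ρ h1 h2
        refine (measure_mono subset_closure).trans ?_
        rw [Measure.map_apply hg isClosed_closure.measurableSet]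
        refine hH ρ (by linarith) h2 _ fun x hx y hy => ?_
        have : edist x y ≤ Metric.ediam (closure U) := Metric.edist_le_ediam_of_mem hx hy
        rw [Metric.ediam_closure, hUd, edist_dist, ENNReal.ofReal_le_ofReal_iff hd0] at this
        linarith
      rw [hUd, ENNReal.ofReal_rpow_of_nonneg hd0 s'.coe_nonneg]
      have ht : Tendsto (fun ρ : ℝ => ENNReal.ofReal (ρ ^ (s' : ℝ))) (𝓝[>] d)
          (𝓝 (ENNReal.ofReal (d ^ (s' : ℝ)))) := by
        refine ENNReal.tendsto_ofReal ?_
        exact ((Real.continuous_rpow_const s'.coe_nonneg).tendsto d).mono_left nhdsWithin_le_nhds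
      refine ge_of_tendsto ht ?_
      filter_upwards [Ioo_mem_nhdsGT hdρ] with ρ hρ
      exact hb ρ hρ.1 hρ.2
    apply le_dimH_of_hausdorffMeasure_ne_zero
    intro h0'
    have h1 := hle (range g)
    rw [h0'] at h1
    have h2 : μ.map g (range g) = 1 := by
      have : IsProbabilityMeasure (μ.map g) := Measure.isProbabilityMeasure_map hg.aemeasurable
      refine le_antisymm prob_le_one ?_
      calc (1 : ℝ≥0∞) = μ univ := by simp
        _ ≤ μ (g ⁻¹' (range g)) := by simp
        _ ≤ _ := Measure.le_map_apply hg.aemeasurable _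
    rw [h2] at h1
    simp at h1
  refine le_of_forall_lt fun b hb => ?_
  obtain ⟨r, hr1, hr2⟩ := ENNReal.lt_iff_exists_nnreal_btwn.1 hb
  refine lt_of_lt_of_le hr1 (key r ?_ ?_)
  · have := lt_of_le_of_lt (zero_le (a := b)) hr1
    exact_mod_cast this
  · exact (ENNReal.lt_ofReal_iff_toReal_lt (by simp)).1 hr2


/-- Exponents of the scales. -/
def NN (j : ℕ) : ℕ := 5 * (j + 1).factorial

/-- The scales. -/
noncomputable def RR (j : ℕ) : ℝ := (1 / 2) ^ NN j

lemma NN_succ (j : ℕ) : NN (j + 1) = (j + 2) * NN j := by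
  unfold NN; rw [Nat.factorial_succ (j + 1)]; ring

lemma le_NN (j : ℕ) : 5 * (j + 1) ≤ NN j := by
  unfold NN
  have := Nat.self_le_factorial (j + 1)
  omega

lemma NN_add_five_le (j : ℕ) : NN j + 5 ≤ NN (j + 1) := by
  rw [NN_succ]; have := le_NN j; nlinarith

lemma RR_pos (j : ℕ) : 0 < RR j := by unfold RR; positivity

lemma RR_succ_le (j : ℕ) : RR (j + 1) ≤ RR j * (1 / 2) := by
  unfold RR
  rw [← pow_succ]
  exact pow_le_pow_of_le_one (by norm_num) (by norm_num) (by have := NN_add_five_le j; omega)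

lemma RR_add_le (j m : ℕ) : RR (m + j) ≤ RR j * (1 / 2) ^ m := by
  induction m with
  | zero => simp
  | succ m ih =>
    have h := RR_succ_le (m + j)
    rw [show m + 1 + j = m + j + 1 by ring, pow_succ]
    nlinarith

lemma RR_anti {i j : ℕ} (h : i ≤ j) : RR j ≤ RR i := by
  obtain ⟨m, rfl⟩ := Nat.exists_eq_add_of_le' h
  have := RR_add_le i m
  have h2 : ((1 : ℝ) / 2) ^ m ≤ 1 := pow_le_one₀ (by norm_num) (by norm_num)
  nlinarith [RR_pos i]

lemma RR_zero : RR 0 = 1 / 32 := by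
  unfold RR NN; norm_num

lemma summable_RR : Summable RR := by
  refine Summable.of_nonneg_of_le (fun j => (RR_pos j).le) (fun m => RR_add_le 0 m) ?_
  exact (summable_geometric_two).mul_left _

lemma tendsto_RR : Tendsto RR atTop (𝓝 0) := summable_RR.tendsto_atTop_zero

lemma summable_of_RR {F : ℕ → ℝ} {c : ℝ} (hF : ∀ l, |F l| ≤ c * RR l) : Summable F :=
  Summable.of_norm_bounded (summable_RR.mul_left c) hF

lemma tail_le {F G : ℕ → ℝ} {c : ℝ} (hF : ∀ l, |F l| ≤ c * RR l) (hG : ∀ l, |G l| ≤ c * RR l)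
    (j : ℕ) :
    |∑' l, F l - ∑' l, G l - ∑ l ∈ Finset.range j, (F l - G l)| ≤ 4 * c * RR j := by
  have sF := summable_of_RR hF
  have sG := summable_of_RR hG
  have hc : 0 ≤ c := by
    have := (abs_nonneg _).trans (hF 0)
    exact nonneg_of_mul_nonneg_left this (RR_pos 0)
  rw [← sF.tsum_sub sG, ← (sF.sub sG).sum_add_tsum_nat_add j, add_sub_cancel_left]
  have h2 : HasSum (fun m : ℕ => (2 * c * RR j) * ((1 : ℝ) / 2) ^ m) ((2 * c * RR j) * 2) :=
    hasSum_geometric_two.mul_left _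
  have := tsum_of_norm_bounded (f := fun m => F (m + j) - G (m + j)) h2 (fun m => by
    have h3 := RR_add_le j m
    calc ‖F (m + j) - G (m + j)‖ ≤ |F (m + j)| + |G (m + j)| := norm_sub_le _ _
      _ ≤ c * RR (m + j) + c * RR (m + j) := add_le_add (hF _) (hG _)
      _ ≤ _ := by nlinarith)
  rw [Real.norm_eq_abs] at this
  linarith

lemma abs_tsum_le {F : ℕ → ℝ} {c : ℝ} (hF : ∀ l, |F l| ≤ c * RR l) :
    |∑' l, F l| ≤ c / 16 := by
  have h2 : HasSum (fun m : ℕ => (c * RR 0) * ((1 : ℝ) / 2) ^ m) ((c * RR 0) * 2) :=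
    hasSum_geometric_two.mul_left _
  have hc : 0 ≤ c := by
    have := (abs_nonneg _).trans (hF 0)
    exact nonneg_of_mul_nonneg_left this (RR_pos 0)
  have := tsum_of_norm_bounded (f := F) h2 (fun m => by
    have h3 := RR_add_le 0 m
    calc ‖F m‖ ≤ c * RR m := hF m
      _ ≤ _ := by rw [mul_assoc]; exact mul_le_mul_of_nonneg_left h3 hc)
  rw [Real.norm_eq_abs, RR_zero] at this
  linarith

section Construction

variable {n : ℕ}

/-- Parameter space: digit choices at each level and coordinate. -/
abbrev Om (f : ℕ → Fin n → ℕ) : Type := (p : ℕ × Fin n) → Fin (2 ^ f p.1 p.2)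

/-- Scaled digit. -/
noncomputable def dg (f : ℕ → Fin n → ℕ) (l : ℕ) (i : Fin n) (ω : Om f) : ℝ :=
  ((ω (l, i) : ℕ) : ℝ) * (1 / 2) ^ (NN l + f l i)

/-- Increment of the point at level `l`. -/
noncomputable def vv (f : ℕ → Fin n → ℕ) (e : ℕ → Fin n → ℝ) (c : ℕ → Fin n) (ω : Om f)
    (i : Fin n) (l : ℕ) : ℝ :=
  (if i = c l then 0 else dg f l i ω) - e l i * dg f l (c l) ω

/-- The center. -/
noncomputable def xx (f : ℕ → Fin n → ℕ) (e : ℕ → Fin n → ℝ) (c : ℕ → Fin n) (ω : Om f) :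
    Fin n → ℝ := fun i => ∑' l, vv f e c ω i l

/-- The radius. -/
noncomputable def rad (f : ℕ → Fin n → ℕ) (c : ℕ → Fin n) (ω : Om f) : ℝ :=
  1 + ∑' l, dg f l (c l) ω

variable (f : ℕ → Fin n → ℕ) (e : ℕ → Fin n → ℝ) (c : ℕ → Fin n)

lemma dg_nonneg (l : ℕ) (i : Fin n) (ω : Om f) : 0 ≤ dg f l i ω := by unfold dg; positivity

lemma dg_le (l : ℕ) (i : Fin n) (ω : Om f) : dg f l i ω ≤ RR l := by
  unfold dg RR
  have h : ((ω (l, i) : ℕ) : ℝ) ≤ 2 ^ f l i := by exact_mod_cast (ω (l, i)).2.le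
  rw [pow_add, mul_comm, mul_assoc]
  have h3 : ((1 : ℝ) / 2) ^ f l i * 2 ^ f l i = 1 := by rw [← mul_pow]; norm_num
  have h2 : ((1 : ℝ) / 2) ^ f l i * (ω (l, i) : ℕ) ≤ 1 := by
    refine le_trans ?_ h3.le; gcongr
  have : 0 ≤ ((1 : ℝ) / 2) ^ NN l := by positivity
  nlinarith

lemma abs_dg_le (l : ℕ) (i : Fin n) (ω : Om f) : |dg f l i ω| ≤ 1 * RR l := by
  rw [abs_of_nonneg (dg_nonneg f l i ω), one_mul]; exact dg_le f l i ω

lemma abs_vv_le (he : ∀ l i, |e l i| ≤ 1) (ω : Om f) (i : Fin n) (l : ℕ) :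
    |vv f e c ω i l| ≤ 2 * RR l := by
  unfold vv
  have h1 := abs_dg_le f l (c l) ω
  have h2 := abs_dg_le f l i ω
  have h3 : |e l i * dg f l (c l) ω| ≤ RR l := by
    rw [abs_mul]
    nlinarith [he l i, abs_nonneg (e l i), abs_nonneg (dg f l (c l) ω)]
  have h4 : |if i = c l then 0 else dg f l i ω| ≤ RR l := by
    split_ifs
    · simpa using (RR_pos l).le
    · linarith
  have := abs_sub (if i = c l then 0 else dg f l i ω) (e l i * dg f l (c l) ω)
  linarith

lemma continuous_dg (l : ℕ) (i : Fin n) : Continuous (dg f l i) := by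
  unfold dg
  refine Continuous.mul ?_ continuous_const
  exact (continuous_of_discreteTopology (f := fun q : Fin (2 ^ f l i) => ((q : ℕ) : ℝ))).comp
    (continuous_apply (l, i))

lemma continuous_xx (he : ∀ l i, |e l i| ≤ 1) : Continuous (xx f e c) := by
  refine continuous_pi fun i => ?_
  refine continuous_tsum (u := fun l => 2 * RR l) (fun l => ?_) (summable_RR.mul_left 2)
    (fun l ω => abs_vv_le f e c he ω i l)
  unfold vv
  have := continuous_dg f l i
  have := continuous_dg f l (c l)
  split_ifs <;> fun_prop

lemma continuous_rad : Continuous (rad f c) := by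
  refine continuous_const.add ?_
  exact continuous_tsum (u := fun l => 1 * RR l) (fun l => continuous_dg f l (c l))
    (summable_RR.mul_left 1) (fun l ω => abs_dg_le f l (c l) ω)

lemma one_le_rad (ω : Om f) : 1 ≤ rad f c ω := by
  unfold rad
  have : 0 ≤ ∑' l, dg f l (c l) ω := tsum_nonneg fun l => dg_nonneg f l (c l) ω
  linarith

lemma rad_le (ω : Om f) : rad f c ω ≤ 1 + 1 / 16 := by
  unfold rad
  have := (abs_le.1 (abs_tsum_le (fun l => abs_dg_le f l (c l) ω))).2
  linarith

lemma abs_xx_le (he : ∀ l i, |e l i| ≤ 1) (ω : Om f) (i : Fin n) : |xx f e c ω i| ≤ 1 / 8 := by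
  have := abs_tsum_le (fun l => abs_vv_le f e c he ω i l)
  unfold xx
  linarith

lemma sep (he : ∀ l i, |e l i| ≤ 1) (hc : ∀ l, |e l (c l)| = 1) (ω ω' : Om f) (j : ℕ)
    (hagree : ∀ l < j, ∀ i, ω (l, i) = ω' (l, i)) (ρ : ℝ)
    (hρ : ∀ i, |xx f e c ω i - xx f e c ω' i| ≤ ρ) (i : Fin n) :
    |dg f j i ω - dg f j i ω'| ≤ 2 * (ρ + 8 * RR (j + 1)) := by
  have h1 : ∀ i, |vv f e c ω i j - vv f e c ω' i j| ≤ ρ + 8 * RR (j + 1) := by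
    intro i
    have h2 := tail_le (fun l => abs_vv_le f e c he ω i l) (fun l => abs_vv_le f e c he ω' i l)
      (j + 1)
    have h3 : ∑ l ∈ Finset.range j, (vv f e c ω i l - vv f e c ω' i l) = 0 := by
      refine Finset.sum_eq_zero fun l hl => ?_
      have hl' := Finset.mem_range.1 hl
      unfold vv dg
      rw [hagree l hl' i, hagree l hl' (c l)]
      ring
    rw [Finset.sum_range_succ, h3, zero_add] at h2
    have h4 := hρ i
    unfold xx at h4
    rw [abs_le] at h2 h4 ⊢
    constructor <;> linarith [h2.1, h2.2, h4.1, h4.2]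
  have h5 : |dg f j (c j) ω - dg f j (c j) ω'| ≤ ρ + 8 * RR (j + 1) := by
    have h6 := h1 (c j)
    unfold vv at h6
    rw [if_pos rfl, if_pos rfl, show (0 : ℝ) - e j (c j) * dg f j (c j) ω -
      (0 - e j (c j) * dg f j (c j) ω') = - (e j (c j) * (dg f j (c j) ω - dg f j (c j) ω')) by ring,
      abs_neg, abs_mul, hc, one_mul] at h6
    exact h6
  have h0 : 0 ≤ ρ + 8 * RR (j + 1) := (abs_nonneg _).trans h5
  by_cases hi : i = c j
  · subst hi; linarith
  · have h6 := h1 i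
    unfold vv at h6
    rw [if_neg hi, if_neg hi] at h6
    have h7 : |e j i * (dg f j (c j) ω - dg f j (c j) ω')| ≤ ρ + 8 * RR (j + 1) := by
      rw [abs_mul]
      nlinarith [he j i, abs_nonneg (e j i), abs_nonneg (dg f j (c j) ω - dg f j (c j) ω')]
    rw [abs_le] at h6 h7 ⊢
    constructor <;> linarith [h6.1, h6.2, h7.1, h7.2]

lemma agree (hf : ∀ l i, NN l + f l i + 5 ≤ NN (l + 1))
    (he : ∀ l i, |e l i| ≤ 1) (hc : ∀ l, |e l (c l)| = 1) (ω ω' : Om f) (j : ℕ) (ρ : ℝ)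
    (hρj : ρ < RR j) (hρ : ∀ i, |xx f e c ω i - xx f e c ω' i| ≤ ρ) :
    ∀ l < j, ∀ i, ω (l, i) = ω' (l, i) := by
  intro l
  induction l using Nat.strong_induction_on with
  | _ l ih =>
    intro hl i
    have h1 := sep f e c he hc ω ω' l (fun l' hl' => ih l' hl' (hl'.trans hl)) ρ hρ i
    have h2 : ρ < RR (l + 1) := hρj.trans_le (RR_anti hl)
    have h3 : 32 * RR (l + 1) ≤ (1 / 2) ^ (NN l + f l i) := by
      unfold RR
      calc 32 * ((1 : ℝ) / 2) ^ NN (l + 1) ≤ 32 * ((1 : ℝ) / 2) ^ (NN l + f l i + 5) := by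
            gcongr 32 * ?_
            exact pow_le_pow_of_le_one (by norm_num) (by norm_num) (hf l i)
        _ = _ := by rw [pow_add]; norm_num; ring
    by_contra hne
    have h4 : (1 : ℝ) ≤ |((ω (l, i) : ℕ) : ℝ) - ((ω' (l, i) : ℕ) : ℝ)| := by
      have h5 : ((ω (l, i) : ℕ) : ℤ) - ((ω' (l, i) : ℕ) : ℤ) ≠ 0 := by
        intro h
        apply hne
        apply Fin.ext
        omega
      have := Int.one_le_abs h5
      exact_mod_cast this
    unfold dg at h1
    rw [← sub_mul, abs_mul, abs_of_pos (by positivity : (0 : ℝ) < (1 / 2) ^ (NN l + f l i))] at h1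
    have h6 := RR_pos (l + 1)
    nlinarith


/-- The uniform measure on digits. -/
noncomputable def unif (m : ℕ) : Measure (Fin (2 ^ m)) :=
  (PMF.uniformOfFintype (Fin (2 ^ m))).toMeasure

instance (m : ℕ) : IsProbabilityMeasure (unif m) := by unfold unif; infer_instance

lemma card_near (m : ℕ) (a D : ℝ) (hD : 0 ≤ D) :
    ((Finset.univ.filter fun q : Fin m => |((q : ℕ) : ℝ) - a| ≤ D).card : ℝ) ≤ 2 * D + 1 := by
  have h1 : (Finset.univ.filter fun q : Fin m => |((q : ℕ) : ℝ) - a| ≤ D).card ≤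
      (Finset.Icc ⌈a - D⌉ ⌊a + D⌋).card := by
    refine Finset.card_le_card_of_injOn (fun q => ((q : ℕ) : ℤ)) ?_ ?_
    · intro q hq
      have hq' := (Finset.mem_filter.1 (Finset.mem_coe.1 hq)).2
      rw [abs_le] at hq'
      simp only [Finset.coe_Icc, Set.mem_Icc]
      rw [Int.ceil_le, Int.le_floor]
      push_cast
      constructor <;> linarith [hq'.1, hq'.2]
    · intro q _ q' _ h
      apply Fin.ext
      simpa using h
  rw [Int.card_Icc] at h1
  have h2 : (((⌊a + D⌋ + 1 - ⌈a - D⌉).toNat : ℤ) : ℝ) ≤ 2 * D + 1 := by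
    rcases le_total 0 (⌊a + D⌋ + 1 - ⌈a - D⌉) with h | h
    · rw [Int.toNat_of_nonneg h]
      push_cast
      linarith [Int.floor_le (a + D), Int.le_ceil (a - D)]
    · rw [Int.toNat_of_nonpos h]
      push_cast
      linarith
  have h3 : ((Finset.univ.filter fun q : Fin m => |((q : ℕ) : ℝ) - a| ≤ D).card : ℝ) ≤
    ((⌊a + D⌋ + 1 - ⌈a - D⌉).toNat : ℝ) := by exact_mod_cast h1
  refine h3.trans ?_
  exact_mod_cast h2

lemma unif_near (m : ℕ) (a D : ℝ) (hD : 0 ≤ D) :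
    unif m {q : Fin (2 ^ m) | |((q : ℕ) : ℝ) - a| ≤ D} ≤
      ENNReal.ofReal ((2 * D + 1) * (1 / 2) ^ m) := by
  classical
  unfold unif
  have h := card_near (2 ^ m) a D hD
  have h2 : (Fintype.card {q : Fin (2 ^ m) | |((q : ℕ) : ℝ) - a| ≤ D}) =
      (Finset.univ.filter fun q : Fin (2 ^ m) => |((q : ℕ) : ℝ) - a| ≤ D).card := by
    rw [Fintype.card_subtype]
    rfl
  rw [PMF.toMeasure_uniformOfFintype_apply]
  · rw [h2, Fintype.card_fin, ← ENNReal.ofReal_natCast, ← ENNReal.ofReal_natCast,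
      ← ENNReal.ofReal_div_of_pos (by positivity)]
    refine ENNReal.ofReal_le_ofReal ?_
    rw [div_eq_mul_inv]
    push_cast
    rw [one_div, inv_pow]
    gcongr
  · exact (Set.toFinite _).measurableSet

lemma unif_singleton (m : ℕ) (a : Fin (2 ^ m)) :
    unif m {a} ≤ ENNReal.ofReal ((1 / 2) ^ m) := by
  have h := unif_near m ((a : ℕ) : ℝ) 0 le_rfl
  refine (measure_mono ?_).trans (h.trans (by simp))
  intro q hq
  rw [Set.mem_singleton_iff] at hq
  simp [hq]

/-- The product measure on the parameter space. -/
noncomputable def mu : Measure (Om f) := Measure.infinitePi fun p : ℕ × Fin n => unif (f p.1 p.2)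

instance : IsProbabilityMeasure (mu f) := by unfold mu; infer_instance

lemma mass (hf : ∀ l i, NN l + f l i + 5 ≤ NN (l + 1))
    (he : ∀ l i, |e l i| ≤ 1) (hc : ∀ l, |e l (c l)| = 1) (j : ℕ) (ρ : ℝ)
    (hρ1 : RR (j + 1) ≤ ρ) (hρj : ρ < RR j) (U : Set (Fin n → ℝ))
    (hU : ∀ x ∈ U, ∀ y ∈ U, dist x y ≤ ρ) :
    mu f (xx f e c ⁻¹' U) ≤ ENNReal.ofReal
      ((∏ l ∈ Finset.range j, ∏ i, (1 / 2) ^ f l i) *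
        ∏ i, (36 * (ρ / RR j) + (1 / 2) ^ f j i)) := by
  classical
  have hρ0 : 0 < ρ := (RR_pos _).trans_le hρ1
  rcases (xx f e c ⁻¹' U).eq_empty_or_nonempty with h | ⟨ω', hω'⟩
  · rw [h]; simp
  set D : Fin n → ℝ := fun i => 18 * ρ / (1 / 2) ^ (NN j + f j i) with hD
  have hD0 : ∀ i, 0 ≤ D i := fun i => by rw [hD]; positivity
  set t : (p : ℕ × Fin n) → Set (Fin (2 ^ f p.1 p.2)) := fun p =>
    if p.1 = j then {q | |((q : ℕ) : ℝ) - ((ω' p : ℕ) : ℝ)| ≤ D p.2} else {ω' p} with ht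
  have hsub : xx f e c ⁻¹' U ⊆
      Set.pi ((Finset.range (j + 1) ×ˢ (Finset.univ : Finset (Fin n)) : Finset (ℕ × Fin n)) :
        Set (ℕ × Fin n)) t := by
    intro ω hω p hp
    have hd : ∀ i, |xx f e c ω i - xx f e c ω' i| ≤ ρ := fun i =>
      (dist_le_pi_dist (xx f e c ω) (xx f e c ω') i).trans (hU _ hω _ hω')
    have hag := agree f e c hf he hc ω ω' j ρ hρj hd
    obtain ⟨l, i⟩ := p
    have hl : l < j + 1 := by simpa using hp
    rw [ht]
    by_cases hlj : l = j
    · subst hlj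
      simp only [if_true, Set.mem_ofPred_eq, hD]
      have h1 := sep f e c he hc ω ω' l hag ρ hd i
      unfold dg at h1
      rw [← sub_mul, abs_mul,
        abs_of_pos (by positivity : (0 : ℝ) < (1 / 2) ^ (NN l + f l i))] at h1
      rw [le_div_iff₀ (by positivity)]
      linarith
    · simp only [hlj, if_false, Set.mem_singleton_iff]
      exact hag l (by omega) i
  refine (measure_mono hsub).trans ?_
  unfold mu
  rw [Measure.infinitePi_pi _ (fun p _ => (Set.toFinite _).measurableSet),
    Finset.prod_product, Finset.prod_range_succ, ENNReal.ofReal_mul (by positivity),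
    ENNReal.ofReal_prod_of_nonneg (fun l _ => by positivity),
    ENNReal.ofReal_prod_of_nonneg (fun i _ => by have := RR_pos j; positivity)]
  refine mul_le_mul' (Finset.prod_le_prod' fun l hl => ?_) (Finset.prod_le_prod' fun i _ => ?_)
  · rw [ENNReal.ofReal_prod_of_nonneg (fun l _ => by positivity)]
    refine Finset.prod_le_prod' fun i _ => ?_
    have hlj : l ≠ j := (Finset.mem_range.1 hl).ne
    simp only [ht, hlj, if_false]
    exact unif_singleton _ _
  · simp only [ht, if_true]
    refine (unif_near _ _ _ (hD0 i)).trans (ENNReal.ofReal_le_ofReal (le_of_eq ?_))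
    simp only [hD]
    unfold RR
    rw [pow_add]
    field_simp
    ring


/-- Available digits. -/
def dd (l : ℕ) : ℕ := NN (l + 1) - NN l - 5

lemma dd_add (l : ℕ) : NN l + dd l + 5 = NN (l + 1) := by
  unfold dd; have := NN_add_five_le l; omega

/-- Number of binary digits used. -/
noncomputable def ff (θ : ℕ → Fin n → ℝ) (l : ℕ) (i : Fin n) : ℕ := ⌊θ l i * dd l⌋₊

lemma ff_le (θ : ℕ → Fin n → ℝ) (h0 : ∀ l i, 0 ≤ θ l i) (l : ℕ) (i : Fin n) :
    (ff θ l i : ℝ) ≤ θ l i * dd l :=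
  Nat.floor_le (mul_nonneg (h0 l i) (Nat.cast_nonneg _))

lemma ff_ge (θ : ℕ → Fin n → ℝ) (l : ℕ) (i : Fin n) :
    θ l i * dd l - 1 ≤ ff θ l i := by
  have := Nat.lt_floor_add_one (θ l i * dd l)
  unfold ff; linarith

lemma ff_le_dd (θ : ℕ → Fin n → ℝ) (h0 : ∀ l i, 0 ≤ θ l i) (h1 : ∀ l i, θ l i ≤ 1) (l : ℕ)
    (i : Fin n) : ff θ l i ≤ dd l := by
  have h := ff_le θ h0 l i
  have h2 : (ff θ l i : ℝ) ≤ dd l := by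
    nlinarith [h1 l i, (Nat.cast_nonneg (dd l) : (0 : ℝ) ≤ dd l)]
  exact_mod_cast h2

lemma hf_ff (θ : ℕ → Fin n → ℝ) (h0 : ∀ l i, 0 ≤ θ l i) (h1 : ∀ l i, θ l i ≤ 1) (l : ℕ)
    (i : Fin n) : NN l + ff θ l i + 5 ≤ NN (l + 1) := by
  have := ff_le_dd θ h0 h1 l i
  have := dd_add l
  omega

lemma half_pow (m : ℕ) : ((1 : ℝ) / 2) ^ m = (2 : ℝ) ^ (-(m : ℝ)) := by
  rw [Real.rpow_neg (by norm_num), Real.rpow_natCast]; simp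

lemma RR_eq (j : ℕ) : RR j = (2 : ℝ) ^ (-(NN j : ℝ)) := half_pow _

lemma sum_dd (j : ℕ) : ∑ l ∈ Finset.range j, (dd l : ℝ) = NN j - 5 - 5 * j := by
  induction j with
  | zero => simp [NN]
  | succ j ih =>
    rw [Finset.sum_range_succ, ih]
    have := dd_add j
    have h : (NN j : ℝ) + dd j + 5 = NN (j + 1) := by exact_mod_cast this
    push_cast
    linarith

lemma half_ff_le (θ : ℕ → Fin n → ℝ) (l : ℕ) (i : Fin n) :
    ((1 : ℝ) / 2) ^ ff θ l i ≤ (2 : ℝ) ^ (1 - θ l i * dd l) := by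
  rw [half_pow]
  refine Real.rpow_le_rpow_of_exponent_le (by norm_num) ?_
  linarith [ff_ge θ l i]

lemma ev_lin (a C : ℝ) (ha : 0 < a) : ∀ᶠ j : ℕ in atTop, C * (j + 1) ≤ a * NN j := by
  filter_upwards [eventually_ge_atTop ⌈C / a⌉₊] with j hj
  have h1 : C / a ≤ j := (Nat.le_ceil _).trans (by exact_mod_cast hj)
  rw [div_le_iff₀ ha] at h1
  have h2 : j * (j + 1) ≤ NN j := by
    unfold NN
    rw [Nat.factorial_succ]
    have := Nat.self_le_factorial j
    nlinarith
  have h3 : (j : ℝ) * (j + 1) ≤ NN j := by exact_mod_cast h2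
  nlinarith [(Nat.cast_nonneg j : (0 : ℝ) ≤ j)]

lemma ev_fact (a C : ℝ) (ha : 0 < a) : ∀ᶠ j : ℕ in atTop, C * NN j ≤ a * NN (j + 1) := by
  filter_upwards [eventually_ge_atTop ⌈C / a⌉₊] with j hj
  have h1 : C / a ≤ j := (Nat.le_ceil _).trans (by exact_mod_cast hj)
  rw [div_le_iff₀ ha] at h1
  rw [NN_succ]
  push_cast
  have : (0 : ℝ) ≤ NN j := Nat.cast_nonneg _
  nlinarith

lemma num1 (θ : ℕ → Fin n → ℝ) (s : ℝ) (hs : ∀ l, ∑ i, θ l i = s) (j : ℕ) :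
    (∏ l ∈ Finset.range j, ∏ i, ((1 : ℝ) / 2) ^ ff θ l i) ≤
      (2 : ℝ) ^ (n * j - s * (NN j - 5 - 5 * j)) := by
  have h1 : ∀ l, ∏ i, ((1 : ℝ) / 2) ^ ff θ l i ≤ (2 : ℝ) ^ (n - s * dd l) := by
    intro l
    calc ∏ i, ((1 : ℝ) / 2) ^ ff θ l i ≤ ∏ i, (2 : ℝ) ^ (1 - θ l i * dd l) :=
          Finset.prod_le_prod (fun i _ => by positivity) fun i _ => half_ff_le θ l i
      _ = (2 : ℝ) ^ (∑ i, (1 - θ l i * dd l)) :=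
          (Real.rpow_sum_of_pos (by norm_num) _ _).symm
      _ = _ := by rw [Finset.sum_sub_distrib, ← Finset.sum_mul, hs]; simp
  calc _ ≤ ∏ l ∈ Finset.range j, (2 : ℝ) ^ (n - s * dd l) :=
        Finset.prod_le_prod (fun l _ => by positivity) fun l _ => h1 l
    _ = (2 : ℝ) ^ (∑ l ∈ Finset.range j, (n - s * dd l)) :=
        (Real.rpow_sum_of_pos (by norm_num) _ _).symm
    _ = _ := by
        rw [Finset.sum_sub_distrib, ← Finset.mul_sum, sum_dd]
        simp [mul_comm]

lemma num2 (θ : ℕ → Fin n → ℝ) (h0 : ∀ l i, 0 ≤ θ l i) (h1 : ∀ l i, θ l i ≤ 1)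
    (s : ℝ) (hs : ∀ l, ∑ i, θ l i = s) (j : ℕ) (ρ : ℝ)
    (hρ1 : RR (j + 1) ≤ ρ) (hρj : ρ < RR j) :
    ∏ i, (36 * (ρ / RR j) + ((1 : ℝ) / 2) ^ ff θ j i) ≤
      (2 : ℝ) ^ (7 * (n : ℝ)) * (ρ / RR j) ^ s := by
  have hR := RR_pos j
  have hρ0 : 0 < ρ := (RR_pos _).trans_le hρ1
  set u := ρ / RR j with hu
  have hu0 : 0 < u := by positivity
  have hu1 : u ≤ 1 := by rw [hu, div_le_one hR]; exact hρj.le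
  have hdu : (2 : ℝ) ^ (-(dd j : ℝ)) ≤ 32 * u := by
    rw [hu, ← mul_div_assoc, le_div_iff₀ hR]
    refine le_trans (le_of_eq ?_) (mul_le_mul_of_nonneg_left hρ1 (by norm_num))
    rw [← half_pow]
    unfold RR
    rw [← dd_add j, pow_add, pow_add]
    norm_num
    ring
  have hi : ∀ i, 36 * u + ((1 : ℝ) / 2) ^ ff θ j i ≤ (2 : ℝ) ^ (7 : ℝ) * u ^ θ j i := by
    intro i
    have e1 : u ≤ u ^ θ j i := by
      calc u = u ^ (1 : ℝ) := (Real.rpow_one u).symm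
        _ ≤ _ := Real.rpow_le_rpow_of_exponent_ge hu0 hu1 (h1 j i)
    have e2 : ((1 : ℝ) / 2) ^ ff θ j i ≤ 64 * u ^ θ j i := by
      calc ((1 : ℝ) / 2) ^ ff θ j i ≤ (2 : ℝ) ^ (1 - θ j i * dd j) := half_ff_le θ j i
        _ = 2 * ((2 : ℝ) ^ (-(dd j : ℝ))) ^ θ j i := by
            rw [← Real.rpow_mul (by norm_num), sub_eq_add_neg, Real.rpow_add (by norm_num),
              Real.rpow_one]
            congr 2
            ring
        _ ≤ 2 * (32 * u) ^ θ j i := by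
            gcongr
            exact h0 j i
        _ = 2 * ((32 : ℝ) ^ θ j i * u ^ θ j i) := by
            rw [Real.mul_rpow (by norm_num) hu0.le]
        _ ≤ 2 * ((32 : ℝ) ^ (1 : ℝ) * u ^ θ j i) := by
            gcongr
            · norm_num
            · exact h1 j i
        _ = _ := by rw [Real.rpow_one]; ring
    have e3 : (2 : ℝ) ^ (7 : ℝ) = 128 := by norm_num
    have e4 : 0 < u ^ θ j i := Real.rpow_pos_of_pos hu0 _
    rw [e3]
    linarith
  calc _ ≤ ∏ i, ((2 : ℝ) ^ (7 : ℝ) * u ^ θ j i) :=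
        Finset.prod_le_prod (fun i _ => by positivity) fun i _ => hi i
    _ = _ := by
        rw [Finset.prod_mul_distrib, ← Real.rpow_sum_of_pos hu0, hs, Finset.prod_const,
          Finset.card_univ, Fintype.card_fin, Real.rpow_mul (by norm_num), Real.rpow_natCast]

lemma num3 (θ : ℕ → Fin n → ℝ) (h0 : ∀ l i, 0 ≤ θ l i) (h1 : ∀ l i, θ l i ≤ 1)
    (s : ℝ) (hs : ∀ l, ∑ i, θ l i = s) (j : ℕ) (ρ s' : ℝ) (hs' : s' < s)
    (hρ1 : RR (j + 1) ≤ ρ) (hρj : ρ < RR j) (hj : 13 * n * ((j : ℝ) + 1) ≤ (s - s') * NN j) :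
    (∏ l ∈ Finset.range j, ∏ i, ((1 : ℝ) / 2) ^ ff θ l i) *
      ∏ i, (36 * (ρ / RR j) + ((1 : ℝ) / 2) ^ ff θ j i) ≤ ρ ^ s' := by
  have hR := RR_pos j
  have hρ0 : 0 < ρ := (RR_pos _).trans_le hρ1
  have hsn : s ≤ n := by
    rw [← hs 0]
    calc ∑ i, θ 0 i ≤ ∑ i : Fin n, (1 : ℝ) := Finset.sum_le_sum fun i _ => h1 0 i
      _ = n := by simp
  have hk := mul_le_mul (num1 θ s hs j) (num2 θ h0 h1 s hs j ρ hρ1 hρj)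
    (by positivity) (by positivity)
  refine hk.trans ?_
  have e1 : (ρ / RR j) ^ s = ρ ^ s' * ρ ^ (s - s') * (2 : ℝ) ^ (s * NN j) := by
    rw [Real.div_rpow hρ0.le hR.le, RR_eq, ← Real.rpow_mul (by norm_num), ← Real.rpow_add hρ0,
      div_eq_mul_inv, ← Real.rpow_neg (by norm_num)]
    congr 2 <;> ring
  have e2 : ρ ^ (s - s') ≤ (2 : ℝ) ^ (-(NN j : ℝ) * (s - s')) := by
    rw [Real.rpow_mul (by norm_num), ← RR_eq]
    exact Real.rpow_le_rpow hρ0.le hρj.le (by linarith)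
  rw [e1]
  have hp : 0 < ρ ^ s' := Real.rpow_pos_of_pos hρ0 _
  calc (2 : ℝ) ^ (n * j - s * (NN j - 5 - 5 * j)) *
        ((2 : ℝ) ^ (7 * (n : ℝ)) * (ρ ^ s' * ρ ^ (s - s') * (2 : ℝ) ^ (s * NN j)))
      ≤ (2 : ℝ) ^ (n * j - s * (NN j - 5 - 5 * j)) *
        ((2 : ℝ) ^ (7 * (n : ℝ)) * (ρ ^ s' * (2 : ℝ) ^ (-(NN j : ℝ) * (s - s')) *
          (2 : ℝ) ^ (s * NN j))) := by gcongr
    _ = ρ ^ s' * (2 : ℝ) ^ ((n * j - s * (NN j - 5 - 5 * j)) + 7 * (n : ℝ) +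
          (-(NN j : ℝ) * (s - s')) + s * NN j) := by
        rw [Real.rpow_add (by norm_num), Real.rpow_add (by norm_num), Real.rpow_add (by norm_num)]
        ring
    _ ≤ ρ ^ s' * 1 := by
        refine mul_le_mul_of_nonneg_left ?_ hp.le
        refine Real.rpow_le_one_of_one_le_of_nonpos (by norm_num) ?_
        have : (0 : ℝ) ≤ j := Nat.cast_nonneg j
        have : (0 : ℝ) ≤ n := Nat.cast_nonneg n
        nlinarith
    _ = ρ ^ s' := mul_one _

theorem le_dimH_xx (θ : ℕ → Fin n → ℝ) (h0 : ∀ l i, 0 ≤ θ l i) (h1 : ∀ l i, θ l i ≤ 1)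
    (s : ℝ) (hs : ∀ l, ∑ i, θ l i = s)
    (he : ∀ l i, |e l i| ≤ 1) (hc : ∀ l, |e l (c l)| = 1) :
    ENNReal.ofReal s ≤ dimH (range (xx (ff θ) e c)) := by
  refine le_dimH_range_of_mass (mu (ff θ)) (xx (ff θ) e c)
    (continuous_xx (ff θ) e c he).measurable s ?_
  intro s' _ hs'
  obtain ⟨j₀, hj₀⟩ := eventually_atTop.1 (ev_lin (s - s') (13 * n) (by linarith))
  refine ⟨RR j₀, RR_pos _, fun ρ hρ hρ0 U hU => ?_⟩
  have hex : ∃ j, RR (j + 1) ≤ ρ := by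
    obtain ⟨j, hj⟩ := (tendsto_RR.eventually (gt_mem_nhds hρ)).exists
    exact ⟨j, (RR_anti (Nat.le_succ j)).trans hj.le⟩
  classical
  have hj1 := Nat.find_spec hex
  set j := Nat.find hex with hj
  have hjj : j₀ ≤ j := by
    by_contra h
    push Not at h
    exact absurd (hj1.trans_lt hρ0) (not_lt.2 (RR_anti h))
  have hρj : ρ < RR j := by
    rcases Nat.eq_zero_or_pos j with h | h
    · have : j₀ = 0 := by omega
      rw [h, ← this]; exact hρ0
    · have := Nat.find_min hex (m := j - 1) (by omega)
      rw [Nat.sub_add_cancel h] at this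
      exact not_le.1 this
  refine (mass (ff θ) e c (hf_ff θ h0 h1) he hc j ρ hj1 hρj U hU).trans ?_
  exact ENNReal.ofReal_le_ofReal (num3 θ h0 h1 s hs j ρ s' hs' hj1 hρj (hj₀ j hjj))


lemma num4 (T t' : ℝ) (ht' : 0 ≤ t') (j : ℕ) (N : ℝ)
    (h : N ≤ (2 : ℝ) ^ ((n : ℝ) * NN j + T * NN (j + 1) + 3 * n))
    (hj : (4 * n + 4 * t') * NN j ≤ (t' - T) * NN (j + 1)) :
    N * (16 * RR (j + 1)) ^ t' ≤ 1 := by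
  have e1 : (16 * RR (j + 1)) ^ t' = (2 : ℝ) ^ ((4 - (NN (j + 1) : ℝ)) * t') := by
    rw [Real.rpow_mul (by norm_num), sub_eq_add_neg, Real.rpow_add (by norm_num), ← RR_eq]
    norm_num
  rw [e1]
  calc N * (2 : ℝ) ^ ((4 - (NN (j + 1) : ℝ)) * t')
      ≤ (2 : ℝ) ^ ((n : ℝ) * NN j + T * NN (j + 1) + 3 * n) *
        (2 : ℝ) ^ ((4 - (NN (j + 1) : ℝ)) * t') := by gcongr
    _ = (2 : ℝ) ^ (((n : ℝ) * NN j + T * NN (j + 1) + 3 * n) + (4 - (NN (j + 1) : ℝ)) * t') := by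
        rw [← Real.rpow_add (by norm_num)]
    _ ≤ 1 := by
        refine Real.rpow_le_one_of_one_le_of_nonpos (by norm_num) ?_
        have h1 : (1 : ℝ) ≤ NN j := by
          have := le_NN j
          exact_mod_cast (by omega : 1 ≤ NN j)
        have : (0 : ℝ) ≤ n := Nat.cast_nonneg n
        nlinarith

lemma sum_ff_le (θ : ℕ → Fin n → ℝ) (h0 : ∀ l i, 0 ≤ θ l i) (h1 : ∀ l i, θ l i ≤ 1) (j : ℕ) :
    ∑ l ∈ Finset.range j, ∑ i, ff θ l i ≤ n * NN j := by
  induction j with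
  | zero => simp
  | succ j ih =>
    rw [Finset.sum_range_succ]
    have h2 : ∑ i, ff θ j i ≤ n * dd j := by
      calc ∑ i, ff θ j i ≤ ∑ i : Fin n, dd j := Finset.sum_le_sum fun i _ => ff_le_dd θ h0 h1 j i
        _ = _ := by simp
    have := dd_add j
    rw [← this]
    nlinarith

lemma prod_eq (g : ℕ → Fin n → ℕ) (j : ℕ) :
    ∏ p : Fin j × Fin n, 2 ^ g p.1 p.2 = 2 ^ (∑ l ∈ Finset.range j, ∑ i, g l i) := by
  rw [Finset.prod_pow_eq_pow_sum, Fintype.sum_prod_type,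
    ← Fin.sum_univ_eq_sum_range (fun l => ∑ i, g l i)]

lemma prod_le (θ : ℕ → Fin n → ℝ) (h0 : ∀ l i, 0 ≤ θ l i) (h1 : ∀ l i, θ l i ≤ 1) (j : ℕ) :
    ((∏ p : Fin j × Fin n, 2 ^ ff θ p.1 p.2 : ℕ) : ℝ) ≤ (2 : ℝ) ^ ((n : ℝ) * NN j) := by
  rw [prod_eq (ff θ)]
  have h : 2 ^ (∑ l ∈ Finset.range j, ∑ i, ff θ l i) ≤ 2 ^ (n * NN j) :=
    Nat.pow_le_pow_right (by norm_num) (sum_ff_le θ h0 h1 j)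
  calc ((2 ^ (∑ l ∈ Finset.range j, ∑ i, ff θ l i) : ℕ) : ℝ) ≤ ((2 ^ (n * NN j) : ℕ) : ℝ) := by
        exact_mod_cast h
    _ = _ := by push_cast; rw [← Real.rpow_natCast]; push_cast; rfl

lemma pow_ff_le (θ : ℕ → Fin n → ℝ) (h0 : ∀ l i, 0 ≤ θ l i) (j : ℕ) (i : Fin n) :
    (2 : ℝ) ^ ff θ j i ≤ (2 : ℝ) ^ (θ j i * NN (j + 1)) := by
  rw [← Real.rpow_natCast]
  refine Real.rpow_le_rpow_of_exponent_le (by norm_num) ((ff_le θ h0 j i).trans ?_)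
  have h2 : (dd j : ℝ) ≤ NN (j + 1) := by
    have := dd_add j
    exact_mod_cast (by omega : dd j ≤ NN (j + 1))
  exact mul_le_mul_of_nonneg_left h2 (h0 j i)

lemma ev_RR (δ : ℝ) (hδ : 0 < δ) : ∀ᶠ j : ℕ in atTop, 16 * RR (j + 1) ≤ δ := by
  have h : Tendsto (fun j => 16 * RR (j + 1)) atTop (𝓝 (16 * 0)) :=
    ((tendsto_add_atTop_iff_nat 1).2 tendsto_RR).const_mul 16
  rw [mul_zero] at h
  filter_upwards [h.eventually (gt_mem_nhds hδ)] with j hj using hj.le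

/-- Points of faces. -/
noncomputable def face (E : Fin n → ℝ) (p : Om f × (Fin n → Icc (-1 : ℝ) 1)) : Fin n → ℝ :=
  fun i => xx f e c p.1 i + rad f c p.1 * (if E i = 0 then (p.2 i : ℝ) else E i)

lemma face_dist (he : ∀ l i, |e l i| ≤ 1) (ω ω' : Om f) (j : ℕ) (i : Fin n)
    (hag : ∀ l < j, ∀ i, ω (l, i) = ω' (l, i)) (hj : i ≠ c j → ω (j, i) = ω' (j, i)) :
    |(xx f e c ω i + rad f c ω * e j i) - (xx f e c ω' i + rad f c ω' * e j i)|
      ≤ 12 * RR (j + 1) := by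
  set F : Om f → ℕ → ℝ := fun ω l => vv f e c ω i l + e j i * dg f l (c l) ω with hF
  have hFb : ∀ ω l, |F ω l| ≤ 3 * RR l := by
    intro ω l
    have h1 := abs_vv_le f e c he ω i l
    have h2 := abs_dg_le f l (c l) ω
    have h3 : |e j i * dg f l (c l) ω| ≤ RR l := by
      rw [abs_mul]
      nlinarith [he j i, abs_nonneg (e j i), abs_nonneg (dg f l (c l) ω)]
    have := abs_add_le (vv f e c ω i l) (e j i * dg f l (c l) ω)
    simp only [hF]
    linarith
  have hsum : ∀ ω, xx f e c ω i + rad f c ω * e j i = ∑' l, F ω l + e j i := by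
    intro ω
    simp only [hF]
    rw [(summable_of_RR (fun l => abs_vv_le f e c he ω i l)).tsum_add
      ((summable_of_RR (fun l => abs_dg_le f l (c l) ω)).mul_left _), tsum_mul_left]
    unfold xx rad
    ring
  have h := tail_le (hFb ω) (hFb ω') (j + 1)
  have h0 : ∑ l ∈ Finset.range (j + 1), (F ω l - F ω' l) = 0 := by
    refine Finset.sum_eq_zero fun l hl => ?_
    have hl' := Finset.mem_range.1 hl
    simp only [hF]
    unfold vv dg
    rcases Nat.lt_or_ge l j with hlj | hlj
    · rw [hag l hlj i, hag l hlj (c l)]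
      ring
    · obtain rfl : l = j := by omega
      by_cases hi : i = c l
      · simp only [if_pos hi]; ring
      · simp only [if_neg hi]; rw [hj hi]; ring
  rw [h0, sub_zero] at h
  rw [hsum, hsum, show ∑' l, F ω l + e j i - (∑' l, F ω' l + e j i) =
    ∑' l, F ω l - ∑' l, F ω' l by ring]
  linarith

theorem dimH_xx_le (θ : ℕ → Fin n → ℝ) (h0 : ∀ l i, 0 ≤ θ l i) (h1 : ∀ l i, θ l i ≤ 1)
    (s : ℝ) (hs0 : 0 ≤ s) (hs : ∀ l, ∑ i, θ l i = s) (he : ∀ l i, |e l i| ≤ 1) :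
    dimH (range (xx (ff θ) e c)) ≤ ENNReal.ofReal s := by
  classical
  refine dimH_range_le_of_label _ s hs0 fun t' ht' δ hδ => ?_
  obtain ⟨j, hj1, hj2⟩ := ((ev_RR δ hδ).and
    (ev_fact (t' - s) (4 * n + 4 * t') (by linarith))).exists
  refine ⟨Fin (j + 1) × Fin n → ℕ, Fintype.piFinset fun p => Finset.range (2 ^ ff θ p.1 p.2),
    fun ω p => (ω (p.1, p.2) : ℕ), 16 * RR (j + 1), by have := RR_pos (j + 1); positivity, hj1,
    ?_, ?_, ?_⟩
  · intro ω
    rw [Fintype.mem_piFinset]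
    exact fun p => Finset.mem_range.2 (ω (p.1, p.2)).2
  · intro ω ω' h
    have hR := RR_pos (j + 1)
    refine (dist_pi_le_iff (by positivity)).2 fun i => ?_
    have h2 := tail_le (fun l => abs_vv_le (ff θ) e c he ω i l)
      (fun l => abs_vv_le (ff θ) e c he ω' i l) (j + 1)
    have hag : ∀ l < j + 1, ∀ i, ω (l, i) = ω' (l, i) := fun l hl i =>
      Fin.ext (congrFun h (⟨l, hl⟩, i))
    have h3 : ∑ l ∈ Finset.range (j + 1), (vv (ff θ) e c ω i l - vv (ff θ) e c ω' i l) = 0 := by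
      refine Finset.sum_eq_zero fun l hl => ?_
      have hl' := Finset.mem_range.1 hl
      unfold vv dg
      rw [hag l hl' i, hag l hl' (c l)]
      ring
    rw [h3, sub_zero] at h2
    rw [Real.dist_eq]
    unfold xx
    linarith
  · refine num4 (n := n) s t' (by linarith) j _ ?_ hj2
    rw [Fintype.card_piFinset]
    simp only [Finset.card_range]
    rw [prod_eq (ff θ), Finset.sum_range_succ, pow_add, ← prod_eq (ff θ)]
    rw [Nat.cast_mul, Real.rpow_add (by norm_num), Real.rpow_add (by norm_num)]
    have a1 := prod_le θ h0 h1 j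
    have a2 : ((2 ^ (∑ i, ff θ j i) : ℕ) : ℝ) ≤ (2 : ℝ) ^ (s * NN (j + 1)) := by
      rw [← hs j, Finset.sum_mul, Real.rpow_sum_of_pos (by norm_num), ← Finset.prod_pow_eq_pow_sum]
      push_cast
      exact Finset.prod_le_prod (fun i _ => by positivity) fun i _ => pow_ff_le θ h0 j i
    have a3 : (1 : ℝ) ≤ (2 : ℝ) ^ (3 * (n : ℝ)) :=
      Real.one_le_rpow (by norm_num) (by positivity)
    calc _ ≤ (2 : ℝ) ^ ((n : ℝ) * NN j) * (2 : ℝ) ^ (s * NN (j + 1)) := by gcongr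
      _ ≤ _ := le_mul_of_one_le_right (by positivity) a3

theorem dimH_face_le (θ : ℕ → Fin n → ℝ) (h0 : ∀ l i, 0 ≤ θ l i) (h1 : ∀ l i, θ l i ≤ 1)
    (he : ∀ l i, |e l i| ≤ 1) (E : Fin n → ℝ) (hE : ∃ᶠ j in atTop, e j = E) (T : ℝ) (hT : 0 ≤ T)
    (hET : ∀ j, e j = E →
      ∑ i, (if E i = 0 then 1 else if i = c j then 0 else θ j i) ≤ T) :
    dimH (range (face (ff θ) e c E)) ≤ ENNReal.ofReal T := by
  classical
  have hEb : ∀ i, |E i| ≤ 1 := by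
    obtain ⟨j, hj⟩ := hE.exists
    rw [← hj]; exact he j
  refine dimH_range_le_of_label _ T hT fun t' ht' δ hδ => ?_
  obtain ⟨j, hjE, hj1, hj2⟩ := (hE.and_eventually ((ev_RR δ hδ).and
    (ev_fact (t' - T) (4 * n + 4 * t') (by linarith)))).exists
  have hR := RR_pos (j + 1)
  have hfb : ∀ p i, |face (ff θ) e c E p i| ≤ 2 := by
    intro p i
    unfold face
    have b1 := abs_xx_le (ff θ) e c he p.1 i
    have b2 := rad_le (ff θ) c p.1
    have b3 := one_le_rad (ff θ) c p.1
    have b4 : |if E i = 0 then (p.2 i : ℝ) else E i| ≤ 1 := by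
      split_ifs
      · exact abs_le.2 (p.2 i).2
      · exact hEb i
    have b5 := abs_add_le (xx (ff θ) e c p.1 i)
      (rad (ff θ) c p.1 * (if E i = 0 then (p.2 i : ℝ) else E i))
    rw [abs_mul, abs_of_pos (by linarith : 0 < rad (ff θ) c p.1)] at b5
    nlinarith [abs_nonneg (if E i = 0 then (p.2 i : ℝ) else E i)]
  set b : Fin n → ℕ := fun i =>
    if E i = 0 then 8 * 2 ^ NN (j + 1) else if i = c j then 1 else 2 ^ ff θ j i with hb
  refine ⟨(Fin j × Fin n → ℕ) × (Fin n → ℕ),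
    (Fintype.piFinset fun p => Finset.range (2 ^ ff θ p.1 p.2)) ×ˢ
      (Fintype.piFinset fun i => Finset.range (b i)),
    fun p => (fun q => (p.1 (q.1, q.2) : ℕ), fun i =>
      if E i = 0 then ⌊(face (ff θ) e c E p i + 2) * 2 ^ NN (j + 1)⌋₊
      else if i = c j then 0 else (p.1 (j, i) : ℕ)),
    16 * RR (j + 1), by positivity, hj1, ?_, ?_, ?_⟩
  · intro p
    rw [Finset.mem_product, Fintype.mem_piFinset, Fintype.mem_piFinset]
    refine ⟨fun q => Finset.mem_range.2 (p.1 (q.1, q.2)).2, fun i => Finset.mem_range.2 ?_⟩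
    simp only [hb]
    split_ifs
    · have h3 := (abs_le.1 (hfb p i))
      have h4 : (0 : ℝ) < 2 ^ NN (j + 1) := by positivity
      rw [Nat.floor_lt (by nlinarith [h3.1])]
      push_cast
      nlinarith [h3.2]
    · norm_num
    · exact (p.1 (j, i)).2
  · intro p p' h
    have hag : ∀ l < j, ∀ i, p.1 (l, i) = p'.1 (l, i) := fun l hl i =>
      Fin.ext (congrFun (congrArg Prod.fst h) (⟨l, hl⟩, i))
    refine (dist_pi_le_iff (by positivity)).2 fun i => ?_
    have hi := congrFun (congrArg Prod.snd h) i
    simp only at hi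
    rw [Real.dist_eq]
    by_cases hEi : E i = 0
    · rw [if_pos hEi, if_pos hEi] at hi
      have h4 : (0 : ℝ) < 2 ^ NN (j + 1) := by positivity
      have k1 := (abs_le.1 (hfb p i)).1
      have k2 := (abs_le.1 (hfb p' i)).1
      have f1 := Nat.floor_le (a := (face (ff θ) e c E p i + 2) * 2 ^ NN (j + 1)) (by nlinarith)
      have f2 := Nat.floor_le (a := (face (ff θ) e c E p' i + 2) * 2 ^ NN (j + 1)) (by nlinarith)
      have f3 := Nat.lt_floor_add_one ((face (ff θ) e c E p i + 2) * 2 ^ NN (j + 1))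
      have f4 := Nat.lt_floor_add_one ((face (ff θ) e c E p' i + 2) * 2 ^ NN (j + 1))
      rw [hi] at f1 f3
      have h5 : RR (j + 1) * 2 ^ NN (j + 1) = 1 := by
        unfold RR; rw [← mul_pow]; norm_num
      have h6 : |face (ff θ) e c E p i - face (ff θ) e c E p' i| ≤ RR (j + 1) := by
        refine le_of_mul_le_mul_right ?_ h4
        have h7 : |face (ff θ) e c E p i - face (ff θ) e c E p' i| * 2 ^ NN (j + 1) =
            |(face (ff θ) e c E p i - face (ff θ) e c E p' i) * 2 ^ NN (j + 1)| := by
          rw [abs_mul, abs_of_pos h4]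
        rw [h5, h7, abs_le]
        constructor <;> nlinarith
      linarith
    · rw [if_neg hEi, if_neg hEi] at hi
      unfold face
      rw [if_neg hEi, ← hjE]
      have := face_dist (ff θ) e c he p.1 p'.1 j i hag (fun hne => by
        rw [if_neg hne, if_neg hne] at hi
        exact Fin.ext hi)
      rw [if_neg (by rw [hjE]; exact hEi)]
      linarith
  · refine num4 (n := n) T t' (by linarith) j _ ?_ hj2
    rw [Finset.card_product, Fintype.card_piFinset, Fintype.card_piFinset]
    simp only [Finset.card_range]
    rw [Nat.cast_mul, add_assoc, Real.rpow_add (by norm_num)]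
    have a1 := prod_le θ h0 h1 j
    have a2 : ((∏ i, b i : ℕ) : ℝ) ≤ (2 : ℝ) ^ (T * NN (j + 1) + 3 * n) := by
      have hbi : ∀ i, (b i : ℝ) ≤
          (2 : ℝ) ^ ((if E i = 0 then 1 else if i = c j then 0 else θ j i) * NN (j + 1) + 3) := by
        intro i
        rw [Real.rpow_add (by norm_num), show (2 : ℝ) ^ (3 : ℝ) = 8 by norm_num]
        simp only [hb]
        split_ifs
        · rw [one_mul, Real.rpow_natCast]; push_cast; linarith
        · simp
        · have := pow_ff_le θ h0 j i
          have h5 : (0 : ℝ) < 2 ^ ff θ j i := by positivity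
          push_cast
          linarith
      push_cast
      calc ∏ i, (b i : ℝ) ≤ ∏ i, (2 : ℝ) ^
            ((if E i = 0 then 1 else if i = c j then 0 else θ j i) * NN (j + 1) + 3) :=
            Finset.prod_le_prod (fun i _ => by positivity) fun i _ => hbi i
        _ = (2 : ℝ) ^ ((∑ i, (if E i = 0 then 1 else if i = c j then 0 else θ j i)) * NN (j + 1)
              + 3 * n) := by
            rw [← Real.rpow_sum_of_pos (by norm_num), Finset.sum_add_distrib, ← Finset.sum_mul]
            simp [mul_comm]
        _ ≤ _ := by
            refine Real.rpow_le_rpow_of_exponent_le (by norm_num) ?_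
            have := mul_le_mul_of_nonneg_right (hET j hjE)
              (Nat.cast_nonneg (NN (j + 1)) : (0 : ℝ) ≤ _)
            linarith
    gcongr

end Construction


lemma exists_weights (n k : ℕ) (hk : k < n) (s : ℝ) (hs₀ : 0 ≤ s) (hsn : s ≤ n) :
    ∃ w t : ℝ, 0 ≤ w ∧ w ≤ 1 ∧ 0 ≤ t ∧ t ≤ 1 ∧
      ((n - k - 1 : ℕ) : ℝ) * w + ((k + 1 : ℕ) : ℝ) * t = s ∧
      ((n - k - 1 : ℕ) : ℝ) * w + k ≤ max (s - 1) k := by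
  rcases le_or_gt s (k + 1) with h | h
  · refine ⟨0, s / (k + 1), le_rfl, zero_le_one, by positivity,
      (div_le_one (by positivity)).2 h, ?_, ?_⟩
    · push_cast; field_simp; ring
    · simp
  · have hm : (0 : ℝ) < (n - k - 1 : ℕ) := by
      have : (k : ℝ) + 1 < n := by linarith
      have h2 : k + 1 < n := by exact_mod_cast this
      exact_mod_cast (by omega : 0 < n - k - 1)
    have hm2 : ((n - k - 1 : ℕ) : ℝ) = n - k - 1 := by
      rw [Nat.sub_sub, Nat.cast_sub hk]; push_cast; ring
    refine ⟨(s - (k + 1)) / (n - k - 1 : ℕ), 1, div_nonneg (by linarith) hm.le,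
      (div_le_one hm).2 (by rw [hm2]; linarith), zero_le_one, le_rfl, ?_, ?_⟩
    · rw [mul_div_cancel₀ _ hm.ne']; push_cast; ring
    · rw [mul_div_cancel₀ _ hm.ne']; refine le_trans (le_of_eq ?_) (le_max_left _ _); ring

/-- Face directions: sign vectors with `n - k` nonzero entries and a marked nonzero entry. -/
abbrev FT (n k : ℕ) : Type :=
  {p : (Fin n → SignType) × Fin n //
    (Finset.univ.filter fun i => p.1 i ≠ 0).card = n - k ∧ p.1 p.2 ≠ 0}

/-- The real sign vector. -/
def sv {n k : ℕ} (p : FT n k) (i : Fin n) : ℝ := ((p.1.1 i : SignType) : ℝ)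

lemma sv_eq_zero {n k : ℕ} (p : FT n k) (i : Fin n) : sv p i = 0 ↔ p.1.1 i = 0 := by
  unfold sv
  cases p.1.1 i <;> simp

lemma abs_sv {n k : ℕ} (p : FT n k) (i : Fin n) : |sv p i| ≤ 1 := by
  unfold sv
  cases p.1.1 i <;> simp

lemma abs_sv_of {n k : ℕ} (p : FT n k) (i : Fin n) (h : p.1.1 i ≠ 0) : |sv p i| = 1 := by
  unfold sv
  revert h
  cases p.1.1 i <;> simp

lemma exists_seq (n k : ℕ) (hk : k < n) : ∃ σ : ℕ → FT n k, ∀ p, ∃ᶠ j in atTop, σ j = p := by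
  classical
  obtain ⟨A, hA⟩ := Finset.exists_subset_card_eq
    (s := (Finset.univ : Finset (Fin n))) (n := n - k) (by simp)
  have hne : A.Nonempty := by rw [← Finset.card_pos]; omega
  obtain ⟨a, ha⟩ := hne
  have : Nonempty (FT n k) := by
    refine ⟨⟨(fun i => if i ∈ A then 1 else 0, a), ?_, ?_⟩⟩
    · rw [← hA.2]
      congr 1
      ext i
      simp
    · simp [ha]
  obtain ⟨g, hg⟩ := exists_surjective_nat (FT n k)
  refine ⟨fun j => g (Nat.unpair j).1, fun p => ?_⟩
  obtain ⟨m, hm⟩ := hg p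
  rw [frequently_atTop]
  intro N
  refine ⟨Nat.pair m N, Nat.right_le_pair m N, ?_⟩
  simp [hm]

lemma card_marked {n k : ℕ} (p : FT n k) :
    (Finset.univ.filter fun i => p.1.1 i ≠ 0 ∧ i ≠ p.1.2).card = n - k - 1 := by
  classical
  have h : (Finset.univ.filter fun i => p.1.1 i ≠ 0 ∧ i ≠ p.1.2) =
      (Finset.univ.filter fun i => p.1.1 i ≠ 0).erase p.1.2 := by
    ext i; simp [and_comm]
  rw [h, Finset.card_erase_of_mem (by simpa using p.2.2), p.2.1]

theorem core (n k : ℕ) (hk : k < n) (s : ℝ) (hs₀ : 0 ≤ s) (hsn : s ≤ n) :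
    ∃ S B : Set (Fin n → ℝ), IsCompact S ∧ IsCompact B ∧ dimH S = ENNReal.ofReal s ∧
      (∀ x ∈ S, ∃ r > (0 : ℝ), ∀ y : Fin n → ℝ, (∀ i, |y i - x i| ≤ r) →
        n - k ≤ {i | |y i - x i| = r}.ncard → y ∈ B) ∧
      dimH B ≤ ENNReal.ofReal (max (s - 1) k) := by
  classical
  obtain ⟨w, t, hw0, hw1, ht0, ht1, hsum, hmax⟩ := exists_weights n k hk s hs₀ hsn
  obtain ⟨σ, hσ⟩ := exists_seq n k hk
  set e : ℕ → Fin n → ℝ := fun j => sv (σ j) with he_def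
  set c : ℕ → Fin n := fun j => (σ j).1.2 with hc_def
  set θ : ℕ → Fin n → ℝ := fun j i =>
    if (σ j).1.1 i ≠ 0 ∧ i ≠ (σ j).1.2 then w else t with hθ_def
  have h0 : ∀ l i, 0 ≤ θ l i := fun l i => by simp only [hθ_def]; split_ifs <;> assumption
  have h1 : ∀ l i, θ l i ≤ 1 := fun l i => by simp only [hθ_def]; split_ifs <;> assumption
  have he : ∀ l i, |e l i| ≤ 1 := fun l i => abs_sv _ _
  have hc : ∀ l, |e l (c l)| = 1 := fun l => abs_sv_of _ _ (σ l).2.2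
  have hs : ∀ l, ∑ i, θ l i = s := by
    intro l
    simp only [hθ_def]
    rw [Finset.sum_ite, Finset.sum_const, Finset.sum_const, nsmul_eq_mul, nsmul_eq_mul,
      card_marked]
    have h2 := Finset.card_filter_add_card_filter_not (s := (Finset.univ : Finset (Fin n)))
      (fun i => (σ l).1.1 i ≠ 0 ∧ i ≠ (σ l).1.2)
    rw [card_marked, Finset.card_univ, Fintype.card_fin] at h2
    rw [show (Finset.univ.filter fun i => ¬ ((σ l).1.1 i ≠ 0 ∧ i ≠ (σ l).1.2)).card = k + 1 by
      omega]
    exact hsum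
  have hmax0 : (0 : ℝ) ≤ max (s - 1) k := le_max_of_le_right (Nat.cast_nonneg k)
  refine ⟨range (xx (ff θ) e c), ⋃ p : FT n k, range (face (ff θ) e c (sv p)),
    isCompact_range (continuous_xx _ e c he), ?_, ?_, ?_, ?_⟩
  · refine isCompact_iUnion fun p => isCompact_range ?_
    have c1 := continuous_xx (ff θ) e c he
    have c2 := continuous_rad (ff θ) c
    refine continuous_pi fun i => ?_
    unfold face
    refine (((continuous_apply i).comp c1).comp continuous_fst).add
      ((c2.comp continuous_fst).mul ?_)
    split_ifs
    · exact continuous_subtype_val.comp ((continuous_apply i).comp continuous_snd)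
    · exact continuous_const
  · exact le_antisymm (dimH_xx_le e c θ h0 h1 s hs₀ hs he) (le_dimH_xx e c θ h0 h1 s hs he hc)
  · rintro _ ⟨ω, rfl⟩
    have hr : 0 < rad (ff θ) c ω := lt_of_lt_of_le one_pos (one_le_rad _ c ω)
    refine ⟨rad (ff θ) c ω, hr, fun y hy hcard => ?_⟩
    set x := xx (ff θ) e c ω with hx
    set r := rad (ff θ) c ω with hrdef
    have hcard' : n - k ≤ (Finset.univ.filter fun i => |y i - x i| = r).card := by
      rw [Set.ncard_eq_toFinset_card'] at hcard
      simpa using hcard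
    obtain ⟨A, hAsub, hA⟩ := Finset.exists_subset_card_eq hcard'
    have hAr : ∀ i ∈ A, |y i - x i| = r := fun i hi => (Finset.mem_filter.1 (hAsub hi)).2
    have hne : ∀ i ∈ A, y i - x i ≠ 0 := fun i hi h => by
      have := hAr i hi
      rw [h, abs_zero] at this
      linarith
    obtain ⟨a, ha⟩ : A.Nonempty := by rw [← Finset.card_pos]; omega
    have hz : ∀ i, (if i ∈ A then SignType.sign (y i - x i) else 0) ≠ 0 ↔ i ∈ A := by
      intro i
      split_ifs with h
      · simp [h, hne i h]
      · simp [h]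
    let p : FT n k := ⟨(fun i => if i ∈ A then SignType.sign (y i - x i) else 0, a), by
      simp only [hz]; simpa using hA, (hz a).2 ha⟩
    refine mem_iUnion.2 ⟨p, ⟨(ω, fun i => ⟨(y i - x i) / r, ?_⟩), ?_⟩⟩
    · have := abs_le.1 (hy i)
      constructor
      · rw [le_div_iff₀ hr]; linarith
      · rw [div_le_iff₀ hr]; linarith
    · funext i
      unfold face
      simp only [sv_eq_zero]
      rw [← hx, ← hrdef]
      by_cases hi : i ∈ A
      · have h3 : p.1.1 i ≠ 0 := (hz i).2 hi
        rw [if_neg h3]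
        have h4 : sv p i = ((SignType.sign (y i - x i) : SignType) : ℝ) := by
          simp [sv, p, hi]
        rw [h4, ← hAr i hi, mul_comm, sign_mul_abs]
        ring
      · have h3 : p.1.1 i = 0 := by simp [p, hi]
        rw [if_pos h3]
        field_simp
        ring
  · rw [dimH_iUnion]
    refine iSup_le fun p => ?_
    refine dimH_face_le e c θ h0 h1 he (sv p) ?_ _ hmax0 ?_
    · exact (hσ p).mono fun j hj => by simp only [he_def, hj]
    · intro j hj
      have hz : ∀ i, sv p i = 0 ↔ (σ j).1.1 i = 0 := fun i => by
        rw [← hj]; exact sv_eq_zero _ _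
      refine le_trans ?_ hmax
      have hle : ∀ i, (if sv p i = 0 then (1 : ℝ) else if i = c j then 0 else θ j i) =
          (if (σ j).1.1 i = 0 then (1 : ℝ) else 0) +
          (if (σ j).1.1 i ≠ 0 ∧ i ≠ (σ j).1.2 then w else 0) := by
        intro i
        simp only [hz, hθ_def, hc_def]
        by_cases q1 : (σ j).1.1 i = 0 <;> by_cases q2 : i = (σ j).1.2 <;> simp [q1, q2]
      rw [Finset.sum_congr rfl fun i _ => hle i, Finset.sum_add_distrib, Finset.sum_ite,
        Finset.sum_ite]
      simp only [Finset.sum_const, Finset.sum_const_zero, nsmul_eq_mul, add_zero, mul_one]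
      rw [card_marked]
      have h2 := Finset.card_filter_add_card_filter_not (s := (Finset.univ : Finset (Fin n)))
        (fun i => (σ j).1.1 i = 0)
      have h3 := (σ j).2.1
      rw [h3, Finset.card_univ, Fintype.card_fin] at h2
      rw [show (Finset.univ.filter fun i => (σ j).1.1 i = 0).card = k by omega]
      linarith

end Thornton


/-- **Thornton's conjecture (Chang–Csörnyei–Héra–Keleti).** For `0 ≤ k < n` and
`s ∈ [0, n]` there exist compact sets `S, B ⊆ ℝⁿ` with `dimH S = s`, `B` containing the
`k`-skeleton of an axis-parallel cube centered at every point of `S`, and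
`dimH B = max (s - 1) k`. -/
theorem thornton_conjecture (n k : ℕ) (hk : k < n) (s : ℝ) (hs₀ : 0 ≤ s) (hsn : s ≤ n) :
    ∃ S B : Set (EuclideanSpace ℝ (Fin n)), IsCompact S ∧ IsCompact B ∧
      dimH S = ENNReal.ofReal s ∧
      (∀ x ∈ S, ∃ r > (0 : ℝ), cubeSkeleton n k x r ⊆ B) ∧
      dimH B = max (ENNReal.ofReal (s - 1)) (k : ℝ≥0∞) := by
  have hkn : (k : ℝ) ≤ n := by exact_mod_cast hk.le
  have hm0 : (0 : ℝ) ≤ max (s - 1) k := le_max_of_le_right (Nat.cast_nonneg k)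
  obtain ⟨S, B, hS, hB, hdS, hsk, hdB⟩ := Thornton.core n k hk s hs₀ hsn
  obtain ⟨Z, _, hZ, _, hdZ, _, _⟩ := Thornton.core n k hk (max (s - 1) k) hm0
    (max_le (by linarith) hkn)
  let L := (EuclideanSpace.equiv (Fin n) ℝ).symm
  refine ⟨L '' S, L '' (B ∪ Z), hS.image L.continuous, (hB.union hZ).image L.continuous, ?_, ?_, ?_⟩
  · rw [ContinuousLinearEquiv.dimH_image, hdS]
  · rintro _ ⟨x, hx, rfl⟩
    obtain ⟨r, hr, hy⟩ := hsk x hx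
    refine ⟨r, hr, fun y hyy => ⟨fun i => y i, Or.inl (hy _ hyy.1 hyy.2), rfl⟩⟩
  · rw [ContinuousLinearEquiv.dimH_image, dimH_union, hdZ, max_eq_right hdB,
      ENNReal.ofReal_max, ENNReal.ofReal_natCast]
end
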